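/- Let u ≥ 2 and let F be a fixed nice u-graph with r = v(F) ≥ 4 vertices, and fix g = g(n) with g(n) → ∞ and g(n) = o(log n/log log n). Then one may couple the random u-graph process (G_t)_{t=0}^{N} on [n] with the random F-graph process (H_t)_{t=0}^{M} on [n] so that the following holds with probability tending to 1 as n → ∞: every F-edge of H_{T_H} that is not present as a copy of F (a subgraph) in G_{T_G} has a partner F-edge among the F-edges added to the F-graph process strictly between times T_H and T_H + ⌊g(n)·n⌋. That is, with E = {F-edges of H_{T_H} whose copy of F is not a subgraph of G_{T_G}} and 𝓕 = {F-edges of H_{T_H} that have a partner F-edge in H_{T_H + ⌊g(n)·n⌋} \ H_{T_H}}, whp E ⊆ 𝓕. -/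

import Mathlib

open Classical Filter Asymptotics MeasureTheory
open scoped ENNReal

noncomputable section

/-- The type of potential `F`-edges on vertex set `Fin n`: a pair consisting of the
`r`-element vertex set of the copy and the `u`-edge set of the copy. -/
abbrev FE (n : ℕ) := Finset (Fin n) × Finset (Finset (Fin n))

/-- `F` (a `u`-graph on `Fin r`) is strictly 1-balanced: every proper subgraph `(V', E')`
with more than one vertex has strictly smaller 1-density, i.e.
`e'/(v'-1) < e(F)/(r-1)`, written multiplicatively. -/
def StrictlyOneBalanced {r : ℕ} (F : Finset (Finset (Fin r))) : Prop :=
  ∀ (V' : Finset (Fin r)) (E' : Finset (Finset (Fin r))),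
    E' ⊆ F → (∀ e ∈ E', e ⊆ V') → 1 < V'.card → ¬(V' = Finset.univ ∧ E' = F) →
      E'.card * (r - 1) < F.card * (V'.card - 1)

/-- After deleting the vertices in `S`, the hypergraph `F` is connected. -/
def ConnectedAvoiding {r : ℕ} (F : Finset (Finset (Fin r))) (S : Finset (Fin r)) : Prop :=
  ∀ x y : Fin r, x ∉ S → y ∉ S →
    Relation.ReflTransGen (fun a b => ∃ e ∈ F, Disjoint e S ∧ a ∈ e ∧ b ∈ e) x y

/-- `F` is 3-connected: at least 4 vertices, and no set of at most 2 vertices disconnects it. -/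
def ThreeConnected {r : ℕ} (F : Finset (Finset (Fin r))) : Prop :=
  4 ≤ r ∧ ∀ S : Finset (Fin r), S.card ≤ 2 → ConnectedAvoiding F S

/-- Two edge sets on `Fin r` are isomorphic via a permutation of the vertices. -/
def EdgeIso {r : ℕ} (F F' : Finset (Finset (Fin r))) : Prop :=
  ∃ σ : Equiv.Perm (Fin r), F.image (fun e => e.image (fun x => σ x)) = F'

/-- `F` is nice: strictly 1-balanced, 3-connected and either `u ≥ 3` or `u = 2` and `F`
cannot be transformed into an isomorphic graph by adding one edge and deleting one edge. -/
def Nice {r : ℕ} (u : ℕ) (F : Finset (Finset (Fin r))) : Prop :=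
  StrictlyOneBalanced F ∧ ThreeConnected F ∧
    (3 ≤ u ∨ (u = 2 ∧ ¬ ∃ a b : Finset (Fin r), a.card = u ∧ a ∉ F ∧ b ∈ F ∧
      EdgeIso (insert a (F.erase b)) F))

/-- `h` is an `F`-edge on `[n]`: a copy of `F`, recorded as its (`r`-element) vertex set
together with its `u`-edge set. -/
def IsFEdge {r : ℕ} (F : Finset (Finset (Fin r))) (n : ℕ) (h : FE n) : Prop :=
  ∃ φ : Fin r ↪ Fin n, h.1 = Finset.univ.map φ ∧ h.2 = F.image (fun e => e.map φ)

/-- All possible `F`-edges on `[n]`. -/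
def allFEdges {r : ℕ} (F : Finset (Finset (Fin r))) (n : ℕ) : Finset (FE n) :=
  Finset.univ.filter (fun h => IsFEdge F n h)

/-- `M`, the total number of `F`-edges on `[n]`. -/
def Mnum {r : ℕ} (F : Finset (Finset (Fin r))) (n : ℕ) : ℕ := (allFEdges F n).card

/-- All `u`-element subsets of `[n]`. -/
def allUEdges (u n : ℕ) : Finset (Finset (Fin n)) :=
  Finset.univ.filter (fun e : Finset (Fin n) => e.card = u)

/-- The number of automorphisms of `F`. -/
def autCard {r : ℕ} (F : Finset (Finset (Fin r))) : ℕ :=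
  Fintype.card {σ : Equiv.Perm (Fin r) // F.image (fun e => e.image (fun x => σ x)) = F}

/-- The degree of a vertex `v` in an `F`-graph `H`. -/
def degFE {n : ℕ} (H : Finset (FE n)) (v : Fin n) : ℕ :=
  (H.filter (fun h => v ∈ h.1)).card

/-- Two `F`-edges are partners if their vertex sets share exactly `u` vertices. -/
def Partner (u : ℕ) {n : ℕ} (h h' : FE n) : Prop :=
  h ≠ h' ∧ (h.1 ∩ h'.1).card = u

/-- The state at time `t` of the process induced by the ordering `f`. -/
def proc {α : Type*} [DecidableEq α] {m : ℕ} (f : Fin m → α) (t : ℕ) : Finset α :=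
  (Finset.univ.filter (fun i : Fin m => (i : ℕ) < t)).image f

/-- A valid ordering of all `u`-element subsets of `[n]`. -/
def ValidOrdU (u n : ℕ) (f : Fin (Nat.choose n u) → Finset (Fin n)) : Prop :=
  Function.Injective f ∧ ∀ e : Finset (Fin n), e.card = u → ∃ i, f i = e

/-- A valid ordering of all `r`-element subsets of `[n]`. -/
def ValidOrdR (r n : ℕ) (f : Fin (Nat.choose n r) → Finset (Fin n)) : Prop :=
  Function.Injective f ∧ ∀ e : Finset (Fin n), e.card = r → ∃ i, f i = e

/-- A valid ordering of all `F`-edges on `[n]`. -/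
def ValidOrdH {r : ℕ} (F : Finset (Finset (Fin r))) (n : ℕ)
    (f : Fin (Mnum F n) → FE n) : Prop :=
  Function.Injective f ∧ ∀ h : FE n, IsFEdge F n h → ∃ i, f i = h

/-- `T_H`: the first time at which the `F`-graph process has no isolated vertices. -/
def THit {r : ℕ} (F : Finset (Finset (Fin r))) (n : ℕ) (f : Fin (Mnum F n) → FE n) : ℕ :=
  sInf {t : ℕ | ∀ v : Fin n, ∃ h ∈ proc f t, v ∈ h.1}

/-- `T_E`: the first time at which the `r`-uniform hypergraph process has no isolated
vertices. -/
def TEHit (r n : ℕ) (f : Fin (Nat.choose n r) → Finset (Fin n)) : ℕ :=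
  sInf {t : ℕ | ∀ v : Fin n, ∃ e ∈ proc f t, v ∈ e}

/-- `T_G`: the first time at which every vertex of `[n]` lies in a copy of `F` in the
`u`-graph process. -/
def TGHit (u : ℕ) {r : ℕ} (F : Finset (Finset (Fin r))) (n : ℕ)
    (f : Fin (Nat.choose n u) → Finset (Fin n)) : ℕ :=
  sInf {t : ℕ | ∀ v : Fin n, ∃ h : FE n, IsFEdge F n h ∧ v ∈ h.1 ∧ h.2 ⊆ proc f t}

/-- The random variable `X` is uniformly distributed over `{a | P a}` under `μ`. -/
def UniformOn {Ω α : Type*} (μ : PMF Ω) (X : Ω → α) (P : α → Prop) : Prop :=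
  μ.toOuterMeasure {ω | P (X ω)} = 1 ∧
    ∀ a b : α, P a → P b →
      μ.toOuterMeasure {ω | X ω = a} = μ.toOuterMeasure {ω | X ω = b}

/-- Under `μ`, the random set `X` contains each element of `all` independently with
probability `p` (a Bernoulli product / binomial random subset distribution). -/
def BernoulliVia {Ω E : Type*} (μ : PMF Ω) (X : Ω → Finset E)
    (all : Finset E) (p : ℝ) : Prop :=
  ∀ A : Finset E, μ.toOuterMeasure {ω | X ω = A} =
    if A ⊆ all then ENNReal.ofReal (p ^ A.card * (1 - p) ^ (all.card - A.card)) else 0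

/-- The function `g` tends to infinity and is `o(log n / log log n)`. -/
def GoodG (g : ℕ → ℝ) : Prop :=
  Tendsto g atTop atTop ∧ g =o[atTop] fun n : ℕ => Real.log n / Real.log (Real.log n)

/-- `π₊`, the probability at the end of the critical window. -/
def piPlus {r : ℕ} (F : Finset (Finset (Fin r))) (g : ℕ → ℝ) (n : ℕ) : ℝ :=
  ((autCard F : ℝ) / (Nat.factorial r : ℝ)) *
    ((Real.log n + g n) / ((n - 1).choose (r - 1) : ℝ))

/-- `π₋`, the probability at the start of the critical window. -/
def piMinus {r : ℕ} (F : Finset (Finset (Fin r))) (g : ℕ → ℝ) (n : ℕ) : ℝ :=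
  ((autCard F : ℝ) / (Nat.factorial r : ℝ)) *
    ((Real.log n - g n) / ((n - 1).choose (r - 1) : ℝ))

/-- `p₊ = (π₊/(1-n^{-δ}))^{1/s}` where `s = e(F)`. -/
def pPlus {r : ℕ} (F : Finset (Finset (Fin r))) (g : ℕ → ℝ) (δ : ℝ) (n : ℕ) : ℝ :=
  (piPlus F g n / (1 - (n : ℝ) ^ (-δ))) ^ ((1 : ℝ) / (F.card : ℝ))

/-- Connectivity (as a multihypergraph of vertex sets) of a set of `F`-edges. -/
def ConnFE {n : ℕ} (S : Finset (FE n)) : Prop :=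
  ∀ a ∈ S, ∀ b ∈ S,
    Relation.ReflTransGen (fun x y : FE n => x ∈ S ∧ y ∈ S ∧ (x.1 ∩ y.1).Nonempty) a b

/-- The multihypergraph of vertex sets of the `F`-edges of `H` contains an avoidable
configuration: a connected `S ⊆ H` with nullity `(r-1)e(S)+1-v(S) > 1` and
`e(S) ≤ 2^(r+1)`. -/
def HasAvoidable (r : ℕ) {n : ℕ} (H : Finset (FE n)) : Prop :=
  ∃ S ⊆ H, S.Nonempty ∧ ConnFE S ∧
    (S.sup Prod.fst).card < (r - 1) * S.card ∧ S.card ≤ 2 ^ (r + 1)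

/-- `G` contains an `F`-factor: pairwise vertex-disjoint copies of `F`, each a subgraph
of `G`, whose vertex sets partition `[n]`. -/
def HasFFactor {r : ℕ} (F : Finset (Finset (Fin r))) (n : ℕ)
    (G : Finset (Finset (Fin n))) : Prop :=
  ∃ C : Finset (FE n), (∀ h ∈ C, IsFEdge F n h ∧ h.2 ⊆ G) ∧
    (∀ h ∈ C, ∀ h' ∈ C, h ≠ h' → Disjoint h.1 h'.1) ∧
    C.sup Prod.fst = Finset.univ ∧ C.card * r = n

/-! ### Bernoulli random subsets -/

section Bern

variable {α : Type*} [DecidableEq α]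

/-- Bernoulli weight of the subset `S` of `A`. -/
def bw (A : Finset α) (p : ℝ) (S : Finset α) : ℝ := p ^ S.card * (1 - p) ^ (A \ S).card

/-- Bernoulli expectation. -/
def bE (A : Finset α) (p : ℝ) (f : Finset α → ℝ) : ℝ := ∑ S ∈ A.powerset, bw A p S * f S

lemma bw_nonneg (A : Finset α) {p : ℝ} (h0 : 0 ≤ p) (h1 : p ≤ 1) (S : Finset α) :
    0 ≤ bw A p S := by
  have : 0 ≤ 1 - p := by linarith
  unfold bw; positivity

lemma bw_insert_of_notMem {A S : Finset α} {a : α} (ha : a ∉ A) (hS : S ⊆ A) (p : ℝ) :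
    bw (insert a A) p S = (1 - p) * bw A p S := by
  unfold bw
  rw [Finset.insert_sdiff_of_notMem _ (fun h => ha (hS h)), Finset.card_insert_of_notMem
    (fun h => ha (Finset.mem_sdiff.1 h).1)]
  ring

lemma bw_insert_insert {A S : Finset α} {a : α} (ha : a ∉ A) (hS : S ⊆ A) (p : ℝ) :
    bw (insert a A) p (insert a S) = p * bw A p S := by
  unfold bw
  rw [Finset.insert_sdiff_insert, Finset.card_insert_of_notMem (fun h => ha (hS h)),
    Finset.sdiff_insert_of_notMem ha]
  ring

lemma bE_insert {A : Finset α} {a : α} (ha : a ∉ A) (p : ℝ) (f : Finset α → ℝ) :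
    bE (insert a A) p f = p * bE A p (fun S => f (insert a S)) + (1 - p) * bE A p f := by
  unfold bE
  rw [Finset.sum_powerset_insert ha, add_comm, Finset.mul_sum, Finset.mul_sum]
  congr 1
  · refine Finset.sum_congr rfl fun S hS => ?_
    rw [bw_insert_insert ha (Finset.mem_powerset.1 hS)]; ring
  · refine Finset.sum_congr rfl fun S hS => ?_
    rw [bw_insert_of_notMem ha (Finset.mem_powerset.1 hS)]; ring

lemma bE_congr {A : Finset α} {p : ℝ} {f g : Finset α → ℝ} (h : ∀ S, S ⊆ A → f S = g S) :
    bE A p f = bE A p g :=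
  Finset.sum_congr rfl fun S hS => by rw [h S (Finset.mem_powerset.1 hS)]

lemma bE_mono {A : Finset α} {p : ℝ} (h0 : 0 ≤ p) (h1 : p ≤ 1) {f g : Finset α → ℝ}
    (h : ∀ S, S ⊆ A → f S ≤ g S) : bE A p f ≤ bE A p g :=
  Finset.sum_le_sum fun S hS =>
    mul_le_mul_of_nonneg_left (h S (Finset.mem_powerset.1 hS)) (bw_nonneg A h0 h1 S)

lemma bE_nonneg {A : Finset α} {p : ℝ} (h0 : 0 ≤ p) (h1 : p ≤ 1) {f : Finset α → ℝ}
    (h : ∀ S, S ⊆ A → 0 ≤ f S) : 0 ≤ bE A p f :=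
  Finset.sum_nonneg fun S hS =>
    mul_nonneg (bw_nonneg A h0 h1 S) (h S (Finset.mem_powerset.1 hS))

lemma bE_add (A : Finset α) (p : ℝ) (f g : Finset α → ℝ) :
    bE A p (fun S => f S + g S) = bE A p f + bE A p g := by
  unfold bE; rw [← Finset.sum_add_distrib]; exact Finset.sum_congr rfl fun S _ => by ring

lemma bE_sub (A : Finset α) (p : ℝ) (f g : Finset α → ℝ) :
    bE A p (fun S => f S - g S) = bE A p f - bE A p g := by
  unfold bE; rw [← Finset.sum_sub_distrib]; exact Finset.sum_congr rfl fun S _ => by ring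

lemma bE_mul_left (A : Finset α) (p c : ℝ) (f : Finset α → ℝ) :
    bE A p (fun S => c * f S) = c * bE A p f := by
  unfold bE; rw [Finset.mul_sum]; exact Finset.sum_congr rfl fun S _ => by ring

lemma bE_sum {β : Type*} (A : Finset α) (p : ℝ) (s : Finset β) (f : β → Finset α → ℝ) :
    bE A p (fun S => ∑ b ∈ s, f b S) = ∑ b ∈ s, bE A p (f b) := by
  unfold bE; rw [Finset.sum_comm]
  exact Finset.sum_congr rfl fun S _ => by rw [Finset.mul_sum]

lemma bE_prod (A : Finset α) (p : ℝ) (c d : α → ℝ) :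
    bE A p (fun S => ∏ a ∈ A, if a ∈ S then c a else d a)
      = ∏ a ∈ A, (p * c a + (1 - p) * d a) := by
  rw [Finset.prod_add]
  unfold bE
  refine Finset.sum_congr rfl fun S hS => ?_
  have hS := Finset.mem_powerset.1 hS
  have : (∏ a ∈ A, if a ∈ S then c a else d a) = (∏ a ∈ S, c a) * ∏ a ∈ A \ S, d a := by
    rw [← Finset.prod_sdiff hS, mul_comm]
    congr 1
    · exact Finset.prod_congr rfl fun a ha => if_pos ha
    · exact Finset.prod_congr rfl fun a ha => if_neg (Finset.mem_sdiff.1 ha).2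
  beta_reduce
  rw [this, Finset.prod_mul_distrib, Finset.prod_mul_distrib, Finset.prod_const,
    Finset.prod_const]
  unfold bw; ring

lemma bE_one (A : Finset α) (p : ℝ) : bE A p (fun _ => 1) = 1 := by
  have := bE_prod A p (fun _ => 1) (fun _ => 1)
  simpa using this

lemma bE_const (A : Finset α) (p c : ℝ) : bE A p (fun _ => c) = c := by
  have := bE_mul_left A p c (fun _ => 1)
  simpa [bE_one] using this

lemma bE_superset {A T : Finset α} (hT : T ⊆ A) (p : ℝ) :
    bE A p (fun S => if T ⊆ S then 1 else 0) = p ^ T.card := by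
  have h := bE_prod A p (fun _ => 1) (fun a => if a ∈ T then 0 else 1)
  rw [bE_congr (g := fun S => ∏ a ∈ A, if a ∈ S then (1:ℝ) else if a ∈ T then 0 else 1), h]
  · rw [← Finset.prod_sdiff hT]
    have h1 : ∀ a ∈ A \ T, p * 1 + (1 - p) * (if a ∈ T then (0:ℝ) else 1) = 1 := by
      intro a ha; rw [if_neg (Finset.mem_sdiff.1 ha).2]; ring
    have h2 : ∀ a ∈ T, p * 1 + (1 - p) * (if a ∈ T then (0:ℝ) else 1) = p := by
      intro a ha; rw [if_pos ha]; ring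
    rw [Finset.prod_congr rfl h1, Finset.prod_congr rfl h2]
    simp
  · intro S hS
    split_ifs with h
    · symm; apply Finset.prod_eq_one
      intro a _
      by_cases haS : a ∈ S
      · simp [haS]
      · have : a ∉ T := fun h' => haS (h h')
        simp [this]
    · symm
      obtain ⟨a, haT, haS⟩ := Finset.not_subset.1 h
      apply Finset.prod_eq_zero (hT haT)
      simp [haS, haT]

/-- Harris' inequality. -/
lemma harris (A : Finset α) {p : ℝ} (h0 : 0 ≤ p) (h1 : p ≤ 1) :
    ∀ (f g : Finset α → ℝ), Antitone f → Antitone g →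
      bE A p f * bE A p g ≤ bE A p (fun S => f S * g S) := by
  induction A using Finset.induction_on with
  | empty => intro f g _ _; simp [bE, bw]
  | insert a A ha ih =>
    intro f g hf hg
    have hf1 : Antitone fun S => f (insert a S) := fun S T h =>
      hf (Finset.insert_subset_insert a h)
    have hg1 : Antitone fun S => g (insert a S) := fun S T h =>
      hg (Finset.insert_subset_insert a h)
    rw [bE_insert ha, bE_insert ha, bE_insert ha]
    have i1 := ih _ _ hf1 hg1
    have i0 := ih _ _ hf hg
    have mf : bE A p (fun S => f (insert a S)) ≤ bE A p f :=
      bE_mono h0 h1 fun S _ => hf (Finset.subset_insert a S)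
    have mg : bE A p (fun S => g (insert a S)) ≤ bE A p g :=
      bE_mono h0 h1 fun S _ => hg (Finset.subset_insert a S)
    set x1 := bE A p (fun S => f (insert a S))
    set y1 := bE A p (fun S => g (insert a S))
    set x0 := bE A p f
    set y0 := bE A p g
    have h1' : 0 ≤ 1 - p := by linarith
    have e1 := mul_le_mul_of_nonneg_left i1 h0
    have e0 := mul_le_mul_of_nonneg_left i0 h1'
    have e2 : 0 ≤ p * (1 - p) * ((x0 - x1) * (y0 - y1)) :=
      mul_nonneg (mul_nonneg h0 h1') (mul_nonneg (by linarith) (by linarith))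
    nlinarith

lemma harris_prod {ι : Type*} (A : Finset α) {p : ℝ} (h0 : 0 ≤ p) (h1 : p ≤ 1) (s : Finset ι)
    (f : ι → Finset α → ℝ) (hf : ∀ i, Antitone (f i)) (hn : ∀ i S, 0 ≤ f i S) :
    ∏ i ∈ s, bE A p (f i) ≤ bE A p (fun S => ∏ i ∈ s, f i S) := by
  induction s using Finset.induction_on with
  | empty => simp [bE_one]
  | insert i s hi ih =>
    simp only [Finset.prod_insert hi]
    have ha : Antitone (fun S => ∏ i ∈ s, f i S) := fun S T h =>
      Finset.prod_le_prod (fun i _ => hn i T) (fun i _ => hf i h)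
    refine le_trans ?_ (harris A h0 h1 _ _ (hf i) ha)
    exact mul_le_mul_of_nonneg_left ih (bE_nonneg h0 h1 fun S _ => hn i S)

lemma eI_step {A Y : Finset α} {e : α} (heA : e ∈ A) (heY : e ∉ Y) (p : ℝ) (f : Finset α → ℝ) :
    bE A p (fun S => if insert e Y ⊆ S then f S else 0)
      = p * bE (A.erase e) p (fun S => if Y ⊆ S then f (insert e S) else 0) ∧
    bE A p (fun S => if Y ⊆ S then f S else 0)
      = p * bE (A.erase e) p (fun S => if Y ⊆ S then f (insert e S) else 0)
        + (1 - p) * bE (A.erase e) p (fun S => if Y ⊆ S then f S else 0) := by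
  have hA : A = insert e (A.erase e) := (Finset.insert_erase heA).symm
  have hne : e ∉ A.erase e := Finset.notMem_erase e A
  constructor
  · conv_lhs => rw [hA]
    rw [bE_insert hne]
    have z : bE (A.erase e) p (fun S => if insert e Y ⊆ S then f S else 0) = 0 := by
      rw [bE_congr (g := fun _ => 0), bE_const]
      intro S hS
      rw [if_neg]
      intro h
      exact hne (hS (h (Finset.mem_insert_self e Y)))
    rw [z, mul_zero, add_zero]
    congr 1
    apply bE_congr
    intro S hS
    have : insert e Y ⊆ insert e S ↔ Y ⊆ S := by
      constructor
      · intro h x hx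
        have := h (Finset.mem_insert_of_mem hx)
        rcases Finset.mem_insert.1 this with rfl | h'
        · exact absurd hx heY
        · exact h'
      · exact fun h => Finset.insert_subset_insert e h
    simp only [this]
  · conv_lhs => rw [hA]
    rw [bE_insert hne]
    congr 2
    apply bE_congr
    intro S hS
    have : Y ⊆ insert e S ↔ Y ⊆ S := by
      constructor
      · intro h x hx
        rcases Finset.mem_insert.1 (h hx) with rfl | h'
        · exact absurd hx heY
        · exact h'
      · exact fun h => h.trans (Finset.subset_insert e S)
    simp only [this]

lemma eI_le {A Y : Finset α} {p : ℝ} (h0 : 0 ≤ p) (h1 : p ≤ 1) (f : Finset α → ℝ)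
    (hf : Antitone f) (Z : Finset α) (hZ : Z ⊆ A) (hYZ : Disjoint Z Y) :
    bE A p (fun S => if Z ∪ Y ⊆ S then f S else 0)
      ≤ p ^ Z.card * bE A p (fun S => if Y ⊆ S then f S else 0) := by
  induction Z using Finset.induction_on with
  | empty => simp
  | insert e Z he ih =>
    have hZ' := (Finset.insert_subset_iff.1 hZ)
    have hd := Finset.disjoint_insert_left.1 hYZ
    have heU : e ∉ Z ∪ Y := by simp [he, hd.1]
    obtain ⟨a, b⟩ := eI_step hZ'.1 heU p f
    rw [Finset.insert_union, Finset.card_insert_of_notMem he, pow_succ]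
    have key : bE A p (fun S => if insert e (Z ∪ Y) ⊆ S then f S else 0)
        ≤ p * bE A p (fun S => if Z ∪ Y ⊆ S then f S else 0) := by
      rw [a, b]
      apply mul_le_mul_of_nonneg_left _ h0
      have : bE (A.erase e) p (fun S => if Z ∪ Y ⊆ S then f (insert e S) else 0)
          ≤ bE (A.erase e) p (fun S => if Z ∪ Y ⊆ S then f S else 0) := by
        apply bE_mono h0 h1
        intro S _
        split_ifs
        · exact hf (Finset.subset_insert e S)
        · exact le_rfl
      nlinarith
    calc _ ≤ _ := key
      _ ≤ p * (p ^ Z.card * bE A p (fun S => if Y ⊆ S then f S else 0)) :=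
        mul_le_mul_of_nonneg_left (ih hZ'.2 hd.2) h0
      _ = _ := by ring

lemma eI_eq {A Y : Finset α} {p : ℝ} (f : Finset α → ℝ)
    (Z : Finset α) (hZ : Z ⊆ A) (hYZ : Disjoint Z Y)
    (hf : ∀ e ∈ Z, ∀ S, Y ⊆ S → f (insert e S) = f S) :
    bE A p (fun S => if Z ∪ Y ⊆ S then f S else 0)
      = p ^ Z.card * bE A p (fun S => if Y ⊆ S then f S else 0) := by
  induction Z using Finset.induction_on with
  | empty => simp
  | insert e Z he ih =>
    have hZ' := (Finset.insert_subset_iff.1 hZ)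
    have hd := Finset.disjoint_insert_left.1 hYZ
    have heU : e ∉ Z ∪ Y := by simp [he, hd.1]
    obtain ⟨a, b⟩ := eI_step hZ'.1 heU p f
    rw [Finset.insert_union, Finset.card_insert_of_notMem he, pow_succ]
    have key : bE A p (fun S => if insert e (Z ∪ Y) ⊆ S then f S else 0)
        = p * bE A p (fun S => if Z ∪ Y ⊆ S then f S else 0) := by
      rw [a, b]
      have : bE (A.erase e) p (fun S => if Z ∪ Y ⊆ S then f (insert e S) else 0)
          = bE (A.erase e) p (fun S => if Z ∪ Y ⊆ S then f S else 0) := by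
        apply bE_congr
        intro S _
        split_ifs with h
        · exact hf e (Finset.mem_insert_self e Z) S (Finset.subset_union_right.trans h)
        · rfl
      rw [this]; ring
    rw [key, ih hZ'.2 hd.2 (fun e' he' => hf e' (Finset.mem_insert_of_mem he'))]
    ring

end Bern



/-! ### The exploration coupling -/

section Explore

variable {α ι : Type*} [DecidableEq α] [DecidableEq ι]

/-- The indicator that all of `R` is present and none of `N` is present in `G`. -/
def ynI (E : ι → Finset α) (R N : Finset ι) (G : Finset α) : ℝ :=
  if R.biUnion E ⊆ G then (if ∀ i ∈ N, ¬ E i ⊆ G then 1 else 0) else 0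

lemma ynI_nonneg (E : ι → Finset α) (R N : Finset ι) (G : Finset α) : 0 ≤ ynI E R N G := by
  unfold ynI; split_ifs <;> norm_num

lemma ynI_split (E : ι → Finset α) (R N : Finset ι) (j : ι) (G : Finset α) :
    ynI E R N G = ynI E (insert j R) N G + ynI E R (insert j N) G := by
  unfold ynI
  simp only [Finset.biUnion_insert, Finset.union_subset_iff, Finset.mem_insert,
    forall_eq_or_imp]
  by_cases h1 : R.biUnion E ⊆ G <;> by_cases h2 : E j ⊆ G <;>
    by_cases h3 : ∀ i ∈ N, ¬ E i ⊆ G <;> simp [h1, h2, h3]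

/-- The greedy good sub-collection. -/
def greedy (Good : Finset ι → Prop) : List ι → Finset ι → Finset ι → Finset ι
  | [], R, _ => R
  | j :: L, R, H => if j ∈ H ∧ Good (insert j R) then greedy Good L (insert j R) H
      else greedy Good L R H

lemma greedy_congr (Good : Finset ι → Prop) (L : List ι) :
    ∀ (R H H' : Finset ι), (∀ j ∈ L, j ∈ H ↔ j ∈ H') → greedy Good L R H = greedy Good L R H' := by
  induction L with
  | nil => intro R H H' _; rfl
  | cons j L ih =>
    intro R H H' h
    have hj := h j (by simp)
    have hL : ∀ i ∈ L, i ∈ H ↔ i ∈ H' := fun i hi => h i (by simp [hi])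
    simp only [greedy, hj, ih _ H H' hL]

lemma greedy_subset (Good : Finset ι → Prop) (L : List ι) :
    ∀ (R H : Finset ι), R ⊆ greedy Good L R H ∧ greedy Good L R H ⊆ R ∪ H := by
  induction L with
  | nil => intro R H; exact ⟨subset_rfl, Finset.subset_union_left⟩
  | cons j L ih =>
    intro R H
    simp only [greedy]
    split_ifs with h
    · obtain ⟨a, b⟩ := ih (insert j R) H
      refine ⟨(Finset.subset_insert j R).trans a, b.trans ?_⟩
      intro x hx
      simp only [Finset.mem_union, Finset.mem_insert] at hx ⊢
      rcases hx with (rfl | hx) | hx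
      · exact Or.inr h.1
      · exact Or.inl hx
      · exact Or.inr hx
    · exact ih R H

/-- If an element of `H` in the list is skipped by the greedy procedure, it lies in a bad
subset of `R ∪ H`. -/
lemma greedy_removed (Bad : Finset ι → Prop) (L : List ι) :
    ∀ (R H : Finset ι), (∀ S, S ⊆ R → ¬ Bad S) → ∀ j ∈ L, j ∈ H →
      j ∉ greedy (fun R => ∀ S, S ⊆ R → ¬ Bad S) L R H →
      ∃ S, S ⊆ R ∪ H ∧ j ∈ S ∧ Bad S := by
  induction L with
  | nil => intro R H _ j hj; simp at hj
  | cons i L ih =>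
    intro R H hR j hj hjH hng
    simp only [greedy] at hng
    split_ifs at hng with h
    · rcases List.mem_cons.1 hj with rfl | hjL
      · exact absurd ((greedy_subset _ L (insert j R) H).1 (Finset.mem_insert_self j R)) hng
      · obtain ⟨S, hS, hj', hb⟩ := ih (insert i R) H h.2 j hjL hjH hng
        refine ⟨S, hS.trans ?_, hj', hb⟩
        intro x hx
        simp only [Finset.mem_union, Finset.mem_insert] at hx ⊢
        rcases hx with (rfl | hx) | hx
        · exact Or.inr h.1
        · exact Or.inl hx
        · exact Or.inr hx
    · rcases List.mem_cons.1 hj with rfl | hjL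
      · have h2 : ¬ ∀ S, S ⊆ insert j R → ¬ Bad S := fun h' => h ⟨hjH, h'⟩
        push Not at h2
        obtain ⟨S, hS, hb⟩ := h2
        refine ⟨S, ?_, ?_, hb⟩
        · intro x hx
          rcases Finset.mem_insert.1 (hS hx) with rfl | hx'
          · exact Finset.mem_union_right _ hjH
          · exact Finset.mem_union_left _ hx'
        · by_contra hjS
          apply hR S _ hb
          intro x hx
          rcases Finset.mem_insert.1 (hS hx) with rfl | hx'
          · exact absurd hx hjS
          · exact hx'
      · exact ih R H hR j hjL hjH hng

theorem explore (U : Finset α) (p π : ℝ) (hp0 : 0 ≤ p) (hp1 : p ≤ 1) (hπ0 : 0 < π) (hπ1 : π ≤ 1)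
    (E : ι → Finset α) (Good : Finset ι → Prop) (V : Finset ι)
    (hstep : ∀ (R N : Finset ι) (j : ι), R ⊆ V → N ⊆ V → j ∈ V → Good R → Good (insert j R) →
      (∀ i ∈ N, i ∉ R ∧ i ≠ j) →
      π * bE U p (ynI E R N) ≤ bE U p (ynI E (insert j R) N))
    (L : List ι) : L.Nodup → (∀ j ∈ L, j ∈ V) →
    ∀ (R N : Finset ι), R ⊆ V → N ⊆ V → Good R → (∀ i ∈ N, i ∉ R) →
      (∀ j ∈ L, j ∉ R ∧ j ∉ N) →
      ∃ c : Finset ι → Finset α → ℝ, (∀ H G, 0 ≤ c H G) ∧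
        (∀ H, H ⊆ L.toFinset →
          ∑ G ∈ U.powerset, c H G = bw L.toFinset π H * bE U p (ynI E R N)) ∧
        (∀ G, G ⊆ U → ∑ H ∈ L.toFinset.powerset, c H G = bw U p G * ynI E R N G) ∧
        (∀ H G, H ⊆ L.toFinset → c H G ≠ 0 → ∀ i ∈ greedy Good L R H, E i ⊆ G) := by
  induction L with
  | nil =>
    intro _ _ R N _ _ _ _ _
    refine ⟨fun _ G => bw U p G * ynI E R N G, fun H G =>
      mul_nonneg (bw_nonneg U hp0 hp1 G) (ynI_nonneg E R N G), ?_, ?_, ?_⟩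
    · intro H hH
      have : H = ∅ := by simpa using hH
      subst this
      simp [bw, bE]
    · intro G _; simp
    · intro H G _ hc i hi
      have hc2 : ynI E R N G ≠ 0 := right_ne_zero_of_mul hc
      unfold ynI at hc2
      have : R.biUnion E ⊆ G := by
        by_contra h; simp [h] at hc2
      exact (Finset.subset_biUnion_of_mem E hi).trans this
  | cons j L ih =>
    intro hnd hV R N hRV hNV hR hNR hL
    have hjL : j ∉ L := (List.nodup_cons.1 hnd).1
    have hnd' := (List.nodup_cons.1 hnd).2
    have hjV : j ∈ V := hV j (by simp)
    have hV' : ∀ i ∈ L, i ∈ V := fun i hi => hV i (by simp [hi])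
    have hjF : j ∉ L.toFinset := by simpa using hjL
    have hL' : ∀ i ∈ L, i ∉ R ∧ i ∉ N := fun i hi => hL i (by simp [hi])
    have hjR := (hL j (by simp)).1
    have hjN := (hL j (by simp)).2
    obtain ⟨c0, c0n, c0H, c0G, c0g⟩ := ih hnd' hV' R N hRV hNV hR hNR hL'
    rw [List.toFinset_cons]
    have hsub : ∀ H, H ⊆ insert j L.toFinset → H.erase j ⊆ L.toFinset := fun H hH => by
      intro x hx
      have := hH (Finset.mem_of_mem_erase hx)
      rcases Finset.mem_insert.1 this with rfl | h
      · exact absurd hx (Finset.notMem_erase _ _)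
      · exact h
    have hsub2 : ∀ H, H ⊆ insert j L.toFinset → j ∉ H → H ⊆ L.toFinset := fun H hH hj => by
      have := hsub H hH
      rwa [Finset.erase_eq_of_notMem hj] at this
    have hgr : ∀ (R' H : Finset ι), greedy Good L R' (H.erase j) = greedy Good L R' H := by
      intro R' H
      apply greedy_congr
      intro i hi
      have : i ≠ j := fun h => hjL (h ▸ hi)
      simp [this]
    by_cases hg : Good (insert j R)
    · -- the element is tested
      have hRV' : insert j R ⊆ V := Finset.insert_subset hjV hRV
      have hNV' : insert j N ⊆ V := Finset.insert_subset hjV hNV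
      obtain ⟨c1, c1n, c1H, c1G, c1g⟩ := ih hnd' hV' (insert j R) N hRV' hNV hg
        (fun i hi => by
          simp only [Finset.mem_insert, not_or]
          exact ⟨fun h => hjN (h ▸ hi), hNR i hi⟩)
        (fun i hi => by
          simp only [Finset.mem_insert, not_or]
          exact ⟨⟨fun h => hjL (h ▸ hi), (hL' i hi).1⟩, (hL' i hi).2⟩)
      obtain ⟨c2, c2n, c2H, c2G, c2g⟩ := ih hnd' hV' R (insert j N) hRV hNV' hR
        (fun i hi => by
          rcases Finset.mem_insert.1 hi with rfl | h
          · exact hjR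
          · exact hNR i h)
        (fun i hi => by
          simp only [Finset.mem_insert, not_or]
          exact ⟨(hL' i hi).1, fun h => hjL (h ▸ hi), (hL' i hi).2⟩)
      set W := bE U p (ynI E R N) with hW
      set W1 := bE U p (ynI E (insert j R) N) with hW1
      set W2 := bE U p (ynI E R (insert j N)) with hW2
      have hWs : W = W1 + W2 := by
        rw [hW, hW1, hW2, ← bE_add]
        exact bE_congr fun S _ => ynI_split E R N j S
      have hst : π * W ≤ W1 := hstep R N j hRV hNV hjV hR hg
        (fun i hi => ⟨hNR i hi, fun h => hjN (h ▸ hi)⟩)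
      have hW0 : 0 ≤ W := bE_nonneg hp0 hp1 fun S _ => ynI_nonneg _ _ _ _
      have hW10 : 0 ≤ W1 := bE_nonneg hp0 hp1 fun S _ => ynI_nonneg _ _ _ _
      set θ := π * W / W1 with hθ
      have hθ0 : 0 ≤ θ := div_nonneg (mul_nonneg hπ0.le hW0) hW10
      have hθ1 : θ ≤ 1 := div_le_one_of_le₀ hst hW10
      have hθW : θ * W1 = π * W := by
        by_cases h : W1 = 0
        · have : π * W = 0 := le_antisymm (h ▸ hst) (mul_nonneg hπ0.le hW0)
          rw [h, this, mul_zero]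
        · rw [hθ, div_mul_cancel₀ _ h]
      have h1θ : 0 ≤ 1 - θ := by linarith
      refine ⟨fun H G => if j ∈ H then θ * c1 (H.erase j) G
        else θ * c2 H G + (1 - θ) * c0 H G, ?_, ?_, ?_, ?_⟩
      · intro H G
        beta_reduce
        split_ifs
        · exact mul_nonneg hθ0 (c1n _ _)
        · exact add_nonneg (mul_nonneg hθ0 (c2n _ _)) (mul_nonneg h1θ (c0n _ _))
      · intro H hH
        by_cases hjH : j ∈ H
        · simp only [hjH, if_true]
          rw [← Finset.mul_sum, c1H _ (hsub H hH)]
          have : bw (insert j L.toFinset) π H = π * bw L.toFinset π (H.erase j) := by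
            conv_lhs => rw [← Finset.insert_erase hjH]
            exact bw_insert_insert hjF (hsub H hH) π
          rw [this]
          linear_combination bw L.toFinset π (H.erase j) * hθW
        · simp only [hjH, if_false]
          have hH' := hsub2 H hH hjH
          rw [Finset.sum_add_distrib, ← Finset.mul_sum, ← Finset.mul_sum, c2H H hH', c0H H hH',
            bw_insert_of_notMem hjF hH']
          have e : W2 = W - W1 := by linarith
          rw [e]
          linear_combination (-(bw L.toFinset π H)) * hθW
      · intro G hG
        rw [Finset.sum_powerset_insert hjF]
        have e1 : ∑ H ∈ L.toFinset.powerset, (if j ∈ H then θ * c1 (H.erase j) G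
            else θ * c2 H G + (1 - θ) * c0 H G)
            = ∑ H ∈ L.toFinset.powerset, (θ * c2 H G + (1 - θ) * c0 H G) := by
          apply Finset.sum_congr rfl
          intro H hH
          rw [if_neg fun h => hjF (Finset.mem_powerset.1 hH h)]
        have e2 : ∑ H ∈ L.toFinset.powerset, (if j ∈ insert j H then θ * c1 ((insert j H).erase j) G
            else θ * c2 (insert j H) G + (1 - θ) * c0 (insert j H) G)
            = ∑ H ∈ L.toFinset.powerset, θ * c1 H G := by
          apply Finset.sum_congr rfl
          intro H hH
          rw [if_pos (Finset.mem_insert_self j H), Finset.erase_insert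
            fun h => hjF (Finset.mem_powerset.1 hH h)]
        rw [e1, e2, Finset.sum_add_distrib, ← Finset.mul_sum, ← Finset.mul_sum, ← Finset.mul_sum,
          c0G G hG, c1G G hG, c2G G hG, ynI_split E R N j G]
        ring
      · intro H G hH hc i hi
        by_cases hjH : j ∈ H
        · simp only [hjH, if_true] at hc
          simp only [greedy, hjH, hg, and_self, if_true] at hi
          rw [← hgr] at hi
          exact c1g _ G (hsub H hH) (right_ne_zero_of_mul hc) i hi
        · simp only [hjH, if_false] at hc
          simp only [greedy, hjH, false_and, if_false] at hi
          have hH' := hsub2 H hH hjH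
          by_cases h2 : c2 H G = 0
          · rw [h2, mul_zero, zero_add] at hc
            exact c0g H G hH' (right_ne_zero_of_mul hc) i hi
          · exact c2g H G hH' h2 i hi
    · refine ⟨fun H G => (if j ∈ H then π else 1 - π) * c0 (H.erase j) G, ?_, ?_, ?_, ?_⟩
      · intro H G
        apply mul_nonneg _ (c0n _ _)
        split_ifs <;> linarith
      · intro H hH
        rw [← Finset.mul_sum, c0H _ (hsub H hH), ← mul_assoc]
        congr 1
        split_ifs with hjH
        · conv_rhs => rw [← Finset.insert_erase hjH]
          exact (bw_insert_insert hjF (hsub H hH) π).symm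
        · rw [Finset.erase_eq_of_notMem hjH]
          exact (bw_insert_of_notMem hjF (hsub2 H hH hjH) π).symm
      · intro G hG
        rw [Finset.sum_powerset_insert hjF, ← Finset.sum_add_distrib, ← c0G G hG]
        apply Finset.sum_congr rfl
        intro H hH
        have hjH : j ∉ H := fun h => hjF (Finset.mem_powerset.1 hH h)
        beta_reduce
        rw [if_neg hjH, if_pos (Finset.mem_insert_self j H), Finset.erase_insert hjH,
          Finset.erase_eq_of_notMem hjH]
        ring
      · intro H G hH hc i hi
        simp only [greedy, hg, and_false, if_false] at hi
        rw [← hgr] at hi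
        exact c0g _ G (hsub H hH) (right_ne_zero_of_mul hc) i hi

/-- The step estimate for the exploration. -/
lemma explore_step (U : Finset α) (p ε : ℝ) (hp0 : 0 ≤ p) (hp1 : p ≤ 1)
    (E : ι → Finset α) (s : ℕ)
    (R N : Finset ι) (j : ι) (hs : (E j).card ≤ s) (hEU : ∀ i ∈ insert j (R ∪ N), E i ⊆ U)
    (hsum : ∑ i ∈ N with ¬ Disjoint (E i) (E j \ R.biUnion E),
      p ^ (E i \ (E j ∪ R.biUnion E)).card ≤ ε) (hε : ε ≤ 1) :
    p ^ s * (1 - ε) * bE U p (ynI E R N) ≤ bE U p (ynI E (insert j R) N) := by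
  set Y := R.biUnion E with hY
  set N1 := N.filter (fun i => ¬ Disjoint (E i) (E j \ Y)) with hN1
  set N0 := N.filter (fun i => Disjoint (E i) (E j \ Y)) with hN0
  set D : Finset α → ℝ := fun G => if ∀ i ∈ N0, ¬ E i ⊆ G then 1 else 0 with hD
  have hDanti : Antitone D := by
    intro S T hST
    simp only [hD]
    split_ifs with h1 h2
    · exact le_rfl
    · exact absurd (fun i hi h => h1 i hi (h.trans hST)) h2
    · exact zero_le_one
    · exact le_rfl
  have hD0 : ∀ S, 0 ≤ D S := by intro S; simp only [hD]; split_ifs <;> norm_num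
  set Z := E j \ Y with hZ
  have hEj : E j ⊆ U := hEU j (Finset.mem_insert_self _ _)
  have hZU : Z ⊆ U := Finset.sdiff_subset.trans hEj
  have hZY : Disjoint Z Y := Finset.sdiff_disjoint
  set W0 := bE U p (fun S => if Y ⊆ S then D S else 0) with hW0
  have hW00 : 0 ≤ W0 := bE_nonneg hp0 hp1 fun S _ => by
    split_ifs
    · exact hD0 S
    · exact le_rfl
  have hDins : ∀ (Z' : Finset α), Z' ⊆ Z → ∀ (Y' : Finset α), ∀ e ∈ Z', ∀ S, Y' ⊆ S →
      D (insert e S) = D S := by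
    intro Z' hZ' Y' e he S _
    have : ∀ i ∈ N0, (E i ⊆ insert e S ↔ E i ⊆ S) := by
      intro i hi
      have hdis := (Finset.mem_filter.1 hi).2
      have : e ∉ E i := fun h => Finset.disjoint_left.1 hdis h (hZ' he)
      exact Finset.subset_insert_iff_of_notMem this
    simp only [hD]
    congr 1
    apply propext
    exact forall_congr' fun i => forall_congr' fun hi => by rw [this i hi]
  have e1 : bE U p (fun S => if Z ∪ Y ⊆ S then D S else 0) = p ^ Z.card * W0 :=
    eI_eq D Z hZU hZY (hDins Z subset_rfl Y)
  -- pointwise lower bound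
  have hpt : ∀ S, S ⊆ U → (if Z ∪ Y ⊆ S then D S else 0)
      - ∑ i ∈ N1, (if (E i \ (E j ∪ Y)) ∪ (Z ∪ Y) ⊆ S then D S else 0) ≤ ynI E (insert j R) N S := by
    intro S _
    have hZYe : (insert j R).biUnion E = Z ∪ Y := by
      rw [Finset.biUnion_insert, hZ, Finset.sdiff_union_self_eq_union]
    unfold ynI
    rw [hZYe]
    by_cases h1 : Z ∪ Y ⊆ S
    · rw [if_pos h1, if_pos h1]
      by_cases h2 : ∃ i ∈ N1, E i ⊆ S
      · obtain ⟨i, hi, hiS⟩ := h2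
        have : D S ≤ ∑ i ∈ N1, (if (E i \ (E j ∪ Y)) ∪ (Z ∪ Y) ⊆ S then D S else 0) := by
          refine le_trans ?_ (Finset.single_le_sum
            (f := fun i => if (E i \ (E j ∪ Y)) ∪ (Z ∪ Y) ⊆ S then D S else 0) ?_ hi)
          · rw [if_pos]
            exact Finset.union_subset (Finset.sdiff_subset.trans hiS) h1
          · intro i _
            split_ifs
            · exact hD0 S
            · exact le_rfl
        have h3 : (0:ℝ) ≤ if ∀ i ∈ N, ¬ E i ⊆ S then 1 else 0 := by split_ifs <;> norm_num
        linarith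
      · push Not at h2
        have h3 : D S = if ∀ i ∈ N, ¬ E i ⊆ S then 1 else 0 := by
          simp only [hD]
          congr 1
          apply propext
          constructor
          · intro h i hi
            by_cases hd : Disjoint (E i) (E j \ Y)
            · exact h i (Finset.mem_filter.2 ⟨hi, hd⟩)
            · exact h2 i (Finset.mem_filter.2 ⟨hi, hd⟩)
          · intro h i hi
            exact h i (Finset.mem_filter.1 hi).1
        rw [h3]
        have : 0 ≤ ∑ i ∈ N1, (if (E i \ (E j ∪ Y)) ∪ (Z ∪ Y) ⊆ S then D S else 0) :=
          Finset.sum_nonneg fun i _ => by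
            split_ifs
            · exact hD0 S
            · exact le_rfl
        rw [h3] at this
        linarith
    · rw [if_neg h1, if_neg h1]
      have : 0 ≤ ∑ i ∈ N1, (if (E i \ (E j ∪ Y)) ∪ (Z ∪ Y) ⊆ S then D S else 0) :=
        Finset.sum_nonneg fun i _ => by
          split_ifs
          · exact hD0 S
          · exact le_rfl
      linarith
  have hlow := bE_mono hp0 hp1 hpt
  rw [bE_sub, bE_sum, e1] at hlow
  have hterm : ∀ i ∈ N1, bE U p (fun S => if (E i \ (E j ∪ Y)) ∪ (Z ∪ Y) ⊆ S then D S else 0)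
      ≤ p ^ (E i \ (E j ∪ Y)).card * (p ^ Z.card * W0) := by
    intro i hi
    have hiN := (Finset.mem_filter.1 hi).1
    have hiU : E i ⊆ U := hEU i (by simp [hiN])
    rw [← e1]
    apply eI_le hp0 hp1 D hDanti _ (Finset.sdiff_subset.trans hiU)
    rw [Finset.disjoint_left]
    intro x hx hx'
    have h1 := (Finset.mem_sdiff.1 hx).2
    apply h1
    rcases Finset.mem_union.1 hx' with h | h
    · exact Finset.mem_union_left _ (Finset.mem_sdiff.1 h).1
    · exact Finset.mem_union_right _ h
  have hs2 := Finset.sum_le_sum hterm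
  rw [← Finset.sum_mul] at hs2
  have hpz : 0 ≤ p ^ Z.card := pow_nonneg hp0 _
  have hs3 : (∑ i ∈ N1, p ^ (E i \ (E j ∪ Y)).card) * (p ^ Z.card * W0) ≤ ε * (p ^ Z.card * W0) :=
    mul_le_mul_of_nonneg_right hsum (mul_nonneg hpz hW00)
  have hmain : p ^ Z.card * ((1 - ε) * W0) ≤ bE U p (ynI E (insert j R) N) := by
    nlinarith
  have hWW : bE U p (ynI E R N) ≤ W0 := by
    apply bE_mono hp0 hp1
    intro S _
    unfold ynI
    by_cases h1 : Y ⊆ S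
    · rw [if_pos h1, if_pos h1]
      simp only [hD]
      split_ifs with h2 h3
      · exact le_rfl
      · exact absurd (fun i hi => h2 i (Finset.mem_filter.1 hi).1) h3
      · exact zero_le_one
      · exact le_rfl
    · rw [if_neg h1, if_neg h1]
  have hWn : 0 ≤ bE U p (ynI E R N) := bE_nonneg hp0 hp1 fun S _ => ynI_nonneg _ _ _ _
  have hcard : Z.card ≤ s := (Finset.card_le_card Finset.sdiff_subset).trans (hs)
  have hpw : p ^ s ≤ p ^ Z.card := pow_le_pow_of_le_one hp0 hp1 hcard
  have h1ε : 0 ≤ 1 - ε := by linarith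
  calc p ^ s * (1 - ε) * bE U p (ynI E R N) = p ^ s * ((1 - ε) * bE U p (ynI E R N)) := by ring
    _ ≤ p ^ Z.card * ((1 - ε) * bE U p (ynI E R N)) :=
      mul_le_mul_of_nonneg_right hpw (mul_nonneg h1ε hWn)
    _ ≤ p ^ Z.card * ((1 - ε) * W0) :=
      mul_le_mul_of_nonneg_left (mul_le_mul_of_nonneg_left hWW h1ε) hpz
    _ ≤ _ := hmain

end Explore


/-! ### The combinatorial lemma: no new copies in good `F`-graphs -/
section Comb

variable {r : ℕ} {F : Finset (Finset (Fin r))}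

lemma exists_edge_of_tc (hT : ThreeConnected F) (S : Finset (Fin r)) (hS : S.card ≤ 2)
    (x y : Fin r) (hx : x ∉ S) (hy : y ∉ S) (hxy : x ≠ y) :
    ∃ e ∈ F, Disjoint e S ∧ x ∈ e := by
  rcases Relation.ReflTransGen.cases_head (hT.2 S hS x y hx hy) with h | ⟨c, ⟨e, he, hd, hxe, _⟩, _⟩
  · exact absurd h hxy
  · exact ⟨e, he, hd, hxe⟩

lemma exists_edge_mem (hT : ThreeConnected F) (x : Fin r) : ∃ e ∈ F, x ∈ e := by
  have hr := hT.1
  obtain ⟨y, hy⟩ : ∃ y : Fin r, x ≠ y := by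
    have : Nontrivial (Fin r) := Fin.nontrivial_iff_two_le.2 (by omega)
    obtain ⟨y, hy⟩ := exists_ne x
    exact ⟨y, hy.symm⟩
  obtain ⟨e, he, _, hx⟩ := exists_edge_of_tc hT ∅ (by simp) x y (by simp) (by simp) hy
  exact ⟨e, he, hx⟩

lemma comb_core {ι : Type*} (hT : ThreeConnected F) (h2 : ∀ e ∈ F, 2 ≤ e.card)
    (S : Finset ι) (W : ι → Finset (Fin r))
    (hcov : ∀ e ∈ F, ∃ a ∈ S, e ⊆ W a) (hedge : ∀ a ∈ S, ∃ e ∈ F, e ⊆ W a)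
    (hne : ∀ a ∈ S, W a ≠ Finset.univ) :
    r + S.card + 1 ≤ ∑ a ∈ S, (W a).card := by
  have hr := hT.1
  set m : Fin r → ℕ := fun v => (S.filter (fun a => v ∈ W a)).card with hm
  have hm1 : ∀ v, 1 ≤ m v := by
    intro v
    obtain ⟨e, he, hv⟩ := exists_edge_mem hT v
    obtain ⟨a, ha, hea⟩ := hcov e he
    exact Finset.card_pos.2 ⟨a, Finset.mem_filter.2 ⟨ha, hea hv⟩⟩
  have hsumW : ∑ a ∈ S, (W a).card = ∑ v, m v := by
    simp only [hm, Finset.card_eq_sum_ones, Finset.sum_filter]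
    rw [Finset.sum_comm]
    apply Finset.sum_congr rfl
    intro a _
    rw [← Finset.sum_filter]
    congr 1
    ext; simp
  set B : ι → Finset (Fin r) := fun a => (W a).filter (fun v => 2 ≤ m v) with hB
  have hW2 : ∀ a ∈ S, 2 ≤ (W a).card := by
    intro a ha
    obtain ⟨e, he, hea⟩ := hedge a ha
    exact (h2 e he).trans (Finset.card_le_card hea)
  have hBW : ∀ a ∈ S, (B a).card ≤ 2 → B a = W a := by
    intro a ha hc
    by_contra hBW
    obtain ⟨x, hxW, hxB⟩ : ∃ x ∈ W a, x ∉ B a := by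
      by_contra hcon
      push Not at hcon
      exact hBW (Finset.Subset.antisymm (Finset.filter_subset _ _) hcon)
    obtain ⟨y, hy⟩ : ∃ y, y ∉ W a := by
      by_contra hcon
      push Not at hcon
      exact hne a ha (Finset.eq_univ_iff_forall.2 hcon)
    have hyB : y ∉ B a := fun h => hy (Finset.filter_subset _ _ h)
    have hpath := hT.2 (B a) hc x y hxB hyB
    have : y ∈ W a ∧ y ∉ B a := by
      refine Relation.ReflTransGen.head_induction_on
        (motive := fun z _ => (z ∈ W a ∧ z ∉ B a) → (y ∈ W a ∧ y ∉ B a)) hpath (fun h => h) ?_ ⟨hxW, hxB⟩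
      rintro z w ⟨e, he, hd, hze, hwe⟩ _ ih ⟨hzW, hzB⟩
      apply ih
      obtain ⟨b, hb, heb⟩ := hcov e he
      have hmz : m z < 2 := by
        by_contra hcon
        exact hzB (Finset.mem_filter.2 ⟨hzW, by omega⟩)
      have hab : b = a := by
        have h1 : (S.filter (fun a => z ∈ W a)).card ≤ 1 := by
          have : m z = (S.filter (fun a => z ∈ W a)).card := rfl
          omega
        exact Finset.card_le_one.1 h1 b (Finset.mem_filter.2 ⟨hb, heb hze⟩) a
          (Finset.mem_filter.2 ⟨ha, hzW⟩)
      subst hab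
      exact ⟨heb hwe, fun h => (Finset.disjoint_left.1 hd) hwe h⟩
    exact hy this.1
  have hB2 : ∀ a ∈ S, 2 ≤ (B a).card := by
    intro a ha
    by_contra hcon
    have := hBW a ha (by omega)
    have := hW2 a ha
    rw [← hBW a ha (by omega)] at this
    omega
  have hsumB : ∑ a ∈ S, (B a).card = ∑ v, if 2 ≤ m v then m v else 0 := by
    have h1 : ∀ v, (if 2 ≤ m v then m v else 0) = ∑ a ∈ S, if v ∈ B a then 1 else 0 := by
      intro v
      split_ifs with h
      · simp only [hm, Finset.card_eq_sum_ones, Finset.sum_filter]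
        apply Finset.sum_congr rfl
        intro a _
        have : v ∈ B a ↔ v ∈ W a := by
          simp only [hB, Finset.mem_filter]; tauto
        simp only [this]
      · symm
        apply Finset.sum_eq_zero
        intro a _
        rw [if_neg]
        intro hv
        exact h (Finset.mem_filter.1 hv).2
    rw [Finset.sum_congr rfl (fun v _ => h1 v), Finset.sum_comm]
    apply Finset.sum_congr rfl
    intro a _
    rw [← Finset.sum_filter, ← Finset.card_eq_sum_ones]
    congr 1
    ext; simp
  have hge : ∀ v, (if 2 ≤ m v then m v else 0) + 2 ≤ 2 * m v := by
    intro v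
    have := hm1 v
    split_ifs <;> omega
  have hsum1 : ∑ a ∈ S, (B a).card + 2 * r ≤ 2 * ∑ v, m v := by
    rw [hsumB, Finset.mul_sum]
    calc _ = ∑ v, ((if 2 ≤ m v then m v else 0) + 2) := by
          rw [Finset.sum_add_distrib]; simp [mul_comm]
      _ ≤ _ := Finset.sum_le_sum (fun v _ => hge v)
  rw [hsumW]
  by_cases h3 : ∃ a ∈ S, 3 ≤ (B a).card
  · obtain ⟨a, ha, ha3⟩ := h3
    have : 2 * S.card + 1 ≤ ∑ a ∈ S, (B a).card := by
      have h := Finset.sum_lt_sum (s := S) (f := fun _ => 2) (g := fun a => (B a).card) hB2 ⟨a, ha, ha3⟩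
      simp at h
      omega
    omega
  · push Not at h3
    have hWc : ∀ a ∈ S, (W a).card = 2 := by
      intro a ha
      have h4 := h3 a ha
      have h5 := hBW a ha (by omega)
      have := hW2 a ha
      rw [← h5] at this ⊢
      omega
    have hm3 : ∀ v, 3 ≤ m v := by
      intro v
      by_contra hcon
      set T := (S.filter (fun a => v ∈ W a)).biUnion (fun a => (W a).erase v) with hTd
      have hTc : T.card ≤ 2 := by
        calc T.card ≤ ∑ a ∈ S.filter (fun a => v ∈ W a), ((W a).erase v).card := Finset.card_biUnion_le
          _ = ∑ a ∈ S.filter (fun a => v ∈ W a), 1 := by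
            apply Finset.sum_congr rfl
            intro a ha
            rw [Finset.mem_filter] at ha
            rw [Finset.card_erase_of_mem ha.2, hWc a ha.1]
          _ = m v := by simp [hm]
          _ ≤ 2 := by omega
      have hvT : v ∉ T := by simp [hTd]
      obtain ⟨y, hy⟩ : ∃ y, y ∉ insert v T := by
        by_contra hcon2
        push Not at hcon2
        have h6 := Finset.eq_univ_iff_forall.2 hcon2
        have h7 := Finset.card_insert_le v T
        rw [h6] at h7
        simp at h7
        omega
      rw [Finset.mem_insert, not_or] at hy
      obtain ⟨e, he, hd, hve⟩ := exists_edge_of_tc hT T hTc v y hvT hy.2 (fun h => hy.1 h.symm)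
      obtain ⟨a, ha, hea⟩ := hcov e he
      have : e ⊆ {v} := by
        intro z hz
        rw [Finset.mem_singleton]
        by_contra hzv
        apply Finset.disjoint_left.1 hd hz
        rw [hTd, Finset.mem_biUnion]
        exact ⟨a, Finset.mem_filter.2 ⟨ha, hea hve⟩, Finset.mem_erase.2 ⟨hzv, hea hz⟩⟩
      have h8 := Finset.card_le_card this
      have := h2 e he
      simp at h8
      omega
    have h9 : ∑ v, m v = 2 * S.card := by
      rw [← hsumW, Finset.sum_congr rfl hWc]; simp [mul_comm]
    have h10 : 3 * r ≤ ∑ v, m v := by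
      calc 3 * r = ∑ v : Fin r, 3 := by simp [mul_comm]
        _ ≤ _ := Finset.sum_le_sum (fun v _ => hm3 v)
    omega

end Comb

section FEfacts

variable {r : ℕ} {F : Finset (Finset (Fin r))} {n u : ℕ}

lemma IsFEdge.card_fst {h : FE n} (hh : IsFEdge F n h) : h.1.card = r := by
  obtain ⟨φ, h1, _⟩ := hh
  rw [h1]; simp

lemma IsFEdge.card_snd {h : FE n} (hh : IsFEdge F n h) : h.2.card = F.card := by
  obtain ⟨φ, _, h2⟩ := hh
  rw [h2]
  exact Finset.card_image_of_injective _ (Finset.map_injective φ)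

lemma IsFEdge.sub {h : FE n} (hh : IsFEdge F n h) {e : Finset (Fin n)} (he : e ∈ h.2) : e ⊆ h.1 := by
  obtain ⟨φ, h1, h2⟩ := hh
  rw [h2, Finset.mem_image] at he
  obtain ⟨e', _, rfl⟩ := he
  rw [h1]
  exact Finset.map_subset_map.2 (Finset.subset_univ _)

lemma IsFEdge.card_edge (hFc : ∀ e ∈ F, e.card = u) {h : FE n} (hh : IsFEdge F n h)
    {e : Finset (Fin n)} (he : e ∈ h.2) : e.card = u := by
  obtain ⟨φ, h1, h2⟩ := hh
  rw [h2, Finset.mem_image] at he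
  obtain ⟨e', he', rfl⟩ := he
  rw [Finset.card_map, hFc e' he']

lemma IsFEdge.fst_eq (hT : ThreeConnected F) {h : FE n} (hh : IsFEdge F n h) :
    h.1 = h.2.biUnion id := by
  apply Finset.Subset.antisymm
  · obtain ⟨φ, h1, h2⟩ := hh
    rw [h1, h2]
    intro v hv
    rw [Finset.mem_map] at hv
    obtain ⟨x, _, rfl⟩ := hv
    obtain ⟨e, he, hx⟩ := exists_edge_mem hT x
    rw [Finset.mem_biUnion]
    exact ⟨e.map φ, Finset.mem_image_of_mem _ he, Finset.mem_map_of_mem φ hx⟩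
  · intro v hv
    rw [Finset.mem_biUnion] at hv
    obtain ⟨e, he, hv⟩ := hv
    exact hh.sub he hv

lemma IsFEdge.ext_sub (hT : ThreeConnected F) {h h' : FE n} (hh : IsFEdge F n h)
    (hh' : IsFEdge F n h') (hs : h.2 ⊆ h'.2) : h = h' := by
  have h2 : h.2 = h'.2 := Finset.eq_of_subset_of_card_le hs (by rw [hh.card_snd, hh'.card_snd])
  exact Prod.ext (by rw [hh.fst_eq hT, hh'.fst_eq hT, h2]) h2

lemma mem_allFEdges {h : FE n} : h ∈ allFEdges F n ↔ IsFEdge F n h := by simp [allFEdges]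

lemma mem_allUEdges {e : Finset (Fin n)} : e ∈ allUEdges u n ↔ e.card = u := by simp [allUEdges]

lemma F_nonempty (hT : ThreeConnected F) : F.Nonempty := by
  obtain ⟨e, he, _⟩ := exists_edge_mem hT ⟨0, by have := hT.1; omega⟩
  exact ⟨e, he⟩

/-- The swap case: a copy on the same vertex set differing in one edge. -/
lemma swap_false (hFc : ∀ e ∈ F, e.card = 2) (hsw : ¬ ∃ a b : Finset (Fin r), a.card = 2 ∧ a ∉ F ∧ b ∈ F ∧
      EdgeIso (insert a (F.erase b)) F) {h i : FE n} (hh : IsFEdge F n h) (hi : IsFEdge F n i)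
    (hV : h.1 = i.1) (e0 : Finset (Fin n)) (he0 : ∀ e ∈ i.2, e ∉ h.2 → e = e0)
    (hne : ¬ i.2 ⊆ h.2) : False := by
  have hcs : h.2.card = i.2.card := by rw [hh.card_snd, hi.card_snd]
  have hci : ∀ e ∈ i.2, e.card = 2 := fun e he => hi.card_edge hFc he
  have hie0 : e0 ∈ i.2 ∧ e0 ∉ h.2 := by
    obtain ⟨e, he, heh⟩ := Finset.not_subset.1 hne
    have := he0 e he heh
    subst this
    exact ⟨he, heh⟩
  have hsd : (i.2 \ h.2).card = 1 := by
    rw [Finset.card_eq_one]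
    refine ⟨e0, ?_⟩
    ext e
    rw [Finset.mem_sdiff, Finset.mem_singleton]
    constructor
    · rintro ⟨h1, h2⟩; exact he0 e h1 h2
    · rintro rfl; exact hie0
  have hsd2 : (h.2 \ i.2).card = 1 := by
    have h1 := Finset.card_sdiff_add_card_inter i.2 h.2
    have h2 := Finset.card_sdiff_add_card_inter h.2 i.2
    rw [Finset.inter_comm] at h2
    omega
  obtain ⟨b0, hb0⟩ := Finset.card_eq_one.1 hsd2
  have hb0m : b0 ∈ h.2 ∧ b0 ∉ i.2 := by
    have : b0 ∈ h.2 \ i.2 := by rw [hb0]; simp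
    exact Finset.mem_sdiff.1 this
  have hi2 : i.2 = insert e0 (h.2.erase b0) := by
    ext e
    rw [Finset.mem_insert, Finset.mem_erase]
    constructor
    · intro he
      by_cases heh : e ∈ h.2
      · right
        refine ⟨?_, heh⟩
        rintro rfl
        exact hb0m.2 he
      · left; exact he0 e he heh
    · rintro (rfl | ⟨hne, heh⟩)
      · exact hie0.1
      · by_contra hei
        have : e ∈ h.2 \ i.2 := Finset.mem_sdiff.2 ⟨heh, hei⟩
        rw [hb0, Finset.mem_singleton] at this
        exact hne this
  have he0V : e0 ⊆ h.1 := by rw [hV]; exact hi.sub hie0.1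
  obtain ⟨φ, hφ1, hφ2⟩ := hh
  obtain ⟨ψ, hψ1, hψ2⟩ := hi
  -- the permutation with `ψ ∘ σ = φ`
  have hex : ∀ x, ∃ y, ψ y = φ x := by
    intro x
    have : φ x ∈ h.1 := by rw [hφ1]; simp
    rw [hV, hψ1] at this
    simpa using this
  choose f hf using hex
  have hfinj : Function.Injective f := by
    intro x y hxy
    apply φ.injective
    rw [← hf x, ← hf y, hxy]
  let σ : Equiv.Perm (Fin r) := Equiv.ofBijective f (Finite.injective_iff_bijective.1 hfinj)
  have hσ : ∀ x, ψ (σ x) = φ x := hf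
  have hmap : ∀ e : Finset (Fin r), (e.image (fun x => σ x)).map ψ = e.map φ := by
    intro e
    ext v
    simp [hσ]
  -- pull back
  have hpb : ∃ a : Finset (Fin r), a.map φ = e0 := by
    refine ⟨Finset.univ.filter (fun x => φ x ∈ e0), ?_⟩
    ext v
    simp only [Finset.mem_map, Finset.mem_filter, Finset.mem_univ, true_and]
    constructor
    · rintro ⟨x, hx, rfl⟩; exact hx
    · intro hv
      have := he0V hv
      rw [hφ1] at this
      simp only [Finset.mem_map, Finset.mem_univ, true_and] at this
      obtain ⟨x, rfl⟩ := this
      exact ⟨x, hv, rfl⟩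
  obtain ⟨a, rfl⟩ := hpb
  have hb : ∃ b ∈ F, b.map φ = b0 := by
    have := hb0m.1
    rw [hφ2, Finset.mem_image] at this
    exact this
  obtain ⟨b, hbF, rfl⟩ := hb
  apply hsw
  refine ⟨a, b, ?_, ?_, hbF, σ, ?_⟩
  · rw [← Finset.card_map φ]; exact hci _ hie0.1
  · intro haF
    apply hie0.2
    rw [hφ2]
    exact Finset.mem_image_of_mem _ haF
  · have hinj := Finset.image_injective (Finset.map_injective ψ)
    apply hinj
    rw [← hψ2, hi2, hφ2, Finset.image_image]
    have : ((fun e : Finset (Fin r) => e.map ψ) ∘ fun e : Finset (Fin r) => e.image (fun x => σ x))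
        = fun e : Finset (Fin r) => e.map φ := by
      funext e
      exact hmap e
    rw [this, Finset.image_insert]
    congr 1
    rw [← Finset.image_erase (Finset.map_injective φ)]

/-- A small dense configuration. -/
def BadSmall (r K : ℕ) {n : ℕ} (S : Finset (FE n)) : Prop :=
  2 ≤ S.card ∧ S.card ≤ K ∧ (S.biUnion Prod.fst).card < (r - 1) * S.card

lemma no_new_copy (hu : 2 ≤ u) (hFc : ∀ e ∈ F, e.card = u) (hF : Nice u F) {K : ℕ} (hK : F.card ≤ K)
    (R : Finset (FE n)) (hR : ∀ h ∈ R, IsFEdge F n h) (hgood : ∀ S, S ⊆ R → ¬ BadSmall r K S)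
    (i : FE n) (hi : IsFEdge F n i) (hcov : i.2 ⊆ R.biUnion Prod.snd) : i ∈ R := by
  by_contra hiR
  obtain ⟨hbal, hT, hsw⟩ := hF
  have hr := hT.1
  have hex : ∀ e ∈ i.2, ∃ h ∈ R, e ∈ h.2 := by
    intro e he
    exact Finset.mem_biUnion.1 (hcov he)
  choose! own hown1 hown2 using hex
  set S := i.2.image own with hS
  have hSR : S ⊆ R := by
    intro h hh
    obtain ⟨e, he, rfl⟩ := Finset.mem_image.1 hh
    exact hown1 e he
  have hne : ∀ a ∈ R, ¬ i.2 ⊆ a.2 := by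
    intro a ha hsub
    exact hiR (hi.ext_sub hT (hR a ha) hsub ▸ ha)
  have hS1 : 2 ≤ S.card := by
    by_contra hcon
    have h1 : S.card ≤ 1 := by omega
    have hine : i.2.Nonempty := by
      rw [← Finset.card_pos, hi.card_snd, Finset.card_pos]
      exact F_nonempty hT
    obtain ⟨e, he⟩ := hine
    apply hne (own e) (hown1 e he)
    intro e' he'
    rw [Finset.card_le_one.1 h1 (own e) (Finset.mem_image_of_mem _ he) (own e') (Finset.mem_image_of_mem _ he')]
    exact hown2 e' he'
  have hSK : S.card ≤ K := (Finset.card_image_le).trans (by rw [hi.card_snd]; exact hK)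
  apply hgood S hSR
  refine ⟨hS1, hSK, ?_⟩
  have hVcard : ∀ a ∈ S, a.1.card = r := fun a ha => (hR a (hSR ha)).card_fst
  have hunion : (S.biUnion Prod.fst).card + ∑ a ∈ S, (i.1 ∩ a.1).card ≤ r + S.card * r := by
    have h1 : S.biUnion Prod.fst ⊆ i.1 ∪ S.biUnion (fun a => a.1 \ i.1) := by
      intro v hv
      obtain ⟨a, ha, hva⟩ := Finset.mem_biUnion.1 hv
      by_cases hvi : v ∈ i.1
      · exact Finset.mem_union_left _ hvi
      · exact Finset.mem_union_right _ (Finset.mem_biUnion.2 ⟨a, ha, Finset.mem_sdiff.2 ⟨hva, hvi⟩⟩)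
    have h2 := (Finset.card_le_card h1).trans (Finset.card_union_le _ _)
    have h3 : (S.biUnion (fun a => a.1 \ i.1)).card ≤ ∑ a ∈ S, (a.1 \ i.1).card := Finset.card_biUnion_le
    have h4 : ∑ a ∈ S, (a.1 \ i.1).card + ∑ a ∈ S, (i.1 ∩ a.1).card = S.card * r := by
      rw [← Finset.sum_add_distrib, ← smul_eq_mul, ← Finset.sum_const]
      apply Finset.sum_congr rfl
      intro a ha
      rw [Finset.inter_comm, Finset.card_sdiff_add_card_inter, hVcard a ha]
    rw [hi.card_fst] at h2
    omega
  have hmain : r + S.card + 1 ≤ ∑ a ∈ S, (i.1 ∩ a.1).card := by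
    have hWge : ∀ a ∈ S, u ≤ (i.1 ∩ a.1).card := by
      intro a ha
      obtain ⟨e, he, rfl⟩ := Finset.mem_image.1 ha
      rw [← hi.card_edge hFc he]
      exact Finset.card_le_card (Finset.subset_inter (hi.sub he) ((hR _ (hown1 e he)).sub (hown2 e he)))
    by_cases hun : ∃ a ∈ S, i.1 ⊆ a.1
    · obtain ⟨a, ha, hia⟩ := hun
      have hVa : a.1 = i.1 := by
        symm
        apply Finset.eq_of_subset_of_card_le hia
        rw [hVcard a ha, hi.card_fst]
      have h1 : ∑ b ∈ S, (i.1 ∩ b.1).card = r + ∑ b ∈ S.erase a, (i.1 ∩ b.1).card := by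
        rw [← Finset.add_sum_erase _ _ ha, hVa, Finset.inter_self, hi.card_fst]
      rw [h1]
      have h2 : (S.erase a).card * u ≤ ∑ b ∈ S.erase a, (i.1 ∩ b.1).card := by
        rw [← smul_eq_mul, ← Finset.sum_const]
        exact Finset.sum_le_sum (fun b hb => hWge b (Finset.mem_of_mem_erase hb))
      rw [Finset.card_erase_of_mem ha] at h2
      obtain ⟨k, hk⟩ : ∃ k, S.card = k + 2 := ⟨S.card - 2, by omega⟩
      have h3 : S.card - 1 = k + 1 := by omega
      rw [h3] at h2
      rcases hsw with hu3 | ⟨hu2, hsw⟩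
      · have : (k + 1) * 3 ≤ (k + 1) * u := Nat.mul_le_mul_left _ hu3
        omega
      · subst hu2
        by_cases hk1 : 1 ≤ k
        · omega
        · have hk0 : k = 0 := by omega
          subst hk0
          have hec : (S.erase a).card = 1 := by rw [Finset.card_erase_of_mem ha]; omega
          obtain ⟨b, hb⟩ := Finset.card_eq_one.1 hec
          rw [hb, Finset.sum_singleton] at h2 ⊢
          by_contra hcon
          have hb2 : (i.1 ∩ b.1).card = 2 := by omega
          refine swap_false hFc hsw (hR a (hSR ha)) hi hVa (i.1 ∩ b.1) ?_ (hne a (hSR ha))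
          intro e he hea
          have hoe : own e = b := by
            have : own e ∈ S.erase a := by
              rw [Finset.mem_erase]
              refine ⟨?_, Finset.mem_image_of_mem _ he⟩
              intro h
              apply hea
              rw [← h]
              exact hown2 e he
            rw [hb, Finset.mem_singleton] at this
            exact this
          apply Finset.eq_of_subset_of_card_le
          · apply Finset.subset_inter (hi.sub he)
            rw [← hoe]
            exact (hR _ (hown1 e he)).sub (hown2 e he)
          · rw [hb2, hi.card_edge hFc he]
    · push Not at hun
      obtain ⟨φ, hφ1, hφ2⟩ := hi
      set W : FE n → Finset (Fin r) := fun a => Finset.univ.filter (fun x => φ x ∈ a.1) with hW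
      have hWc : ∀ a, (i.1 ∩ a.1).card = (W a).card := by
        intro a
        rw [← Finset.card_map φ]
        congr 1
        ext v
        rw [hφ1]
        simp only [hW, Finset.mem_inter, Finset.mem_map, Finset.mem_univ, true_and, Finset.mem_filter]
        constructor
        · rintro ⟨⟨x, rfl⟩, h2⟩
          exact ⟨x, h2, rfl⟩
        · rintro ⟨x, h1, rfl⟩
          exact ⟨⟨x, rfl⟩, h1⟩
      have hsubW : ∀ e ∈ F, ∀ a ∈ R, e.map φ ∈ a.2 → e ⊆ W a := by
        intro e he a ha hea x hx
        simp only [hW, Finset.mem_filter, Finset.mem_univ, true_and]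
        exact (hR a ha).sub hea (Finset.mem_map_of_mem φ hx)
      rw [Finset.sum_congr rfl (fun a _ => hWc a)]
      apply comb_core hT (fun e he => by rw [hFc e he]; exact hu)
      · intro e he
        have he' : e.map φ ∈ i.2 := by rw [hφ2]; exact Finset.mem_image_of_mem _ he
        exact ⟨own (e.map φ), Finset.mem_image_of_mem _ he', hsubW e he _ (hown1 _ he') (hown2 _ he')⟩
      · intro a ha
        obtain ⟨e', he', rfl⟩ := Finset.mem_image.1 ha
        have he2 := he'
        rw [hφ2, Finset.mem_image] at he2
        obtain ⟨e, he, rfl⟩ := he2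
        exact ⟨e, he, hsubW e he _ (hown1 _ he') (hown2 _ he')⟩
      · intro a ha hWu
        apply hun a ha
        intro v hv
        rw [hφ1, Finset.mem_map] at hv
        obtain ⟨x, _, rfl⟩ := hv
        have : x ∈ W a := by rw [hWu]; simp
        simpa [hW] using this
  have h5 : (r - 1) * S.card + S.card = S.card * r := by
    obtain ⟨q, rfl⟩ : ∃ q, r = q + 1 := ⟨r - 1, by omega⟩
    simp; ring
  omega

end FEfacts


/-! ### Counting extensions -/
section Counting

variable {r : ℕ} {F : Finset (Finset (Fin r))} {n u : ℕ}

/-- The graph joining two vertices lying in a common edge of `E'`. -/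
def cg (E' : Finset (Finset (Fin r))) : SimpleGraph (Fin r) where
  Adj a b := a ≠ b ∧ ∃ e ∈ E', a ∈ e ∧ b ∈ e
  symm := ⟨fun a b => by
    rintro ⟨h, e, he, h1, h2⟩
    exact ⟨h.symm, e, he, h2, h1⟩⟩
  loopless := ⟨fun a h => h.1 rfl⟩

/-- Number of components. -/
def ncomp (E' : Finset (Finset (Fin r))) : ℕ := Fintype.card (cg E').ConnectedComponent

lemma ncomp_le (E' : Finset (Finset (Fin r))) : ncomp E' ≤ r := by
  have : Fintype.card (cg E').ConnectedComponent ≤ Fintype.card (Fin r) :=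
    Fintype.card_le_of_surjective (cg E').connectedComponentMk (fun c => by
      induction c using SimpleGraph.ConnectedComponent.ind with
      | _ v => exact ⟨v, rfl⟩)
  rw [Fintype.card_fin] at this
  exact this

lemma comp_bound (hbal : StrictlyOneBalanced F) (h2 : ∀ e ∈ F, 2 ≤ e.card)
    {E' : Finset (Finset (Fin r))} (hE : E' ⊆ F) (hne : E'.Nonempty) (hneF : E' ≠ F) :
    E'.card * (r - 1) + 1 + F.card * ncomp E' ≤ F.card * r := by
  set VC : (cg E').ConnectedComponent → Finset (Fin r) :=
    fun C => Finset.univ.filter (fun x => (cg E').connectedComponentMk x = C) with hVC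
  set EC : (cg E').ConnectedComponent → Finset (Finset (Fin r)) :=
    fun C => E'.filter (fun e => e ⊆ VC C) with hEC
  have hV : ∑ C, (VC C).card = r := by
    have := Finset.card_eq_sum_card_fiberwise (s := (Finset.univ : Finset (Fin r)))
      (f := (cg E').connectedComponentMk) (t := Finset.univ) (fun _ _ => Finset.mem_coe.2 (Finset.mem_univ _))
    rw [Finset.card_univ, Fintype.card_fin] at this
    exact this.symm
  have hVpos : ∀ C, 1 ≤ (VC C).card := by
    intro C
    induction C using SimpleGraph.ConnectedComponent.ind with
    | _ v => exact Finset.card_pos.2 ⟨v, by simp [hVC]⟩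
  have hin : ∀ e ∈ E', ∃ C, e ⊆ VC C := by
    intro e he
    have hc : 0 < e.card := by have := h2 e (hE he); omega
    obtain ⟨a, ha⟩ := Finset.card_pos.1 hc
    refine ⟨(cg E').connectedComponentMk a, ?_⟩
    intro b hb
    simp only [hVC, Finset.mem_filter, Finset.mem_univ, true_and]
    by_cases hab : b = a
    · rw [hab]
    · exact SimpleGraph.ConnectedComponent.sound (SimpleGraph.Adj.reachable ⟨hab, e, he, hb, ha⟩)
  have hEsum : E'.card ≤ ∑ C, (EC C).card := by
    calc E'.card ≤ (Finset.univ.biUnion EC).card := by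
          apply Finset.card_le_card
          intro e he
          obtain ⟨C, hC⟩ := hin e he
          exact Finset.mem_biUnion.2 ⟨C, Finset.mem_univ _, Finset.mem_filter.2 ⟨he, hC⟩⟩
      _ ≤ _ := Finset.card_biUnion_le
  have hEF : ∀ C, EC C ⊆ F := fun C => (Finset.filter_subset _ _).trans hE
  have hstrict : ∀ C, 1 < (VC C).card → (EC C).card * (r - 1) < F.card * ((VC C).card - 1) := by
    intro C hC
    apply hbal (VC C) (EC C) (hEF C) (fun e he => (Finset.mem_filter.1 he).2) hC
    rintro ⟨_, h⟩
    apply hneF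
    apply Finset.Subset.antisymm hE
    rw [← h]
    exact Finset.filter_subset _ _
  have hle : ∀ C, (EC C).card * (r - 1) ≤ F.card * ((VC C).card - 1) := by
    intro C
    by_cases hC : 1 < (VC C).card
    · exact (hstrict C hC).le
    · have : EC C = ∅ := by
        rw [Finset.eq_empty_iff_forall_notMem]
        intro e he
        have h3 := h2 e (hEF C he)
        have h4 := Finset.card_le_card (Finset.mem_filter.1 he).2
        omega
      simp [this]
  obtain ⟨e, he⟩ := hne
  obtain ⟨C0, hC0⟩ := hin e he
  have hC01 : 1 < (VC C0).card := by
    have h3 := h2 e (hE he)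
    have h4 := Finset.card_le_card hC0
    omega
  have hsum : ∑ C, (EC C).card * (r - 1) < ∑ C, F.card * ((VC C).card - 1) :=
    Finset.sum_lt_sum (fun C _ => hle C) ⟨C0, Finset.mem_univ _, hstrict C0 hC01⟩
  rw [← Finset.sum_mul, ← Finset.mul_sum] at hsum
  have h5 : ∑ C, ((VC C).card - 1) + ncomp E' = r := by
    rw [ncomp, ← Finset.card_univ, Finset.card_eq_sum_ones, ← Finset.sum_add_distrib]
    conv_rhs => rw [← hV]
    apply Finset.sum_congr rfl
    intro C _
    have := hVpos C
    omega
  have h6 : E'.card * (r - 1) ≤ (∑ C, (EC C).card) * (r - 1) := Nat.mul_le_mul_right _ hEsum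
  have h7 : F.card * r = F.card * ∑ C, ((VC C).card - 1) + F.card * ncomp E' := by
    rw [← mul_add, h5]
  omega

/-- Iterated neighbourhoods. -/
def ballN (nb : Fin n → Finset (Fin n)) : ℕ → Fin n → Finset (Fin n)
  | 0, x => {x}
  | k + 1, x => (ballN nb k x).biUnion nb

lemma ballN_card (nb : Fin n → Finset (Fin n)) (B : ℕ) (hB : ∀ x, (nb x).card ≤ B) (k : ℕ) (x : Fin n) :
    (ballN nb k x).card ≤ B ^ k := by
  induction k with
  | zero => simp [ballN]
  | succ k ih =>
    rw [ballN]
    calc _ ≤ (ballN nb k x).card * B := Finset.card_biUnion_le_card_mul _ _ _ (fun y _ => hB y)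
      _ ≤ B ^ k * B := Nat.mul_le_mul_right _ ih
      _ = _ := (pow_succ _ _).symm

lemma ballN_mono (nb : Fin n → Finset (Fin n)) (hself : ∀ x, x ∈ nb x) {k l : ℕ} (hkl : k ≤ l) (x : Fin n) :
    ballN nb k x ⊆ ballN nb l x := by
  induction hkl with
  | refl => exact Finset.Subset.refl _
  | step _ ih =>
    refine ih.trans ?_
    intro y hy
    exact Finset.mem_biUnion.2 ⟨y, hy, hself y⟩

lemma walk_ball (nb : Fin n → Finset (Fin n)) (G : SimpleGraph (Fin r)) (φ : Fin r → Fin n)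
    (hφ : ∀ a b, G.Adj a b → φ b ∈ nb (φ a)) {a b : Fin r} (w : G.Walk a b) :
    φ a ∈ ballN nb w.length (φ b) := by
  induction w with
  | nil => simp [ballN]
  | cons h w ih =>
    rw [SimpleGraph.Walk.length_cons, ballN]
    exact Finset.mem_biUnion.2 ⟨_, ih, hφ _ _ h.symm⟩

lemma count_maps (nb : Fin n → Finset (Fin n)) (hself : ∀ x, x ∈ nb x) (B : ℕ)
    (hB : ∀ x, (nb x).card ≤ B) (E' : Finset (Finset (Fin r))) (a0 : Fin r) (T : Finset (Fin n)) :
    (Finset.univ.filter (fun φ : Fin r → Fin n => φ a0 ∈ T ∧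
      ∀ a b, (cg E').Adj a b → φ b ∈ nb (φ a))).card ≤ (B ^ r) ^ r * (T.card * n ^ (ncomp E' - 1)) := by
  set G := cg E' with hG
  set C0 := G.connectedComponentMk a0 with hC0
  set rep : G.ConnectedComponent → Fin r := fun C => if C = C0 then a0 else C.out with hrep
  have hrepC : ∀ C, G.connectedComponentMk (rep C) = C := by
    intro C
    simp only [hrep]
    split_ifs with h
    · rw [h]
    · exact Quot.out_eq C
  set Φ := Finset.univ.filter (fun φ : Fin r → Fin n => φ a0 ∈ T ∧
      ∀ a b, G.Adj a b → φ b ∈ nb (φ a)) with hΦ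
  set Ψ : Finset (G.ConnectedComponent → Fin n) :=
    Fintype.piFinset (fun C => if C = C0 then T else Finset.univ) with hΨ
  have hΨc : Ψ.card = T.card * n ^ (ncomp E' - 1) := by
    rw [hΨ, Fintype.card_piFinset, ← Finset.mul_prod_erase _ _ (Finset.mem_univ C0), if_pos rfl]
    congr 1
    rw [Finset.prod_congr rfl (g := fun _ => n)]
    · rw [Finset.prod_const, Finset.card_erase_of_mem (Finset.mem_univ _), Finset.card_univ]
      rfl
    · intro C hC
      rw [if_neg (Finset.ne_of_mem_erase hC)]
      simp
  rw [← hΨc]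
  apply Finset.card_le_mul_card_image_of_maps_to (f := fun φ C => φ (rep C))
  · intro φ hφ
    rw [hΦ, Finset.mem_filter] at hφ
    rw [hΨ, Fintype.mem_piFinset]
    intro C
    split_ifs with h
    · simp only [hrep, h, if_true]
      exact hφ.2.1
    · simp
  · intro ψ hψ
    calc _ ≤ (Fintype.piFinset (fun y : Fin r => ballN nb r (ψ (G.connectedComponentMk y)))).card := by
          apply Finset.card_le_card
          intro φ hφ
          rw [Finset.mem_filter, hΦ, Finset.mem_filter] at hφ
          obtain ⟨⟨_, _, hadj⟩, rfl⟩ := hφ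
          rw [Fintype.mem_piFinset]
          intro y
          have hreach : G.Reachable y (rep (G.connectedComponentMk y)) := by
            rw [← SimpleGraph.ConnectedComponent.eq, hrepC]
          obtain ⟨w, hw⟩ := hreach.exists_isPath
          have hlen := hw.length_lt
          rw [Fintype.card_fin] at hlen
          exact ballN_mono nb hself hlen.le _ (walk_ball nb G φ hadj w)
      _ = ∏ y : Fin r, (ballN nb r (ψ (G.connectedComponentMk y))).card := Fintype.card_piFinset _
      _ ≤ ∏ y : Fin r, B ^ r := Finset.prod_le_prod' (fun y _ => ballN_card nb B hB r _)
      _ = _ := by simp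

lemma term_bound (hbal : StrictlyOneBalanced F) (h2 : ∀ e ∈ F, 2 ≤ e.card) (hr : 1 ≤ r)
    {E' : Finset (Finset (Fin r))} (hE : E' ⊆ F) (hne : E'.Nonempty) (hneF : E' ≠ F)
    (p L x : ℝ) (hp : 0 ≤ p) (hL : 1 ≤ L) (hx : 0 ≤ x) (hxn : x ^ F.card * n = 1)
    (hpL : p ^ F.card * (n : ℝ) ^ (r - 1) ≤ L) :
    (n : ℝ) ^ (ncomp E' - 1) * p ^ (F.card - E'.card) ≤ L * x := by
  have hcb := comp_bound hbal h2 hE hne hneF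
  have hcr := ncomp_le E'
  have hEc : E'.card ≤ F.card := Finset.card_le_card hE
  have hF0 : F.card ≠ 0 := by
    have := Finset.card_pos.2 hne
    omega
  have hn0 : n ≠ 0 := by
    rintro rfl
    simp at hxn
  have hn1 : (1:ℝ) ≤ n := by exact_mod_cast Nat.one_le_iff_ne_zero.2 hn0
  have hnpos : (0:ℝ) < n := by linarith
  have hc1 : 1 ≤ ncomp E' := by
    have : Nonempty (cg E').ConnectedComponent := ⟨(cg E').connectedComponentMk ⟨0, hr⟩⟩
    exact Fintype.card_pos
  set s := F.card with hs
  set c := ncomp E' with hc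
  set e := E'.card with he
  rw [← pow_le_pow_iff_left₀ (by positivity) (by positivity) hF0]
  have key : s * (c - 1) + (r - 1) * e + 1 ≤ (r - 1) * s := by
    obtain ⟨c', hc'⟩ : ∃ c', c = c' + 1 := ⟨c - 1, by omega⟩
    obtain ⟨r', hr'⟩ : ∃ r', r = r' + 1 := ⟨r - 1, by omega⟩
    rw [hc'] at hcb ⊢
    rw [hr'] at hcb ⊢
    simp only [Nat.add_sub_cancel] at hcb ⊢
    nlinarith
  have h1 : ((n:ℝ) ^ (c - 1) * p ^ (s - e)) ^ s * ((n:ℝ) ^ ((r - 1) * e + 1)) * n ^ ((r-1) * (s - e)) ≤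
      L ^ s * x ^ s * ((n:ℝ) ^ ((r - 1) * e + 1)) * n ^ ((r-1) * (s - e)) := by
    calc _ = (p ^ s * (n:ℝ) ^ (r - 1)) ^ (s - e) * (n:ℝ) ^ (s * (c - 1) + (r - 1) * e + 1) := by
          rw [mul_pow, mul_pow, ← pow_mul, ← pow_mul, ← pow_mul, ← pow_mul]
          rw [mul_comm (s - e) s, pow_add, pow_add, pow_add, mul_comm (c-1) s]
          ring
      _ ≤ L ^ (s - e) * (n:ℝ) ^ ((r - 1) * s) := by
          apply mul_le_mul
          · exact pow_le_pow_left₀ (by positivity) hpL _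
          · exact pow_le_pow_right₀ hn1 key
          · positivity
          · positivity
      _ ≤ L ^ s * (n:ℝ) ^ ((r - 1) * s) := by
          apply mul_le_mul_of_nonneg_right _ (by positivity)
          exact pow_le_pow_right₀ hL (by omega)
      _ = L ^ s * (x ^ s * n) * (n:ℝ) ^ ((r - 1) * s) := by rw [hxn, mul_one]
      _ = _ := by
          have : (r - 1) * s = (r - 1) * e + (r - 1) * (s - e) := by
            rw [← mul_add]; congr 1; omega
          rw [this, pow_add, pow_add]
          ring
  rw [mul_assoc, mul_assoc (L ^ s * x ^ s)] at h1
  rw [mul_pow L]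
  exact le_of_mul_le_mul_right h1 (by positivity)

lemma count_sum (hu : 2 ≤ u) (hFc : ∀ e ∈ F, e.card = u) (hF : Nice u F) {K D : ℕ} (hK : F.card ≤ K)
    (R : Finset (FE n)) (hR : ∀ h ∈ R, IsFEdge F n h) (hgood : ∀ S, S ⊆ R → ¬ BadSmall r K S)
    (hdeg : ∀ v, degFE R v ≤ D) (j : FE n) (hj : j ∈ R) (N : Finset (FE n))
    (hN : ∀ i ∈ N, IsFEdge F n i ∧ i ∉ R ∧ ¬ Disjoint i.2 j.2)
    (p L x : ℝ) (hp : 0 ≤ p) (hL : 1 ≤ L) (hx : 0 ≤ x) (hxn : x ^ F.card * n = 1)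
    (hpL : p ^ F.card * (n : ℝ) ^ (r - 1) ≤ L) :
    ∑ i ∈ N, p ^ (i.2 \ R.biUnion Prod.snd).card ≤
      2 ^ F.card * (r * (((1 + r * D : ℕ) : ℝ) ^ r) ^ r * r) * (L * x) := by
  have hbal := hF.1
  have hT := hF.2.1
  have hr4 := hT.1
  set Y := R.biUnion Prod.snd with hY
  set nb : Fin n → Finset (Fin n) := fun v =>
    insert v ((R.filter (fun h => v ∈ h.1)).biUnion Prod.fst) with hnb
  have hself : ∀ v, v ∈ nb v := fun v => Finset.mem_insert_self _ _
  have hB : ∀ v, (nb v).card ≤ 1 + r * D := by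
    intro v
    refine (Finset.card_insert_le _ _).trans ?_
    rw [add_comm]
    apply Nat.add_le_add_left
    calc _ ≤ (R.filter (fun h => v ∈ h.1)).card * r :=
          Finset.card_biUnion_le_card_mul _ _ _ (fun h hh =>
            (hR h (Finset.mem_filter.1 hh).1).card_fst.le)
      _ ≤ D * r := Nat.mul_le_mul_right _ (hdeg v)
      _ = _ := mul_comm _ _
  have hex : ∀ i : FE n, ∃ φ : Fin r → Fin n, i ∈ N → Function.Injective φ ∧
      i.1 = Finset.univ.image φ ∧ i.2 = F.image (fun e => e.image φ) := by
    intro i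
    by_cases hi : i ∈ N
    · obtain ⟨φ, h1, h2⟩ := (hN i hi).1
      refine ⟨φ, fun _ => ⟨φ.injective, ?_, ?_⟩⟩
      · rw [h1, Finset.map_eq_image]
      · rw [h2]; simp only [Finset.map_eq_image]
    · by_cases hn : ∃ φ : Fin r → Fin n, True
      · obtain ⟨φ, _⟩ := hn
        exact ⟨φ, fun h => absurd h hi⟩
      · exfalso
        apply hn
        obtain ⟨φ, _⟩ := hR j hj
        exact ⟨φ, trivial⟩
  choose emb hemb using hex
  set Ep : FE n → Finset (Finset (Fin r)) := fun i => F.filter (fun e => e.image (emb i) ∈ Y) with hEp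
  set Φ : Finset (Finset (Fin r)) → Finset (Fin r → Fin n) := fun E' =>
    (Finset.univ : Finset (Fin r)).biUnion (fun a0 =>
      Finset.univ.filter (fun φ : Fin r → Fin n => φ a0 ∈ j.1 ∧
      ∀ a b, (cg E').Adj a b → φ b ∈ nb (φ a))) with hΦ
  have hΦc : ∀ E', ((Φ E').card : ℝ) ≤ (r * (((1 + r * D : ℕ) : ℝ) ^ r) ^ r * r) * (n:ℝ) ^ (ncomp E' - 1) := by
    intro E'
    have h1 : (Φ E').card ≤ r * (((1 + r * D) ^ r) ^ r * (r * n ^ (ncomp E' - 1))) := by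
      calc _ ≤ (Finset.univ : Finset (Fin r)).card * (((1 + r * D) ^ r) ^ r * (r * n ^ (ncomp E' - 1))) := by
            apply Finset.card_biUnion_le_card_mul
            intro a0 _
            have := count_maps nb hself _ hB E' a0 j.1
            rwa [(hR j hj).card_fst] at this
        _ = _ := by simp
    calc ((Φ E').card : ℝ) ≤ ((r * (((1 + r * D) ^ r) ^ r * (r * n ^ (ncomp E' - 1))) : ℕ) : ℝ) := by
          exact_mod_cast h1
      _ = _ := by push_cast; ring
  set 𝓔 := F.powerset.filter (fun E' => E'.Nonempty ∧ E' ≠ F) with h𝓔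
  have hmemY : ∀ e ∈ Y, ∀ v ∈ e, ∀ w ∈ e, w ∈ nb v := by
    intro e he v hv w hw
    rw [hY, Finset.mem_biUnion] at he
    obtain ⟨h, hh, heh⟩ := he
    apply Finset.mem_insert_of_mem
    exact Finset.mem_biUnion.2 ⟨h, Finset.mem_filter.2 ⟨hh, (hR h hh).sub heh hv⟩, (hR h hh).sub heh hw⟩
  have hmaps : ∀ i ∈ N, Ep i ∈ 𝓔 ∧ emb i ∈ Φ (Ep i) ∧ (i.2 \ Y).card = F.card - (Ep i).card := by
    intro i hi
    obtain ⟨hinj, h1, h2⟩ := hemb i hi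
    obtain ⟨hiF, hiR, hij⟩ := hN i hi
    obtain ⟨e', he'i, he'j⟩ := Finset.not_disjoint_iff.1 hij
    rw [h2, Finset.mem_image] at he'i
    obtain ⟨e0, he0, rfl⟩ := he'i
    have he0E : e0 ∈ Ep i := Finset.mem_filter.2 ⟨he0, Finset.mem_biUnion.2 ⟨j, hj, he'j⟩⟩
    refine ⟨?_, ?_, ?_⟩
    · rw [h𝓔, Finset.mem_filter, Finset.mem_powerset]
      refine ⟨Finset.filter_subset _ _, ⟨e0, he0E⟩, ?_⟩
      intro hEF
      apply hiR
      apply no_new_copy hu hFc hF hK R hR hgood i hiF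
      intro e he
      rw [h2, Finset.mem_image] at he
      obtain ⟨e1, he1, rfl⟩ := he
      rw [← hEF] at he1
      exact (Finset.mem_filter.1 he1).2
    · have hc : 0 < e0.card := by rw [hFc e0 he0]; omega
      obtain ⟨a0, ha0⟩ := Finset.card_pos.1 hc
      rw [hΦ, Finset.mem_biUnion]
      refine ⟨a0, Finset.mem_univ _, Finset.mem_filter.2 ⟨Finset.mem_univ _, ?_, ?_⟩⟩
      · exact (hR j hj).sub he'j (Finset.mem_image_of_mem _ ha0)
      · rintro a b ⟨_, e, he, hae, hbe⟩
        exact hmemY _ (Finset.mem_filter.1 he).2 _ (Finset.mem_image_of_mem _ hae) _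
          (Finset.mem_image_of_mem _ hbe)
    · have h3 : i.2 \ Y = (F \ Ep i).image (fun e => e.image (emb i)) := by
        ext e
        rw [Finset.mem_sdiff, h2, Finset.mem_image, Finset.mem_image]
        constructor
        · rintro ⟨⟨e1, he1, rfl⟩, hY1⟩
          refine ⟨e1, Finset.mem_sdiff.2 ⟨he1, fun h => hY1 (Finset.mem_filter.1 h).2⟩, rfl⟩
        · rintro ⟨e1, he1, rfl⟩
          rw [Finset.mem_sdiff] at he1
          exact ⟨⟨e1, he1.1, rfl⟩, fun h => he1.2 (Finset.mem_filter.2 ⟨he1.1, h⟩)⟩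
      rw [h3, Finset.card_image_of_injective _ (Finset.image_injective hinj),
        Finset.card_sdiff_of_subset (Finset.filter_subset _ _)]
  have hinjN : Set.InjOn emb N := by
    intro i hi i' hi' h
    obtain ⟨_, h1, h2⟩ := hemb i hi
    obtain ⟨_, h1', h2'⟩ := hemb i' hi'
    exact Prod.ext (by rw [h1, h1', h]) (by rw [h2, h2', h])
  calc ∑ i ∈ N, p ^ (i.2 \ Y).card
      = ∑ E' ∈ 𝓔, ∑ i ∈ N with Ep i = E', p ^ (i.2 \ Y).card :=
        (Finset.sum_fiberwise_of_maps_to (fun i hi => (hmaps i hi).1) _).symm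
    _ ≤ ∑ E' ∈ 𝓔, (r * (((1 + r * D : ℕ) : ℝ) ^ r) ^ r * r) * (L * x) := by
        apply Finset.sum_le_sum
        intro E' hE'
        rw [h𝓔, Finset.mem_filter, Finset.mem_powerset] at hE'
        calc ∑ i ∈ N with Ep i = E', p ^ (i.2 \ Y).card
            = ∑ i ∈ N with Ep i = E', p ^ (F.card - E'.card) := by
              apply Finset.sum_congr rfl
              intro i hi
              rw [Finset.mem_filter] at hi
              rw [(hmaps i hi.1).2.2, hi.2]
          _ = ((N.filter (fun i => Ep i = E')).card : ℝ) * p ^ (F.card - E'.card) := by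
              rw [Finset.sum_const, nsmul_eq_mul]
          _ ≤ ((Φ E').card : ℝ) * p ^ (F.card - E'.card) := by
              apply mul_le_mul_of_nonneg_right _ (by positivity)
              have : (N.filter (fun i => Ep i = E')).card ≤ (Φ E').card := by
                apply Finset.card_le_card_of_injOn emb
                · intro i hi
                  rw [Finset.mem_coe, Finset.mem_filter] at hi
                  rw [Finset.mem_coe, ← hi.2]
                  exact (hmaps i hi.1).2.1
                · intro i hi i' hi' h
                  exact hinjN (Finset.mem_filter.1 hi).1 (Finset.mem_filter.1 hi').1 h
              exact_mod_cast this
          _ ≤ ((r * (((1 + r * D : ℕ) : ℝ) ^ r) ^ r * r) * (n:ℝ) ^ (ncomp E' - 1)) * p ^ (F.card - E'.card) :=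
              mul_le_mul_of_nonneg_right (hΦc E') (by positivity)
          _ = (r * (((1 + r * D : ℕ) : ℝ) ^ r) ^ r * r) * ((n:ℝ) ^ (ncomp E' - 1) * p ^ (F.card - E'.card)) := by
              ring
          _ ≤ _ := by
              apply mul_le_mul_of_nonneg_left _ (by positivity)
              exact term_bound hbal (fun e he => by rw [hFc e he]; exact hu) (by omega) hE'.1 hE'.2.1 hE'.2.2
                p L x hp hL hx hxn hpL
    _ = (𝓔.card : ℝ) * ((r * (((1 + r * D : ℕ) : ℝ) ^ r) ^ r * r) * (L * x)) := by
        rw [Finset.sum_const, nsmul_eq_mul]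
    _ ≤ 2 ^ F.card * ((r * (((1 + r * D : ℕ) : ℝ) ^ r) ^ r * r) * (L * x)) := by
        apply mul_le_mul_of_nonneg_right _ (by positivity)
        have : 𝓔.card ≤ 2 ^ F.card := by
          rw [← Finset.card_powerset]
          exact Finset.card_le_card (Finset.filter_subset _ _)
        exact_mod_cast this
    _ = _ := by ring

end Counting


/-! ### The one-shot coupling -/
section OneShot

variable {r : ℕ} {F : Finset (Finset (Fin r))} {n u : ℕ}

/-- Bad configurations. -/
def BadC (r K D : ℕ) {n : ℕ} (S : Finset (FE n)) : Prop :=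
  BadSmall r K S ∨ (S.card = D ∧ ∃ v, ∀ h ∈ S, v ∈ h.1)

lemma deg_le_of_good {K D : ℕ} (R : Finset (FE n)) (hgood : ∀ S, S ⊆ R → ¬ BadC r K D S) (v : Fin n) :
    degFE R v ≤ D := by
  by_contra hcon
  push Not at hcon
  obtain ⟨S, hS, hSc⟩ := Finset.exists_subset_card_eq (s := R.filter (fun h : FE n => v ∈ h.1)) (n := D) hcon.le
  exact hgood S (hS.trans (Finset.filter_subset _ _))
    (Or.inr ⟨hSc, v, fun h hh => (Finset.mem_filter.1 (hS hh)).2⟩)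

lemma ynI_empty {α ι : Type*} [DecidableEq α] [DecidableEq ι] (E : ι → Finset α) (G : Finset α) :
    ynI E ∅ ∅ G = 1 := by
  simp [ynI]

theorem oneshot (hu : 2 ≤ u) (hFc : ∀ e ∈ F, e.card = u) (hF : Nice u F) {K D : ℕ} (hK : F.card ≤ K)
    (p π ε L x : ℝ) (hp : 0 ≤ p) (hp1 : p ≤ 1) (hπ0 : 0 < π) (hπ1 : π ≤ 1)
    (hπ : π = p ^ F.card * (1 - ε)) (hε1 : ε ≤ 1)
    (hD : 1 ≤ D)
    (hL : 1 ≤ L) (hx : 0 ≤ x) (hxn : x ^ F.card * n = 1)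
    (hpL : p ^ F.card * (n : ℝ) ^ (r - 1) ≤ L)
    (hε : 2 ^ F.card * (r * (((1 + r * D : ℕ) : ℝ) ^ r) ^ r * r) * (L * x) ≤ ε) :
    ∃ c : Finset (FE n) → Finset (Finset (Fin n)) → ℝ, (∀ H G, 0 ≤ c H G) ∧
      (∀ H, H ⊆ allFEdges F n → ∑ G ∈ (allUEdges u n).powerset, c H G = bw (allFEdges F n) π H) ∧
      (∀ G, G ⊆ allUEdges u n → ∑ H ∈ (allFEdges F n).powerset, c H G = bw (allUEdges u n) p G) ∧
      (∀ H G, H ⊆ allFEdges F n → c H G ≠ 0 → ∀ i ∈ H, (¬ ∃ S, S ⊆ H ∧ i ∈ S ∧ BadC r K D S) → i.2 ⊆ G) := by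
  set A := allFEdges F n with hA
  set U := allUEdges u n with hU
  have hAU : ∀ i ∈ A, i.2 ⊆ U := by
    intro i hi e he
    exact mem_allUEdges.2 ((mem_allFEdges.1 hi).card_edge hFc he)
  have hgood0 : ∀ S : Finset (FE n), S ⊆ ∅ → ¬ BadC r K D S := by
    intro S hS
    have : S = ∅ := Finset.subset_empty.1 hS
    subst this
    rintro (h | h)
    · have := h.1; simp at this
    · have := h.1; simp at this; omega
  have hstep : ∀ (R N : Finset (FE n)) (j : FE n), R ⊆ A → N ⊆ A → j ∈ A →
      (∀ S, S ⊆ R → ¬ BadC r K D S) → (∀ S, S ⊆ insert j R → ¬ BadC r K D S) →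
      (∀ i ∈ N, i ∉ R ∧ i ≠ j) →
      π * bE U p (ynI Prod.snd R N) ≤ bE U p (ynI Prod.snd (insert j R) N) := by
    intro R N j hRA hNA hjA hgR hgjR hN
    rw [hπ]
    apply explore_step U p ε hp hp1 Prod.snd F.card R N j
    · exact (mem_allFEdges.1 hjA).card_snd.le
    · intro i hi
      rw [Finset.mem_insert, Finset.mem_union] at hi
      rcases hi with rfl | hi | hi
      · exact hAU _ hjA
      · exact hAU _ (hRA hi)
      · exact hAU _ (hNA hi)
    · have hb : j.2 ∪ R.biUnion Prod.snd = (insert j R).biUnion Prod.snd := by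
        rw [Finset.biUnion_insert]
      rw [hb]
      refine le_trans ?_ hε
      apply count_sum hu hFc hF hK (insert j R) _ _ (deg_le_of_good _ hgjR) j (Finset.mem_insert_self _ _) _ _
        p L x hp hL hx hxn hpL
      · intro h hh
        rw [Finset.mem_insert] at hh
        rcases hh with rfl | hh
        · exact mem_allFEdges.1 hjA
        · exact mem_allFEdges.1 (hRA hh)
      · intro S hS hb
        exact hgjR S hS (Or.inl hb)
      · intro i hi
        rw [Finset.mem_filter] at hi
        refine ⟨mem_allFEdges.1 (hNA hi.1), ?_, ?_⟩
        · rw [Finset.mem_insert, not_or]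
          exact ⟨(hN i hi.1).2, (hN i hi.1).1⟩
        · intro hd
          exact hi.2 (Finset.disjoint_of_subset_right Finset.sdiff_subset hd)
    · exact hε1
  obtain ⟨c, hc0, hcH, hcG, hcg⟩ := explore U p π hp hp1 hπ0 hπ1 (Prod.snd : FE n → _)
    (fun R => ∀ S, S ⊆ R → ¬ BadC r K D S) A hstep A.toList (Finset.nodup_toList A)
    (fun j hj => Finset.mem_toList.1 hj) ∅ ∅ (Finset.empty_subset _) (Finset.empty_subset _)
    hgood0 (by simp) (by simp)
  simp only [Finset.toList_toFinset] at hcH hcG hcg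
  refine ⟨c, hc0, ?_, ?_, ?_⟩
  · intro H hH
    rw [hcH H hH, bE_congr (g := fun _ => 1) (fun S _ => ynI_empty _ S), bE_one, mul_one]
  · intro G hG
    rw [hcG G hG, ynI_empty, mul_one]
  · intro H G hH hc i hi hno
    apply hcg H G hH hc i
    by_contra hng
    apply hno
    obtain ⟨S, hS1, hS2, hS3⟩ := greedy_removed (BadC r K D) A.toList ∅ H hgood0 i
      (Finset.mem_toList.2 (hH hi)) hi hng
    exact ⟨S, by simpa using hS1, hS2, hS3⟩

end OneShot


/-! ### Sorting by keys and random orders -/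
section Sorting

variable {α : Type*}

/-- `f` lists the elements of `U` in increasing order of `κ`. -/
def IsSort {k : ℕ} (U : Finset α) (κ : α → ℕ) (f : Fin k → α) : Prop :=
  (∀ i, f i ∈ U) ∧ StrictMono (fun i => κ (f i))

lemma IsSort.injective {k : ℕ} {U : Finset α} {κ : α → ℕ} {f : Fin k → α} (h : IsSort U κ f) :
    Function.Injective f := by
  intro i j hij
  apply h.2.injective
  simp only [hij]

lemma IsSort.surj {k : ℕ} {U : Finset α} {κ : α → ℕ} {f : Fin k → α} (h : IsSort U κ f)
    (hk : U.card = k) {a : α} (ha : a ∈ U) : ∃ i, f i = a := by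
  have h1 : Finset.univ.image f = U := by
    apply Finset.eq_of_subset_of_card_le
    · intro x hx
      obtain ⟨i, _, rfl⟩ := Finset.mem_image.1 hx
      exact h.1 i
    · rw [Finset.card_image_of_injective _ h.injective, hk]; simp
  rw [← h1, Finset.mem_image] at ha
  obtain ⟨i, _, hi⟩ := ha
  exact ⟨i, hi⟩

lemma IsSort.unique {k : ℕ} {U : Finset α} {κ : α → ℕ} {f f' : Fin k → α} (h : IsSort U κ f)
    (h' : IsSort U κ f') (hk : U.card = k) (hκ : Set.InjOn κ U) : f = f' := by
  have hc : (U.image κ).card = k := by rw [Finset.card_image_of_injOn hκ, hk]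
  have h1 := Finset.orderEmbOfFin_unique hc (f := fun i => κ (f i))
    (fun i => Finset.mem_image_of_mem _ (h.1 i)) h.2
  have h2 := Finset.orderEmbOfFin_unique hc (f := fun i => κ (f' i))
    (fun i => Finset.mem_image_of_mem _ (h'.1 i)) h'.2
  funext i
  apply hκ (h.1 i) (h'.1 i)
  exact congrFun (h1.trans h2.symm) i

lemma exists_isSort {k : ℕ} (U : Finset α) (κ : α → ℕ) (hk : U.card = k) (hκ : Set.InjOn κ U) :
    ∃ f : Fin k → α, IsSort U κ f := by
  have hc : (U.image κ).card = k := by rw [Finset.card_image_of_injOn hκ, hk]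
  have hex : ∀ i : Fin k, ∃ a ∈ U, κ a = (U.image κ).orderEmbOfFin hc i := by
    intro i
    have := Finset.orderEmbOfFin_mem (U.image κ) hc i
    rw [Finset.mem_image] at this
    exact this
  choose f hf1 hf2 using hex
  refine ⟨f, hf1, ?_⟩
  intro i j hij
  simp only [hf2]
  exact ((U.image κ).orderEmbOfFin hc).strictMono hij

/-- The sorted list. -/
def sortFn [Inhabited α] (U : Finset α) (κ : α → ℕ) (k : ℕ) : Fin k → α :=
  if h : ∃ f : Fin k → α, IsSort U κ f then h.choose else fun _ => default

lemma sortFn_isSort [Inhabited α] {U : Finset α} {κ : α → ℕ} {k : ℕ} (hk : U.card = k)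
    (hκ : Set.InjOn κ U) : IsSort U κ (sortFn U κ k) := by
  have h := exists_isSort U κ hk hκ
  rw [sortFn, dif_pos h]
  exact h.choose_spec

lemma mem_proc [DecidableEq α] {m : ℕ} {f : Fin m → α} {t : ℕ} {a : α} :
    a ∈ proc f t ↔ ∃ i : Fin m, (i : ℕ) < t ∧ f i = a := by
  simp [proc]

lemma proc_mono [DecidableEq α] {m : ℕ} (f : Fin m → α) {t t' : ℕ} (h : t ≤ t') : proc f t ⊆ proc f t' := by
  intro a ha
  rw [mem_proc] at ha ⊢
  obtain ⟨i, hi, rfl⟩ := ha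
  exact ⟨i, by omega, rfl⟩

lemma proc_card [DecidableEq α] {m : ℕ} {f : Fin m → α} (hf : Function.Injective f) {t : ℕ} (ht : t ≤ m) :
    (proc f t).card = t := by
  rw [proc, Finset.card_image_of_injective _ hf]
  rw [Fin.card_filter_val_lt, min_eq_right ht]

lemma IsSort.down [DecidableEq α] {k : ℕ} {U : Finset α} {κ : α → ℕ} {f : Fin k → α} (h : IsSort U κ f)
    (hk : U.card = k) {t : ℕ} {a b : α} (ha : a ∈ proc f t) (hb : b ∈ U) (hba : κ b ≤ κ a) :
    b ∈ proc f t := by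
  obtain ⟨j, rfl⟩ := h.surj hk hb
  rw [mem_proc] at ha ⊢
  obtain ⟨i, hi, rfl⟩ := ha
  have : j ≤ i := by
    by_contra hcon
    push Not at hcon
    have := h.2 hcon
    simp only at this
    omega
  exact ⟨j, lt_of_le_of_lt this hi, rfl⟩

lemma IsSort.mem_proc_iff [DecidableEq α] {k : ℕ} {U : Finset α} {κ : α → ℕ} {f : Fin k → α} (h : IsSort U κ f)
    (hk : U.card = k) {i : Fin k} {b : α} (hb : b ∈ U) :
    b ∈ proc f i ↔ κ b < κ (f i) := by
  obtain ⟨j, rfl⟩ := h.surj hk hb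
  rw [mem_proc]
  constructor
  · rintro ⟨j', hj', he⟩
    have := h.injective he
    subst this
    exact h.2 hj'
  · intro hlt
    refine ⟨j, ?_, rfl⟩
    have := (h.2.lt_iff_lt (a := j) (b := i)).1 hlt
    exact this

/-- If `H ⊆ U` consists of the elements of smallest key then it is an initial segment. -/
lemma IsSort.proc_comparable [DecidableEq α] {k : ℕ} {U H : Finset α} {κ : α → ℕ} {f : Fin k → α}
    (h : IsSort U κ f) (hk : U.card = k) (hH : H ⊆ U) (hsmall : ∀ a ∈ H, ∀ b ∈ U, b ∉ H → κ a < κ b) :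
    (∀ t, t ≤ H.card → proc f t ⊆ H) ∧ (∀ t, H.card ≤ t → H ⊆ proc f t) := by
  have hcU : H.card ≤ k := by rw [← hk]; exact Finset.card_le_card hH
  have hor : ∀ t, proc f t ⊆ H ∨ H ⊆ proc f t := by
    intro t
    by_contra hcon
    push Not at hcon
    obtain ⟨b, hb, hbH⟩ := Finset.not_subset.1 hcon.1
    obtain ⟨a, ha, haP⟩ := Finset.not_subset.1 hcon.2
    apply haP
    have hbU : b ∈ U := by
      rw [mem_proc] at hb
      obtain ⟨i, _, rfl⟩ := hb
      exact h.1 i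
    exact h.down hk hb (hH ha) (hsmall a ha b hbU hbH).le
  have heq : proc f H.card = H := by
    have hc := proc_card h.injective hcU
    rcases hor H.card with h1 | h1
    · exact Finset.eq_of_subset_of_card_le h1 hc.ge
    · exact (Finset.eq_of_subset_of_card_le h1 hc.le).symm
  constructor
  · intro t ht
    rw [← heq]; exact proc_mono f ht
  · intro t ht
    conv_lhs => rw [← heq]
    exact proc_mono f ht

lemma exists_perm_comp {ι : Type*} [Fintype α] (a b : ι → α) (ha : Function.Injective a)
    (hb : Function.Injective b) : ∃ τ : Equiv.Perm α, ∀ i, τ (a i) = b i := by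
  let e : {x // x ∈ Set.range a} ≃ {x // x ∈ Set.range b} :=
    (Equiv.ofInjective a ha).symm.trans (Equiv.ofInjective b hb)
  refine ⟨e.extendSubtype, fun i => ?_⟩
  rw [Equiv.extendSubtype_apply_of_mem e (a i) ⟨i, rfl⟩]
  have : (⟨a i, ⟨i, rfl⟩⟩ : {x // x ∈ Set.range a}) = Equiv.ofInjective a ha i := rfl
  simp only [e, Equiv.trans_apply, this, Equiv.symm_apply_apply]
  rfl

/-- Sorting is equivariant. -/
lemma IsSort.perm [DecidableEq α] {k : ℕ} {U : Finset α} {κ κ' : α → ℕ} {f : Fin k → α} (h : IsSort U κ f)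
    (τ : Equiv.Perm α) (hτ : ∀ a, a ∈ U → τ a ∈ U) (hκ : ∀ a ∈ U, κ' (τ a) = κ a) :
    IsSort U κ' (fun i => τ (f i)) := by
  refine ⟨fun i => hτ _ (h.1 i), ?_⟩
  intro i j hij
  simp only [hκ _ (h.1 _)]
  exact h.2 hij

end Sorting

section Orders

/-- Index type of the auxiliary labels. -/
abbrev Lam (n : ℕ) := Finset (Fin n) ⊕ (FE n × Finset (Fin n))

/-- Random labels. -/
abbrev Lab (n : ℕ) := Lam n ≃ Fin (Fintype.card (Lam n))

variable {n : ℕ}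

/-- Key of a `u`-edge. -/
def keyU (G : Finset (Finset (Fin n))) (σ : Lab n) (e : Finset (Fin n)) : ℕ :=
  (σ (Sum.inl e) : ℕ) + if e ∈ G then 0 else Fintype.card (Lam n)

/-- The owner of an edge. -/
def own (H : Finset (FE n)) (e : Finset (Fin n)) : FE n :=
  if h : ∃ h ∈ H, e ∈ h.2 then h.choose else default

lemma own_mem {H : Finset (FE n)} {e : Finset (Fin n)} {h : FE n} (hh : h ∈ H) (he : e ∈ h.2) :
    own H e ∈ H ∧ e ∈ (own H e).2 := by
  have hex : ∃ h ∈ H, e ∈ h.2 := ⟨h, hh, he⟩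
  rw [own, dif_pos hex]
  exact hex.choose_spec

/-- The label used by `F`-edge `h` at its `u`-edge `e`. -/
def xlab (H : Finset (FE n)) (h : FE n) (e : Finset (Fin n)) : Lam n :=
  if h ∈ H ∧ own H e = h then Sum.inl e else Sum.inr (h, e)

lemma xlab_inj {H : Finset (FE n)} {h h' : FE n} {e e' : Finset (Fin n)}
    (hx : xlab H h e = xlab H h' e') : h = h' ∧ e = e' := by
  unfold xlab at hx
  split_ifs at hx with h1 h2 h2
  · have := Sum.inl.inj hx
    subst this
    exact ⟨h1.2.symm.trans h2.2, rfl⟩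
  · have := Sum.inr.inj hx
    exact Prod.ext_iff.1 this

/-- The time label of an `F`-edge. -/
def tlab (H : Finset (FE n)) (σ : Lab n) (h : FE n) : ℕ :=
  h.2.sup (fun e => (σ (xlab H h e) : ℕ))

/-- Key of an `F`-edge. -/
def keyH (H : Finset (FE n)) (σ : Lab n) (h : FE n) : ℕ :=
  tlab H σ h + if h ∈ H then 0 else Fintype.card (Lam n)

lemma tlab_lt (H : Finset (FE n)) (σ : Lab n) (h : FE n) : tlab H σ h < Fintype.card (Lam n) := by
  rw [tlab, Finset.sup_lt_iff]
  · intro e _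
    exact (σ _).2
  · exact Fintype.card_pos_iff.2 ⟨Sum.inl ∅⟩

lemma keyU_inj (G : Finset (Finset (Fin n))) (σ : Lab n) (U : Finset (Finset (Fin n))) :
    Set.InjOn (keyU G σ) U := by
  intro e _ e' _ hk
  unfold keyU at hk
  have h1 := (σ (Sum.inl e)).2
  have h2 := (σ (Sum.inl e')).2
  have h3 : (σ (Sum.inl e) : ℕ) = σ (Sum.inl e') := by
    split_ifs at hk <;> omega
  exact Sum.inl.inj (σ.injective (Fin.ext h3))

lemma tlab_inj (H : Finset (FE n)) (σ : Lab n) {h h' : FE n} (hne : h.2.Nonempty) (hne' : h'.2.Nonempty)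
    (ht : tlab H σ h = tlab H σ h') : h = h' := by
  obtain ⟨e, he, h1⟩ := Finset.exists_mem_eq_sup h.2 hne (fun e => (σ (xlab H h e) : ℕ))
  obtain ⟨e', he', h2⟩ := Finset.exists_mem_eq_sup h'.2 hne' (fun e => (σ (xlab H h' e) : ℕ))
  unfold tlab at ht
  rw [h1, h2] at ht
  exact (xlab_inj (σ.injective (Fin.ext ht))).1

lemma keyH_inj (H : Finset (FE n)) (σ : Lab n) {A : Finset (FE n)} (hA : ∀ h ∈ A, h.2.Nonempty) :
    Set.InjOn (keyH H σ) A := by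
  intro h hh h' hh' hk
  unfold keyH at hk
  have h1 := tlab_lt H σ h
  have h2 := tlab_lt H σ h'
  exact tlab_inj H σ (hA h hh) (hA h' hh') (by split_ifs at hk <;> omega)

/-- The order of `u`-edges. -/
def ordU (u : ℕ) (G : Finset (Finset (Fin n))) (σ : Lab n) : Fin (Nat.choose n u) → Finset (Fin n) :=
  sortFn (allUEdges u n) (keyU G σ) (Nat.choose n u)

/-- The order of `F`-edges. -/
def ordH {r : ℕ} (F : Finset (Finset (Fin r))) (H : Finset (FE n)) (σ : Lab n) : Fin (Mnum F n) → FE n :=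
  sortFn (allFEdges F n) (keyH H σ) (Mnum F n)

lemma card_allUEdges (u : ℕ) : (allUEdges u n).card = Nat.choose n u := by
  rw [allUEdges, Finset.univ_filter_card_eq, Finset.card_powersetCard]
  simp

lemma ordU_isSort (u : ℕ) (G : Finset (Finset (Fin n))) (σ : Lab n) :
    IsSort (allUEdges u n) (keyU G σ) (ordU u G σ) :=
  sortFn_isSort (card_allUEdges u) (keyU_inj G σ _)

variable {r : ℕ} {F : Finset (Finset (Fin r))}

lemma allF_nonempty_edges (hF0 : F.Nonempty) : ∀ h ∈ allFEdges F n, h.2.Nonempty := by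
  intro h hh
  rw [← Finset.card_pos, (mem_allFEdges.1 hh).card_snd, Finset.card_pos]
  exact hF0

lemma ordH_isSort (hF0 : F.Nonempty) (H : Finset (FE n)) (σ : Lab n) :
    IsSort (allFEdges F n) (keyH H σ) (ordH F H σ) :=
  sortFn_isSort rfl (keyH_inj H σ (allF_nonempty_edges hF0))

lemma mem_of_perm {α : Type*} [Fintype α] {U : Finset α} {τ : Equiv.Perm α} (hτ : ∀ a, a ∈ U → τ a ∈ U)
    {a : α} : τ a ∈ U ↔ a ∈ U := by
  constructor
  · intro h
    have h1 : U.map τ.toEmbedding = U := by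
      apply Finset.eq_of_subset_of_card_le
      · intro x hx
        obtain ⟨y, hy, rfl⟩ := Finset.mem_map.1 hx
        exact hτ y hy
      · simp
    rw [← h1, Finset.mem_map] at h
    obtain ⟨y, hy, hya⟩ := h
    have : y = a := τ.injective hya
    rwa [← this]
  · exact hτ a

/-- Equivariance of the order of `u`-edges. -/
lemma ordU_equiv (u : ℕ) (τ : Equiv.Perm (Finset (Fin n))) (hτ : ∀ a, a ∈ allUEdges u n → τ a ∈ allUEdges u n)
    (G : Finset (Finset (Fin n))) (P : (Fin (Nat.choose n u) → Finset (Fin n)) → ℝ) :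
    ∑ σ : Lab n, P (ordU u (G.image τ) σ) = ∑ σ : Lab n, P (fun i => τ (ordU u G σ i)) := by
  symm
  let β : Equiv.Perm (Lam n) := Equiv.sumCongr τ (Equiv.refl _)
  let θ : Lab n ≃ Lab n := ⟨fun σ => β.symm.trans σ, fun σ => β.trans σ,
    fun σ => by ext x; simp, fun σ => by ext x; simp⟩
  apply Fintype.sum_equiv θ
  intro σ
  congr 1
  apply IsSort.unique (U := allUEdges u n) (κ := keyU (G.image τ) (θ σ)) _ (ordU_isSort u _ _)
    (card_allUEdges u) (keyU_inj _ _ _)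
  apply (ordU_isSort u G σ).perm τ hτ
  intro a _
  have h1 : (θ σ) (Sum.inl (τ a)) = σ (Sum.inl a) := by
    simp [θ, β]
  have h2 : τ a ∈ G.image τ ↔ a ∈ G := by simp
  simp only [keyU, h1, h2]

/-- Equivariance of the order of `F`-edges. -/
lemma ordH_equiv (hF0 : F.Nonempty) (τ : Equiv.Perm (FE n)) (hτ : ∀ a, a ∈ allFEdges F n → τ a ∈ allFEdges F n)
    (H : Finset (FE n)) (P : (Fin (Mnum F n) → FE n) → ℝ) :
    ∑ σ : Lab n, P (ordH F (H.image τ) σ) = ∑ σ : Lab n, P (fun i => τ (ordH F H σ i)) := by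
  symm
  -- enumerate the edges of every `F`-edge
  have hen : ∀ h : {h // h ∈ allFEdges F n}, ∃ en : Fin F.card → Finset (Fin n),
      Function.Injective en ∧ Finset.univ.image en = h.1.2 := by
    intro h
    have hc : h.1.2.card = F.card := (mem_allFEdges.1 h.2).card_snd
    let e := Finset.equivFinOfCardEq hc
    refine ⟨fun i => (e.symm i : Finset (Fin n)), ?_, ?_⟩
    · intro i j hij
      exact e.symm.injective (Subtype.ext hij)
    · ext x
      simp only [Finset.mem_image, Finset.mem_univ, true_and]
      constructor
      · rintro ⟨i, rfl⟩
        exact (e.symm i).2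
      · intro hx
        exact ⟨e ⟨x, hx⟩, by simp⟩
  choose en hen1 hen2 using hen
  let τ' : {h // h ∈ allFEdges F n} → {h // h ∈ allFEdges F n} := fun h => ⟨τ h.1, hτ _ h.2⟩
  obtain ⟨β, hβ⟩ := exists_perm_comp
    (fun x : {h // h ∈ allFEdges F n} × Fin F.card => xlab H x.1.1 (en x.1 x.2))
    (fun x : {h // h ∈ allFEdges F n} × Fin F.card => xlab (H.image τ) (τ x.1.1) (en (τ' x.1) x.2))
    (by
      rintro ⟨h, i⟩ ⟨h', i'⟩ hx
      obtain ⟨h1, h2⟩ := xlab_inj hx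
      have : h = h' := Subtype.ext h1
      subst this
      exact Prod.ext rfl (hen1 h h2))
    (by
      rintro ⟨h, i⟩ ⟨h', i'⟩ hx
      obtain ⟨h1, h2⟩ := xlab_inj hx
      have : h = h' := Subtype.ext (τ.injective h1)
      subst this
      exact Prod.ext rfl (hen1 _ h2))
  let θ : Lab n ≃ Lab n := ⟨fun σ => β.symm.trans σ, fun σ => β.trans σ,
    fun σ => by ext x; simp, fun σ => by ext x; simp⟩
  apply Fintype.sum_equiv θ
  intro σ
  congr 1
  apply IsSort.unique (U := allFEdges F n) (κ := keyH (H.image τ) (θ σ)) _ (ordH_isSort hF0 _ _)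
    rfl (keyH_inj _ _ (allF_nonempty_edges hF0))
  apply (ordH_isSort hF0 H σ).perm τ hτ
  intro a ha
  have h2 : τ a ∈ H.image τ ↔ a ∈ H := by simp
  have h3 : tlab (H.image τ) (θ σ) (τ a) = tlab H σ a := by
    unfold tlab
    have e1 : a.2 = Finset.univ.image (en ⟨a, ha⟩) := (hen2 ⟨a, ha⟩).symm
    have e2 : (τ a).2 = Finset.univ.image (en (τ' ⟨a, ha⟩)) := (hen2 (τ' ⟨a, ha⟩)).symm
    rw [e1, e2, Finset.sup_image, Finset.sup_image]
    apply Finset.sup_congr rfl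
    intro i _
    have := hβ (⟨a, ha⟩, i)
    simp only at this
    simp only [Function.comp_apply, θ, Equiv.coe_fn_mk, Equiv.trans_apply, ← this, Equiv.symm_apply_apply]
  simp only [keyH, h3, h2]

end Orders


/-! ### The deterministic conclusion -/
section Determ

variable {r : ℕ} {F : Finset (Finset (Fin r))} {n u : ℕ}

lemma inter_le_two_of_good {K : ℕ} (hK : 2 ≤ K) (hr : 2 ≤ r) {H : Finset (FE n)} (hH : ∀ h ∈ H, IsFEdge F n h)
    (hgood : ∀ S, S ⊆ H → ¬ BadSmall r K S) {h h' : FE n} (hh : h ∈ H) (hh' : h' ∈ H) (hne : h ≠ h') :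
    (h.1 ∩ h'.1).card ≤ 2 := by
  by_contra hcon
  apply hgood {h, h'}
  · intro x hx
    rw [Finset.mem_insert, Finset.mem_singleton] at hx
    rcases hx with rfl | rfl
    · exact hh
    · exact hh'
  · have hc := Finset.card_pair hne
    refine ⟨by rw [hc], by rw [hc]; exact hK, ?_⟩
    rw [hc, Finset.biUnion_insert, Finset.singleton_biUnion]
    have h1 := Finset.card_union_add_card_inter h.1 h'.1
    rw [(hH h hh).card_fst, (hH h' hh').card_fst] at h1
    omega

theorem determ (hu : 2 ≤ u) (hFc : ∀ e ∈ F, e.card = u) (hF : Nice u F) {K : ℕ} (hK : 2 ≤ K)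
    (H : Finset (FE n)) (G : Finset (Finset (Fin n))) (σ : Lab n) (m gap : ℕ)
    (hHA : H ⊆ allFEdges F n)
    (hgood : ∀ S, S ⊆ H → ¬ BadSmall r K S)
    (hHG : ∀ i ∈ H, i.2 ⊆ G)
    (hcov : ∀ v : Fin n, ∃ h ∈ H, v ∈ h.1)
    (hlast : H.card ≤ m + gap)
    (hTm : ¬ ∀ v : Fin n, ∃ h ∈ proc (ordH F H σ) m, v ∈ h.1)
    (hX : ∀ v : Fin n, (¬ ∃ h ∈ proc (ordH F H σ) m, v ∈ h.1) → ∀ i, IsFEdge F n i → v ∈ i.1 →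
      i.2 ⊆ G → i ∈ H)
    (hP : ∀ v : Fin n, (¬ ∃ h ∈ proc (ordH F H σ) m, v ∈ h.1) → ∀ i ∈ H, v ∈ i.1 →
      ∀ i' ∈ H, i' ≠ i → (i.1 ∩ i'.1).card < 2) :
    ∀ h ∈ proc (ordH F H σ) (THit F n (ordH F H σ)),
      ¬ h.2 ⊆ proc (ordU u G σ) (TGHit u F n (ordU u G σ)) →
        ∃ h' ∈ proc (ordH F H σ) (THit F n (ordH F H σ) + gap),
          h' ∉ proc (ordH F H σ) (THit F n (ordH F H σ)) ∧ Partner u h h' := by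
  have hT := hF.2.1
  have hr := hT.1
  have hF0 := F_nonempty hT
  have hHF : ∀ h ∈ H, IsFEdge F n h := fun h hh => mem_allFEdges.1 (hHA hh)
  set f := ordH F H σ with hf
  have hs : IsSort (allFEdges F n) (keyH H σ) f := ordH_isSort hF0 H σ
  have hsU : IsSort (allUEdges u n) (keyU G σ) (ordU u G σ) := ordU_isSort u G σ
  obtain ⟨hcmp1, hcmp2⟩ := hs.proc_comparable (H := H) rfl hHA (by
    intro a ha b _ hb
    rw [keyH, keyH, if_pos ha, if_neg hb]
    have := tlab_lt H σ a
    omega)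
  have hHcM : H.card ≤ Mnum F n := Finset.card_le_card hHA
  set T := THit F n f with hTdef
  have hne : {t : ℕ | ∀ v : Fin n, ∃ h ∈ proc f t, v ∈ h.1}.Nonempty := by
    refine ⟨H.card, fun v => ?_⟩
    obtain ⟨h, hh, hv⟩ := hcov v
    exact ⟨h, hcmp2 _ le_rfl hh, hv⟩
  have hTmem : ∀ v : Fin n, ∃ h ∈ proc f T, v ∈ h.1 := Nat.sInf_mem hne
  have hTH : T ≤ H.card := by
    apply Nat.sInf_le
    intro v
    obtain ⟨h, hh, hv⟩ := hcov v
    exact ⟨h, hcmp2 _ le_rfl hh, hv⟩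
  have hmT : m < T := by
    by_contra hcon
    push Not at hcon
    apply hTm
    intro v
    obtain ⟨h, hh, hv⟩ := hTmem v
    exact ⟨h, proc_mono f hcon hh, hv⟩
  have hnot : T - 1 ∉ {t : ℕ | ∀ v : Fin n, ∃ h ∈ proc f t, v ∈ h.1} :=
    Nat.notMem_of_lt_sInf (show T - 1 < T by omega)
  rw [Set.mem_setOf_eq, not_forall] at hnot
  obtain ⟨v, hv⟩ := hnot
  have hvm : ¬ ∃ h ∈ proc f m, v ∈ h.1 := by
    rintro ⟨h, hh, hvh⟩
    exact hv ⟨h, proc_mono f (by omega) hh, hvh⟩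
  let i0 : Fin (Mnum F n) := ⟨T - 1, by omega⟩
  have hPT : ∀ h, h ∈ proc f T → h ∈ H ∧ tlab H σ h ≤ tlab H σ (f i0) := by
    intro h hh
    have h1 := hcmp1 T hTH hh
    refine ⟨h1, ?_⟩
    have h0 : f i0 ∈ H := hcmp1 T hTH (mem_proc.2 ⟨i0, by change T - 1 < T; omega, rfl⟩)
    obtain ⟨i, hi, rfl⟩ := mem_proc.1 hh
    have hle : i ≤ i0 := by change (i : ℕ) ≤ T - 1; omega
    have := hs.2.monotone hle
    simpa only [keyH, if_pos h1, if_pos h0, add_zero] using this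
  have hi0H : f i0 ∈ H := (hPT _ (mem_proc.2 ⟨i0, by change T - 1 < T; omega, rfl⟩)).1
  have hge : ∀ i ∈ H, v ∈ i.1 → tlab H σ (f i0) ≤ tlab H σ i := by
    intro i hi hvi
    by_contra hcon
    push Not at hcon
    apply hv
    refine ⟨i, ?_, hvi⟩
    have : i ∈ proc f i0 := by
      rw [hs.mem_proc_iff rfl (hHA hi)]
      simpa only [keyH, if_pos hi, if_pos hi0H, add_zero] using hcon
    exact this
  -- the time for G
  have hneG : {t : ℕ | ∀ v : Fin n, ∃ h : FE n, IsFEdge F n h ∧ v ∈ h.1 ∧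
      h.2 ⊆ proc (ordU u G σ) t}.Nonempty := by
    refine ⟨Nat.choose n u, fun w => ?_⟩
    obtain ⟨h, hh, hw⟩ := hcov w
    refine ⟨h, hHF h hh, hw, ?_⟩
    intro e he
    obtain ⟨i, hi⟩ := hsU.surj (card_allUEdges u) (mem_allUEdges.2 ((hHF h hh).card_edge hFc he))
    exact mem_proc.2 ⟨i, i.2, hi⟩
  set TG := TGHit u F n (ordU u G σ) with hTG
  have hTGmem : ∀ v : Fin n, ∃ h : FE n, IsFEdge F n h ∧ v ∈ h.1 ∧
      h.2 ⊆ proc (ordU u G σ) TG := Nat.sInf_mem hneG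
  intro h hh hnsub
  obtain ⟨e, he, heG⟩ := Finset.not_subset.1 hnsub
  have hhH := (hPT h hh).1
  obtain ⟨ho1, ho2⟩ := own_mem hhH he
  set h' := own H e with hh'
  have hec : e.card = u := (hHF h hhH).card_edge hFc he
  by_cases hcase : h' ∈ proc f T
  · exfalso
    obtain ⟨i, hiF, hvi, hiG⟩ := hTGmem v
    have hσe : (σ (Sum.inl e) : ℕ) ≤ tlab H σ (f i0) := by
      refine le_trans ?_ (hPT h' hcase).2
      have h1 : xlab H h' e = Sum.inl e := by rw [xlab, if_pos ⟨ho1, rfl⟩]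
      rw [← h1]
      exact Finset.le_sup (f := fun e => (σ (xlab H h' e) : ℕ)) ho2
    have heGm : e ∈ G := hHG h hhH he
    have hkey : ∀ e' ∈ i.2, e' ∈ G ∧ (σ (Sum.inl e') : ℕ) < σ (Sum.inl e) := by
      intro e' he'
      have hlt : keyU G σ e' < keyU G σ e := by
        by_contra hcon
        push Not at hcon
        exact heG (hsU.down (card_allUEdges u) (hiG he') (mem_allUEdges.2 hec) hcon)
      rw [keyU, keyU, if_pos heGm] at hlt
      have := (σ (Sum.inl e)).2
      split_ifs at hlt with h1
      · exact ⟨h1, by omega⟩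
      · omega
    have hiH : i ∈ H := hX v hvm i hiF hvi (fun e' he' => (hkey e' he').1)
    have hown : ∀ e' ∈ i.2, xlab H i e' = Sum.inl e' := by
      intro e' he'
      rw [xlab, if_pos]
      refine ⟨hiH, ?_⟩
      by_contra hne'
      obtain ⟨hm1, hm2⟩ := own_mem hiH he'
      have h1 := hP v hvm i hiH hvi _ hm1 hne'
      have h2 : e' ⊆ i.1 ∩ (own H e').1 := Finset.subset_inter (hiF.sub he') ((hHF _ hm1).sub hm2)
      have h3 := Finset.card_le_card h2
      rw [hiF.card_edge hFc he'] at h3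
      omega
    have h1 := hge i hiH hvi
    obtain ⟨e', he', h2⟩ := Finset.exists_mem_eq_sup i.2 (allF_nonempty_edges hF0 i (hHA hiH))
      (fun e => (σ (xlab H i e) : ℕ))
    have h3 : tlab H σ i = σ (Sum.inl e') := by
      rw [tlab, h2, hown e' he']
    have := (hkey e' he').2
    omega
  · have hneq : h ≠ h' := by
      intro h1
      rw [← h1] at hcase
      exact hcase hh
    refine ⟨h', hcmp2 _ (by omega) ho1, hcase, hneq, ?_⟩
    have h1 := inter_le_two_of_good hK (by omega) hHF hgood hhH ho1 hneq
    have h2 : e ⊆ h.1 ∩ h'.1 := Finset.subset_inter ((hHF h hhH).sub he) ((hHF _ ho1).sub ho2)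
    have h3 := Finset.card_le_card h2
    omega

end Determ


/-! ### Exchangeability and avoidance probabilities -/
section Exch

variable {Ω α : Type*} [DecidableEq α]

lemma exch_avoid (s : Finset Ω) (w : Ω → ℝ) (Z : Ω → Finset α) (H : Finset α) (m : ℕ)
    (hZ : ∀ ω ∈ s, Z ω ⊆ H ∧ (Z ω).card = m)
    (hex : ∀ h ∈ H, ∀ h' ∈ H, ∀ P : Finset α → ℝ,
      ∑ ω ∈ s, w ω * P (Z ω) = ∑ ω ∈ s, w ω * P ((Z ω).image (Equiv.swap h h')))
    (S : Finset α) (hS : S ⊆ H) :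
    ∑ ω ∈ s, w ω * (if Disjoint S (Z ω) then 1 else 0) =
      (∑ ω ∈ s, w ω) * ∏ i ∈ Finset.range S.card, (1 - (m : ℝ) / ((H.card : ℝ) - i)) := by
  induction S using Finset.induction_on with
  | empty => simp
  | insert h S hh ih =>
    have hSH : S ⊆ H := fun x hx => hS (Finset.mem_insert_of_mem hx)
    have hhH : h ∈ H := hS (Finset.mem_insert_self _ _)
    have ih := ih hSH
    rw [Finset.card_insert_of_notMem hh, Finset.prod_range_succ, ← mul_assoc, ← ih]
    have hlt : S.card < H.card := Finset.card_lt_card ⟨hSH, fun hc => hh (hc hhH)⟩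
    set b : ℝ := ∑ ω ∈ s, w ω * (if Disjoint S (Z ω) ∧ h ∈ Z ω then 1 else 0) with hb
    have hsame : ∀ h' ∈ H \ S, ∑ ω ∈ s, w ω * (if Disjoint S (Z ω) ∧ h' ∈ Z ω then 1 else 0) = b := by
      intro h' hh'
      rw [Finset.mem_sdiff] at hh'
      rw [hb, hex h hhH h' hh'.1 (fun Y => if Disjoint S Y ∧ h ∈ Y then 1 else 0)]
      apply Finset.sum_congr rfl
      intro ω _
      congr 1
      apply if_congr _ rfl rfl
      have e1 : h' ∈ Z ω ↔ h ∈ (Z ω).image (Equiv.swap h h') := by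
        rw [Finset.mem_image]
        constructor
        · intro hz; exact ⟨h', hz, by simp⟩
        · rintro ⟨a, ha, hae⟩
          have : a = h' := by
            have := congrArg (Equiv.swap h h') hae
            simpa using this
          rwa [← this]
      have e2 : Disjoint S (Z ω) ↔ Disjoint S ((Z ω).image (Equiv.swap h h')) := by
        rw [Finset.disjoint_left, Finset.disjoint_left]
        refine forall_congr' fun a => ?_
        refine imp_congr_right fun ha => ?_
        have hfix : Equiv.swap h h' a = a := Equiv.swap_apply_of_ne_of_ne
          (fun hc => hh (hc ▸ ha)) (fun hc => hh'.2 (hc ▸ ha))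
        rw [not_iff_not, Finset.mem_image]
        constructor
        · intro hz; exact ⟨a, hz, hfix⟩
        · rintro ⟨x, hx, hxe⟩
          have : x = a := by
            have := congrArg (Equiv.swap h h') hxe
            rw [hfix] at this
            simpa using this
          rwa [← this]
      rw [e1, e2]
    have hsum : ((H.card : ℝ) - S.card) * b =
        m * ∑ ω ∈ s, w ω * (if Disjoint S (Z ω) then 1 else 0) := by
      have h1 : ∑ h' ∈ H \ S, ∑ ω ∈ s, w ω * (if Disjoint S (Z ω) ∧ h' ∈ Z ω then (1:ℝ) else 0)
          = ((H.card : ℝ) - S.card) * b := by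
        rw [Finset.sum_congr rfl hsame, Finset.sum_const, Finset.card_sdiff_of_subset hSH,
          nsmul_eq_mul, Nat.cast_sub (Finset.card_le_card hSH)]
      rw [← h1, Finset.sum_comm, Finset.mul_sum]
      apply Finset.sum_congr rfl
      intro ω hω
      by_cases hd : Disjoint S (Z ω)
      · simp only [hd, true_and, if_true]
        rw [← Finset.mul_sum, Finset.sum_boole]
        have : (H \ S).filter (fun x => x ∈ Z ω) = Z ω := by
          ext x
          simp only [Finset.mem_filter, Finset.mem_sdiff]
          constructor
          · exact fun hx => hx.2
          · intro hx
            exact ⟨⟨(hZ ω hω).1 hx, fun hxS => Finset.disjoint_left.1 hd hxS hx⟩, hx⟩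
        rw [this, (hZ ω hω).2]
        ring
      · simp [hd]
    have hpos : (0:ℝ) < (H.card : ℝ) - S.card := by
      have : (S.card : ℝ) < H.card := by exact_mod_cast hlt
      linarith
    have hb2 : b = (∑ ω ∈ s, w ω * (if Disjoint S (Z ω) then 1 else 0)) * (m / ((H.card : ℝ) - S.card)) := by
      field_simp
      linarith
    have hsplit : ∑ ω ∈ s, w ω * (if Disjoint (insert h S) (Z ω) then 1 else 0) =
        ∑ ω ∈ s, w ω * (if Disjoint S (Z ω) then 1 else 0) - b := by
      rw [hb, ← Finset.sum_sub_distrib]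
      apply Finset.sum_congr rfl
      intro ω _
      simp only [Finset.disjoint_insert_left]
      by_cases h1 : h ∈ Z ω <;> by_cases h2 : Disjoint S (Z ω) <;> simp [h1, h2]
    rw [hsplit, hb2]
    ring

lemma image_proc {m t : ℕ} (f : Fin m → α) (τ : α → α) :
    proc (fun i => τ (f i)) t = (proc f t).image τ := by
  rw [proc, proc, Finset.image_image]; rfl

lemma bw_image (A : Finset α) (p : ℝ) (τ : Equiv.Perm α) (hτA : A.image τ = A) (S : Finset α) :
    bw A p (S.image τ) = bw A p S := by
  rw [bw, bw, Finset.card_image_of_injective _ τ.injective]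
  congr 2
  conv_lhs => rw [← hτA]
  rw [← Finset.image_sdiff _ _ τ.injective, Finset.card_image_of_injective _ τ.injective]

lemma bE_image (A : Finset α) (p : ℝ) (τ : Equiv.Perm α) (hτA : A.image τ = A) (f : Finset α → ℝ) :
    bE A p (fun S => f (S.image τ)) = bE A p f := by
  rw [bE, bE]
  apply Finset.sum_bij (fun S _ => S.image τ)
  · intro S hS
    rw [Finset.mem_powerset] at hS ⊢
    rw [← hτA]; exact Finset.image_subset_image hS
  · intro S _ S' _ h
    exact Finset.image_injective τ.injective h
  · intro S hS
    rw [Finset.mem_powerset] at hS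
    refine ⟨S.image τ.symm, ?_, ?_⟩
    · rw [Finset.mem_powerset]
      intro x hx
      obtain ⟨y, hy, rfl⟩ := Finset.mem_image.1 hx
      have := hS hy
      rw [← hτA, Finset.mem_image] at this
      obtain ⟨z, hz, rfl⟩ := this
      simpa using hz
    · rw [Finset.image_image]; simp
  · intro S _
    rw [bw_image A p τ hτA]

end Exch

section Exch2
variable {n r : ℕ} {F : Finset (Finset (Fin r))}

lemma image_eq_of_perm {α : Type*} [DecidableEq α] {U : Finset α} {τ : Equiv.Perm α}
    (hτ : ∀ a, a ∈ U → τ a ∈ U) : U.image τ = U := by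
  apply Finset.eq_of_subset_of_card_le
  · intro x hx
    obtain ⟨y, hy, rfl⟩ := Finset.mem_image.1 hx
    exact hτ y hy
  · rw [Finset.card_image_of_injective _ τ.injective]

lemma swap_mem {α : Type*} [DecidableEq α] {U : Finset α} {h h' : α} (hh : h ∈ U) (hh' : h' ∈ U) (a : α) (ha : a ∈ U) :
    Equiv.swap h h' a ∈ U := by
  rw [Equiv.swap_apply_def]
  split_ifs <;> assumption

lemma ordH_small (hF0 : F.Nonempty) {H : Finset (FE n)} (hHA : H ⊆ allFEdges F n) (σ : Lab n) :
    (∀ t, t ≤ H.card → proc (ordH F H σ) t ⊆ H) ∧ (∀ t, H.card ≤ t → H ⊆ proc (ordH F H σ) t) := by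
  apply (ordH_isSort hF0 H σ).proc_comparable rfl hHA
  intro a ha b _ hbH
  unfold keyH
  rw [if_pos ha, if_neg hbH]
  have := tlab_lt H σ a
  omega

/-- Avoidance for a fixed `H`. -/
lemma avoid_fixed (hF0 : F.Nonempty) {H : Finset (FE n)} (hHA : H ⊆ allFEdges F n) {m : ℕ} (hm : m ≤ H.card)
    {S : Finset (FE n)} (hS : S ⊆ H) :
    ∑ σ : Lab n, (if Disjoint S (proc (ordH F H σ) m) then (1:ℝ) else 0) =
      (Fintype.card (Lab n) : ℝ) * ∏ i ∈ Finset.range S.card, (1 - (m : ℝ) / ((H.card : ℝ) - i)) := by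
  have hmM : m ≤ Mnum F n := hm.trans (Finset.card_le_card hHA)
  have h := exch_avoid (Finset.univ : Finset (Lab n)) (fun _ => (1:ℝ)) (fun σ => proc (ordH F H σ) m) H m
    (fun σ _ => ⟨(ordH_small hF0 hHA σ).1 m hm, proc_card (ordH_isSort hF0 H σ).injective hmM⟩) ?_ S hS
  · simpa using h
  · intro h hh h' hh' P
    simp only [one_mul]
    have := ordH_equiv hF0 (Equiv.swap h h') (swap_mem (hHA hh) (hHA hh')) H (fun f => P (proc f m))
    rw [image_eq_of_perm (swap_mem hh hh')] at this
    rw [this]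
    simp only [image_proc]

/-- Exchangeability of the averaged order. -/
lemma ordH_avg (hF0 : F.Nonempty) (π : ℝ) (τ : Equiv.Perm (FE n)) (hτ : ∀ a, a ∈ allFEdges F n → τ a ∈ allFEdges F n)
    (P : (Fin (Mnum F n) → FE n) → ℝ) :
    bE (allFEdges F n) π (fun H => ∑ σ : Lab n, P (ordH F H σ)) =
      bE (allFEdges F n) π (fun H => ∑ σ : Lab n, P (fun i => τ (ordH F H σ i))) := by
  rw [← bE_image (allFEdges F n) π τ (image_eq_of_perm hτ)]
  apply bE_congr
  intro H _
  exact ordH_equiv hF0 τ hτ H P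

lemma ordU_avg (u : ℕ) (p : ℝ) (τ : Equiv.Perm (Finset (Fin n))) (hτ : ∀ a, a ∈ allUEdges u n → τ a ∈ allUEdges u n)
    (P : (Fin (Nat.choose n u) → Finset (Fin n)) → ℝ) :
    bE (allUEdges u n) p (fun G => ∑ σ : Lab n, P (ordU u G σ)) =
      bE (allUEdges u n) p (fun G => ∑ σ : Lab n, P (fun i => τ (ordU u G σ i))) := by
  rw [← bE_image (allUEdges u n) p τ (image_eq_of_perm hτ)]
  apply bE_congr
  intro G _
  exact ordU_equiv u τ hτ G P

/-- Avoidance averaged over `H`. -/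
lemma avoid_avg (hF0 : F.Nonempty) (π : ℝ) {m : ℕ} (hm : m ≤ Mnum F n)
    {S : Finset (FE n)} (hS : S ⊆ allFEdges F n) :
    bE (allFEdges F n) π (fun H => ∑ σ : Lab n, (if Disjoint S (proc (ordH F H σ) m) then (1:ℝ) else 0)) =
      (Fintype.card (Lab n) : ℝ) * ∏ i ∈ Finset.range S.card, (1 - (m : ℝ) / ((Mnum F n : ℝ) - i)) := by
  have conv : ∀ φ : Finset (FE n) → Lab n → ℝ, bE (allFEdges F n) π (fun H => ∑ σ : Lab n, φ H σ) =
      ∑ ω ∈ (allFEdges F n).powerset ×ˢ (Finset.univ : Finset (Lab n)), bw (allFEdges F n) π ω.1 * φ ω.1 ω.2 := by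
    intro φ
    rw [Finset.sum_product, bE]
    apply Finset.sum_congr rfl
    intro H _
    rw [Finset.mul_sum]
  have h := exch_avoid ((allFEdges F n).powerset ×ˢ (Finset.univ : Finset (Lab n)))
    (fun ω => bw (allFEdges F n) π ω.1) (fun ω => proc (ordH F ω.1 ω.2) m) (allFEdges F n) m ?_ ?_ S hS
  · rw [conv, h]
    congr 1
    have := conv (fun _ _ => 1)
    simp only [mul_one] at this
    rw [← this]
    simp only [Finset.sum_const, Finset.card_univ, nsmul_eq_mul, mul_one]
    exact bE_const _ _ _
  · intro ω _
    have hs := ordH_isSort hF0 ω.1 ω.2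
    refine ⟨?_, proc_card hs.injective hm⟩
    intro x hx
    obtain ⟨i, _, rfl⟩ := mem_proc.1 hx
    exact hs.1 i
  · intro h hh h' hh' P
    have h1 := ordH_avg hF0 π (Equiv.swap h h') (swap_mem hh hh') (fun f => P (proc f m))
    rw [conv, conv] at h1
    rw [h1]
    simp only [image_proc]

lemma validH_range {a : Fin (Mnum F n) → FE n} (ha : ValidOrdH F n a) : Finset.univ.image a = allFEdges F n := by
  symm
  apply Finset.eq_of_subset_of_card_le
  · intro x hx
    obtain ⟨i, rfl⟩ := ha.2 x (mem_allFEdges.1 hx)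
    simp
  · rw [Finset.card_image_of_injective _ ha.1, Finset.card_univ, Fintype.card_fin]; exact le_rfl

lemma validU_range {u : ℕ} {a : Fin (Nat.choose n u) → Finset (Fin n)} (ha : ValidOrdU u n a) :
    Finset.univ.image a = allUEdges u n := by
  symm
  apply Finset.eq_of_subset_of_card_le
  · intro x hx
    obtain ⟨i, rfl⟩ := ha.2 x (mem_allUEdges.1 hx)
    simp
  · rw [Finset.card_image_of_injective _ ha.1, card_allUEdges]; simp

lemma ordH_unif (hF0 : F.Nonempty) (π : ℝ) (a b : Fin (Mnum F n) → FE n) (ha : ValidOrdH F n a) (hb : ValidOrdH F n b) :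
    bE (allFEdges F n) π (fun H => ∑ σ : Lab n, if ordH F H σ = a then (1:ℝ) else 0) =
      bE (allFEdges F n) π (fun H => ∑ σ : Lab n, if ordH F H σ = b then (1:ℝ) else 0) := by
  obtain ⟨τ, hτ⟩ := exists_perm_comp a b ha.1 hb.1
  rw [ordH_avg hF0 π τ ?_ (fun f => if f = b then 1 else 0)]
  · apply bE_congr
    intro H _
    apply Finset.sum_congr rfl
    intro σ _
    apply if_congr _ rfl rfl
    constructor
    · rintro rfl; funext i; exact hτ i
    · intro h
      funext i
      apply τ.injective
      rw [hτ i, ← h]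
  · intro x hx
    rw [← validH_range ha, Finset.mem_image] at hx
    obtain ⟨i, _, rfl⟩ := hx
    rw [hτ, ← validH_range hb]
    exact Finset.mem_image_of_mem _ (Finset.mem_univ _)

lemma ordU_unif (u : ℕ) (p : ℝ) (a b : Fin (Nat.choose n u) → Finset (Fin n)) (ha : ValidOrdU u n a)
    (hb : ValidOrdU u n b) :
    bE (allUEdges u n) p (fun G => ∑ σ : Lab n, if ordU u G σ = a then (1:ℝ) else 0) =
      bE (allUEdges u n) p (fun G => ∑ σ : Lab n, if ordU u G σ = b then (1:ℝ) else 0) := by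
  obtain ⟨τ, hτ⟩ := exists_perm_comp a b ha.1 hb.1
  rw [ordU_avg u p τ ?_ (fun f => if f = b then 1 else 0)]
  · apply bE_congr
    intro H _
    apply Finset.sum_congr rfl
    intro σ _
    apply if_congr _ rfl rfl
    constructor
    · rintro rfl; funext i; exact hτ i
    · intro h
      funext i
      apply τ.injective
      rw [hτ i, ← h]
  · intro x hx
    rw [← validU_range ha, Finset.mem_image] at hx
    obtain ⟨i, _, rfl⟩ := hx
    rw [hτ, ← validU_range hb]
    exact Finset.mem_image_of_mem _ (Finset.mem_univ _)

end Exch2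


/-! ### Counting `F`-edges -/
section Counting
variable {n r : ℕ} {F : Finset (Finset (Fin r))}

/-- Transport of an `F`-edge by a vertex permutation. -/
def mvE (τ : Equiv.Perm (Fin n)) (h : FE n) : FE n :=
  (h.1.map τ.toEmbedding, h.2.image (fun e => e.map τ.toEmbedding))

lemma mvE_isFEdge (τ : Equiv.Perm (Fin n)) {h : FE n} (hh : IsFEdge F n h) : IsFEdge F n (mvE τ h) := by
  obtain ⟨φ, h1, h2⟩ := hh
  refine ⟨φ.trans τ.toEmbedding, ?_, ?_⟩
  · simp only [mvE, h1, Finset.map_map]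
  · simp only [mvE, h2, Finset.image_image]
    apply Finset.image_congr
    intro e _
    simp [Finset.map_map]

lemma mvE_inj (τ : Equiv.Perm (Fin n)) : Function.Injective (mvE τ) := by
  intro h h' hh
  simp only [mvE, Prod.mk.injEq] at hh
  refine Prod.ext (Finset.map_injective _ hh.1) ?_
  exact Finset.image_injective (Finset.map_injective _) hh.2

lemma degAll_le (v w : Fin n) : degFE (allFEdges F n) v ≤ degFE (allFEdges F n) w := by
  apply Finset.card_le_card_of_injOn (mvE (Equiv.swap v w))
  · intro h hh
    simp only [Finset.coe_filter, Set.mem_ofPred_eq, mem_allFEdges] at hh ⊢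
    refine ⟨mvE_isFEdge _ hh.1, ?_⟩
    simp only [mvE, Finset.mem_map]
    exact ⟨v, hh.2, by simp⟩
  · exact (mvE_inj _).injOn

/-- The number of `F`-edges through a vertex. -/
def Ndeg {r : ℕ} (F : Finset (Finset (Fin r))) (n : ℕ) : ℕ := if h : 0 < n then degFE (allFEdges F n) ⟨0, h⟩ else 0

lemma degAll_eq (v : Fin n) : degFE (allFEdges F n) v = Ndeg F n := by
  rw [Ndeg, dif_pos (Fin.pos v)]
  exact le_antisymm (degAll_le _ _) (degAll_le _ _)

lemma n_mul_Ndeg : n * Ndeg F n = r * Mnum F n := by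
  have h1 : ∑ v : Fin n, degFE (allFEdges F n) v = n * Ndeg F n := by
    rw [Finset.sum_congr rfl (fun v _ => degAll_eq v)]
    simp
  rw [← h1]
  simp only [degFE, Finset.card_filter]
  rw [Finset.sum_comm]
  have : ∀ h ∈ allFEdges F n, ∑ v : Fin n, (if v ∈ h.1 then 1 else 0) = r := by
    intro h hh
    rw [← Finset.card_filter]
    have := (mem_allFEdges.1 hh).card_fst
    rw [← this]
    congr 1
    ext; simp
  rw [Finset.sum_congr rfl this, Finset.sum_const, Mnum, smul_eq_mul, mul_comm]

/-- `F`-edge from a map. -/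
def ofMap (F : Finset (Finset (Fin r))) (f : Fin r → Fin n) : FE n :=
  (Finset.univ.image f, F.image (fun e => e.image f))

lemma IsFEdge.exists_ofMap {h : FE n} (hh : IsFEdge F n h) : ∃ f : Fin r → Fin n, Function.Injective f ∧ h = ofMap F f := by
  obtain ⟨φ, h1, h2⟩ := hh
  refine ⟨φ, φ.injective, Prod.ext ?_ ?_⟩
  · rw [h1, Finset.map_eq_image]; rfl
  · rw [h2]
    simp only [ofMap]
    apply Finset.image_congr
    intro e _
    simp only [Finset.map_eq_image]

lemma Mnum_ge : n.choose r ≤ Mnum F n := by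
  have h1 : (Finset.univ : Finset (Fin n)).powersetCard r ⊆ (allFEdges F n).image Prod.fst := by
    intro s hs
    rw [Finset.mem_powersetCard] at hs
    rw [Finset.mem_image]
    let φ : Fin r ↪ Fin n := (s.orderEmbOfFin hs.2).toEmbedding
    refine ⟨(Finset.univ.map φ, F.image (fun e => e.map φ)), mem_allFEdges.2 ⟨φ, rfl, rfl⟩, ?_⟩
    simp only [φ]
    ext x
    simp only [Finset.mem_map, Finset.mem_univ, true_and]
    have := Finset.range_orderEmbOfFin s hs.2
    constructor
    · rintro ⟨i, rfl⟩
      exact Finset.orderEmbOfFin_mem s hs.2 i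
    · intro hx
      have hx' : x ∈ Set.range (s.orderEmbOfFin hs.2) := by rw [this]; exact hx
      exact hx'
  have h2 := (Finset.card_le_card h1).trans Finset.card_image_le
  rw [Finset.card_powersetCard, Finset.card_univ, Fintype.card_fin] at h2
  exact h2

lemma Mnum_le : Mnum F n ≤ n ^ r := by
  have h1 : allFEdges F n ⊆ (Finset.univ : Finset (Fin r → Fin n)).image (ofMap F) := by
    intro h hh
    obtain ⟨f, _, rfl⟩ := (mem_allFEdges.1 hh).exists_ofMap
    exact Finset.mem_image_of_mem _ (Finset.mem_univ _)
  have h2 := (Finset.card_le_card h1).trans Finset.card_image_le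
  rw [Finset.card_univ, Fintype.card_pi_const, Fintype.card_fin] at h2
  exact h2

lemma pair_count {v w : Fin n} (hvw : v ≠ w) :
    ((allFEdges F n).filter (fun h => v ∈ h.1 ∧ w ∈ h.1)).card ≤ r ^ 2 * n ^ (r - 2) := by
  let T : Fin r × Fin r → Finset (Fin r → Fin n) := fun ij =>
    Finset.univ.filter (fun f => f ij.1 = v ∧ f ij.2 = w)
  have h1 : (allFEdges F n).filter (fun h => v ∈ h.1 ∧ w ∈ h.1) ⊆
      (((Finset.univ : Finset (Fin r × Fin r)).filter (fun ij => ij.1 ≠ ij.2)).biUnion T).image (ofMap F) := by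
    intro h hh
    rw [Finset.mem_filter] at hh
    obtain ⟨f, hf, rfl⟩ := (mem_allFEdges.1 hh.1).exists_ofMap
    obtain ⟨⟨i, hi⟩, ⟨j, hj⟩⟩ : (∃ i, f i = v) ∧ (∃ j, f j = w) := by simpa [ofMap] using hh.2
    apply Finset.mem_image_of_mem
    rw [Finset.mem_biUnion]
    refine ⟨(i, j), ?_, by simp [T, hi, hj]⟩
    rw [Finset.mem_filter]
    refine ⟨Finset.mem_univ _, ?_⟩
    intro hij
    have hij : i = j := hij
    rw [hij] at hi
    exact hvw (hi.symm.trans hj)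
  refine (Finset.card_le_card h1).trans (Finset.card_image_le.trans (Finset.card_biUnion_le.trans ?_))
  have hT : ∀ ij ∈ (Finset.univ : Finset (Fin r × Fin r)).filter (fun ij => ij.1 ≠ ij.2), (T ij).card ≤ n ^ (r - 2) := by
    rintro ⟨i, j⟩ hij
    rw [Finset.mem_filter] at hij
    have hij := hij.2
    simp only at hij
    have : T (i, j) ⊆ Fintype.piFinset (fun x : Fin r => if x = i then {v} else if x = j then {w} else Finset.univ) := by
      intro f hf
      rw [Fintype.mem_piFinset]
      intro x
      simp only [T, Finset.mem_filter] at hf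
      split_ifs with h1 h2
      · rw [h1, hf.2.1]; simp
      · rw [h2, hf.2.2]; simp
      · simp
    refine (Finset.card_le_card this).trans ?_
    rw [Fintype.card_piFinset]
    rw [← Finset.mul_prod_erase _ _ (Finset.mem_univ i), ← Finset.mul_prod_erase _ _ (a := j) (by simp [hij.symm])]
    simp only [if_true, Finset.card_singleton, one_mul, if_neg hij.symm]
    rw [Finset.prod_congr rfl (g := fun _ => n)]
    · rw [Finset.prod_const, Finset.card_erase_of_mem (by simp [hij.symm]), Finset.card_erase_of_mem (by simp)]
      simp [Nat.sub_sub]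
    · intro x hx
      rw [Finset.mem_erase, Finset.mem_erase] at hx
      rw [if_neg hx.2.1, if_neg hx.1]; simp
  refine (Finset.sum_le_card_nsmul _ _ _ hT).trans ?_
  rw [smul_eq_mul]
  apply Nat.mul_le_mul_right
  refine (Finset.card_filter_le _ _).trans ?_
  simp [sq]

lemma overlap_count {i : FE n} (hi : IsFEdge F n i) :
    ((allFEdges F n).filter (fun i' => 2 ≤ (i.1 ∩ i'.1).card)).card ≤ r ^ 4 * n ^ (r - 2) := by
  have h1 : (allFEdges F n).filter (fun i' => 2 ≤ (i.1 ∩ i'.1).card) ⊆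
      ((i.1 ×ˢ i.1).filter (fun vw => vw.1 ≠ vw.2)).biUnion
        (fun vw => (allFEdges F n).filter (fun h => vw.1 ∈ h.1 ∧ vw.2 ∈ h.1)) := by
    intro h hh
    rw [Finset.mem_filter] at hh
    obtain ⟨v, hv, w, hw, hvw⟩ := Finset.one_lt_card.1 hh.2
    rw [Finset.mem_inter] at hv hw
    rw [Finset.mem_biUnion]
    refine ⟨(v, w), ?_, ?_⟩
    · simp [hv.1, hw.1, hvw]
    · simp [hh.1, hv.2, hw.2]
  refine (Finset.card_le_card h1).trans (Finset.card_biUnion_le.trans ?_)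
  refine (Finset.sum_le_card_nsmul _ _ (r ^ 2 * n ^ (r - 2)) ?_).trans ?_
  · intro vw hvw
    rw [Finset.mem_filter] at hvw
    exact pair_count hvw.2
  · rw [smul_eq_mul]
    have : ((i.1 ×ˢ i.1).filter (fun vw => vw.1 ≠ vw.2)).card ≤ r ^ 2 := by
      refine (Finset.card_filter_le _ _).trans ?_
      rw [Finset.card_product, hi.card_fst, sq]
    calc _ ≤ r ^ 2 * (r ^ 2 * n ^ (r - 2)) := Nat.mul_le_mul_right _ this
      _ = _ := by ring

lemma badSmall_count (hn : 0 < n) (k t : ℕ) :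
    ((allFEdges F n).powerset.filter (fun S => S.card = k ∧ (S.biUnion Prod.fst).card ≤ t)).card ≤
      n ^ t * 2 ^ (t ^ r) := by
  let B : (Fin t → Fin n) → Finset (FE n) := fun f =>
    (Finset.univ : Finset (Fin r → Fin t)).image (fun ψ => ofMap F (f ∘ ψ))
  have h1 : (allFEdges F n).powerset.filter (fun S => S.card = k ∧ (S.biUnion Prod.fst).card ≤ t) ⊆
      (Finset.univ : Finset (Fin t → Fin n)).biUnion (fun f => (B f).powerset) := by
    intro S hS
    rw [Finset.mem_filter, Finset.mem_powerset] at hS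
    obtain ⟨hSA, _, hc⟩ := hS
    rw [Finset.mem_biUnion]
    have hex : ∃ f : Fin t → Fin n, ∀ x ∈ S.biUnion Prod.fst, ∃ i, f i = x := by
      set W := S.biUnion Prod.fst
      let e := W.equivFin
      refine ⟨fun i => if h : (i : ℕ) < W.card then (e.symm ⟨i, h⟩ : Fin n) else ⟨0, hn⟩, ?_⟩
      intro x hx
      refine ⟨⟨e ⟨x, hx⟩, lt_of_lt_of_le (e ⟨x, hx⟩).2 hc⟩, ?_⟩
      simp
    obtain ⟨f, hf⟩ := hex
    refine ⟨f, Finset.mem_univ _, ?_⟩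
    rw [Finset.mem_powerset]
    intro h hh
    obtain ⟨φ, _, hφ⟩ := (mem_allFEdges.1 (hSA hh)).exists_ofMap
    have : ∀ x : Fin r, ∃ i, f i = φ x := by
      intro x
      apply hf
      rw [Finset.mem_biUnion]
      refine ⟨h, hh, ?_⟩
      rw [hφ]; simp [ofMap]
    choose ψ hψ using this
    simp only [B, Finset.mem_image, Finset.mem_univ, true_and]
    refine ⟨ψ, ?_⟩
    rw [hφ]
    congr 1
    funext x
    exact hψ x
  refine (Finset.card_le_card h1).trans (Finset.card_biUnion_le.trans ?_)
  refine (Finset.sum_le_card_nsmul _ _ (2 ^ (t ^ r)) ?_).trans ?_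
  · intro f _
    rw [Finset.card_powerset]
    apply Nat.pow_le_pow_right (by norm_num)
    refine Finset.card_image_le.trans ?_
    simp
  · simp

end Counting


/-! ### Finite probability estimates -/
section FiniteProb
variable {n r : ℕ} {F : Finset (Finset (Fin r))}

lemma prod_ite_pow {α : Type*} [DecidableEq α] (A : Finset α) (P : α → Prop) [DecidablePred P] (c : ℝ) :
    ∏ a ∈ A, (if P a then c else 1) = c ^ (A.filter P).card := by
  rw [Finset.prod_ite, Finset.prod_const_one, mul_one, Finset.prod_const]

lemma bE_pow_filter {α : Type*} [DecidableEq α] (A : Finset α) (π q : ℝ) (P : α → Prop) [DecidablePred P] :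
    bE A π (fun H => q ^ (H.filter P).card) = (1 - (1 - q) * π) ^ (A.filter P).card := by
  have h1 := bE_prod A π (fun a => if P a then q else 1) (fun _ => 1)
  have h2 : ∏ a ∈ A, (π * (if P a then q else 1) + (1 - π) * 1) = (1 - (1 - q) * π) ^ (A.filter P).card := by
    rw [← prod_ite_pow]
    apply Finset.prod_congr rfl
    intro a _
    split_ifs <;> ring
  rw [h2] at h1
  rw [← h1]
  apply bE_congr
  intro H hH
  rw [← prod_ite_pow]
  rw [← Finset.prod_subset hH]
  · apply Finset.prod_congr rfl
    intro a ha
    rw [if_pos ha]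
  · intro a _ ha
    rw [if_neg ha]

lemma bE_pow_deg (π q : ℝ) (v : Fin n) :
    bE (allFEdges F n) π (fun H => q ^ degFE H v) = (1 - (1 - q) * π) ^ Ndeg F n := by
  rw [← degAll_eq v]
  exact bE_pow_filter _ _ _ _

/-- Probability of an isolated vertex. -/
lemma isolated_bound (π : ℝ) (h0 : 0 ≤ π) (h1 : π ≤ 1) :
    bE (allFEdges F n) π (fun H => if ∀ v, ∃ h ∈ H, v ∈ h.1 then 0 else 1) ≤ n * (1 - π) ^ Ndeg F n := by
  have hle : bE (allFEdges F n) π (fun H => if ∀ v, ∃ h ∈ H, v ∈ h.1 then 0 else 1) ≤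
      bE (allFEdges F n) π (fun H => ∑ v : Fin n, (0:ℝ) ^ degFE H v) := by
    apply bE_mono h0 h1
    intro H _
    split_ifs with h
    · exact Finset.sum_nonneg (fun v _ => by positivity)
    · push Not at h
      obtain ⟨v, hv⟩ := h
      have : degFE H v = 0 := by
        rw [degFE, Finset.card_eq_zero, Finset.filter_eq_empty_iff]
        exact hv
      calc (1:ℝ) = 0 ^ degFE H v := by rw [this]; simp
        _ ≤ _ := Finset.single_le_sum (f := fun v => (0:ℝ) ^ degFE H v) (fun v _ => by positivity) (Finset.mem_univ v)
  refine hle.trans ?_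
  rw [bE_sum]
  simp only [bE_pow_deg]
  simp

/-- Chernoff bound on the number of `F`-edges. -/
lemma size_bound {α : Type*} [DecidableEq α] (A : Finset α) (π : ℝ) (h0 : 0 ≤ π) (h1 : π ≤ 1) (m : ℕ) (η : ℝ) (hη : 0 ≤ η) :
    bE A π (fun H => if m < H.card then 1 else 0) ≤ (1 + η * π) ^ A.card / (1 + η) ^ m := by
  have h2 := bE_pow_filter A π (1 + η) (fun _ => True)
  simp only [Finset.filter_true] at h2
  have h3 : (1 - (1 - (1 + η)) * π) = 1 + η * π := by ring
  rw [h3] at h2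
  rw [le_div_iff₀ (by positivity), ← h2, mul_comm, ← bE_mul_left]
  apply bE_mono h0 h1
  intro H _
  split_ifs with h
  · rw [mul_one]
    exact pow_le_pow_right₀ (by linarith) h.le
  · rw [mul_zero]; positivity

/-- Bound for the expected weight of bad configurations. -/
def Rm {r : ℕ} (F : Finset (Finset (Fin r))) (n K D : ℕ) (π : ℝ) : ℝ :=
  ∑ k ∈ Finset.Icc 2 K, (k : ℝ) * ((n : ℝ) ^ ((r - 1) * k - 1) * 2 ^ (((r - 1) * k - 1) ^ r)) * π ^ k
    + n * (D * (Nat.choose (Ndeg F n) D : ℝ) * π ^ D)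

/-- The total size of bad configurations in `H`. -/
def badW (r K D : ℕ) {n : ℕ} (A H : Finset (FE n)) : ℝ :=
  ∑ S ∈ A.powerset.filter (BadC r K D), (S.card : ℝ) * (if S ⊆ H then 1 else 0)

lemma bad_bound (hn : 0 < n) (K D : ℕ) (π : ℝ) (h0 : 0 ≤ π) :
    bE (allFEdges F n) π (badW r K D (allFEdges F n)) ≤ Rm F n K D π := by
  unfold badW
  rw [bE_sum]
  have h2 : ∀ S ∈ (allFEdges F n).powerset.filter (BadC r K D),
      bE (allFEdges F n) π (fun H => (S.card : ℝ) * (if S ⊆ H then 1 else 0)) = (S.card : ℝ) * π ^ S.card := by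
    intro S hS
    rw [Finset.mem_filter, Finset.mem_powerset] at hS
    rw [bE_mul_left, bE_superset hS.1]
  rw [Finset.sum_congr rfl h2]
  let X : ℕ → Finset (Finset (FE n)) := fun k =>
    (allFEdges F n).powerset.filter (fun S => S.card = k ∧ (S.biUnion Prod.fst).card ≤ (r - 1) * k - 1)
  let Y : Fin n → Finset (Finset (FE n)) := fun v => ((allFEdges F n).filter (fun h => v ∈ h.1)).powersetCard D
  have hsub : (allFEdges F n).powerset.filter (BadC r K D) ⊆
      (Finset.Icc 2 K).biUnion X ∪ (Finset.univ : Finset (Fin n)).biUnion Y := by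
    intro S hS
    rw [Finset.mem_filter, Finset.mem_powerset] at hS
    rw [Finset.mem_union, Finset.mem_biUnion, Finset.mem_biUnion]
    rcases hS.2 with hb | ⟨hc, v, hv⟩
    · left
      refine ⟨S.card, Finset.mem_Icc.2 ⟨hb.1, hb.2.1⟩, ?_⟩
      simp only [X, Finset.mem_filter, Finset.mem_powerset]
      have := hb.2.2
      refine ⟨hS.1, by trivial, by omega⟩
    · right
      refine ⟨v, Finset.mem_univ _, ?_⟩
      simp only [Y, Finset.mem_powersetCard]
      refine ⟨fun x hx => Finset.mem_filter.2 ⟨hS.1 hx, hv x hx⟩, hc⟩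
  have hnn : ∀ S : Finset (FE n), 0 ≤ (S.card : ℝ) * π ^ S.card := fun S => by positivity
  refine (Finset.sum_le_sum_of_subset_of_nonneg hsub (fun S _ _ => hnn S)).trans ?_
  have hun : ∀ (P Q : Finset (Finset (FE n))), ∑ S ∈ P ∪ Q, (S.card : ℝ) * π ^ S.card ≤
      ∑ S ∈ P, (S.card : ℝ) * π ^ S.card + ∑ S ∈ Q, (S.card : ℝ) * π ^ S.card := by
    intro P Q
    rw [← Finset.sum_union_inter]
    have := Finset.sum_nonneg (s := P ∩ Q) (fun S _ => hnn S)
    linarith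
  have hbi : ∀ {ι : Type} (s : Finset ι) (P : ι → Finset (Finset (FE n))),
      ∑ S ∈ s.biUnion P, (S.card : ℝ) * π ^ S.card ≤ ∑ i ∈ s, ∑ S ∈ P i, (S.card : ℝ) * π ^ S.card := by
    intro ι s P
    induction s using Finset.induction_on with
    | empty => simp
    | insert a s ha ih =>
      rw [Finset.biUnion_insert, Finset.sum_insert ha]
      exact (hun _ _).trans (by linarith)
  refine (hun _ _).trans ?_
  unfold Rm
  apply add_le_add
  · refine (hbi _ _).trans ?_
    apply Finset.sum_le_sum
    intro k _
    have e1 : ∑ S ∈ X k, (S.card : ℝ) * π ^ S.card = (X k).card * (k * π ^ k) := by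
      rw [Finset.sum_congr rfl (g := fun _ => (k : ℝ) * π ^ k)]
      · rw [Finset.sum_const, nsmul_eq_mul]
      · intro S hS
        simp only [X, Finset.mem_filter] at hS
        rw [hS.2.1]
    rw [e1]
    have e2 : ((X k).card : ℝ) ≤ (n : ℝ) ^ ((r - 1) * k - 1) * 2 ^ (((r - 1) * k - 1) ^ r) := by
      exact_mod_cast badSmall_count (F := F) hn k ((r - 1) * k - 1)
    calc _ ≤ ((n : ℝ) ^ ((r - 1) * k - 1) * 2 ^ (((r - 1) * k - 1) ^ r)) * (k * π ^ k) := by gcongr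
      _ = _ := by ring
  · refine (hbi _ _).trans ?_
    have : ∀ v ∈ (Finset.univ : Finset (Fin n)), ∑ S ∈ Y v, (S.card : ℝ) * π ^ S.card =
        D * (Nat.choose (Ndeg F n) D : ℝ) * π ^ D := by
      intro v _
      rw [Finset.sum_congr rfl (g := fun _ => (D : ℝ) * π ^ D)]
      · rw [Finset.sum_const, nsmul_eq_mul]
        simp only [Y, Finset.card_powersetCard]
        rw [← degAll_eq v, degFE]
        ring
      · intro S hS
        simp only [Y, Finset.mem_powersetCard] at hS
        rw [hS.2]
    rw [Finset.sum_congr rfl this]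
    simp

lemma bad_event_bound (hn : 0 < n) (K D : ℕ) (hD : 1 ≤ D) (π : ℝ) (h0 : 0 ≤ π) (h1 : π ≤ 1) :
    bE (allFEdges F n) π (fun H => if ∀ S, S ⊆ H → ¬ BadC r K D S then 0 else 1) ≤ Rm F n K D π := by
  refine le_trans ?_ (bad_bound hn K D π h0)
  apply bE_mono h0 h1
  intro H hH
  have hnn : ∀ S ∈ (allFEdges F n).powerset.filter (BadC r K D), 0 ≤ (S.card : ℝ) * (if S ⊆ H then 1 else 0) := by
    intro S _
    split_ifs <;> positivity
  split_ifs with h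
  · exact Finset.sum_nonneg hnn
  · push Not at h
    obtain ⟨S, hS, hb⟩ := h
    have hmem : S ∈ (allFEdges F n).powerset.filter (BadC r K D) :=
      Finset.mem_filter.2 ⟨Finset.mem_powerset.2 (hS.trans hH), hb⟩
    have hc : 1 ≤ S.card := by
      rcases hb with hb | hb
      · have := hb.1; omega
      · rw [hb.1]; exact hD
    calc (1:ℝ) ≤ S.card := by exact_mod_cast hc
      _ = (S.card : ℝ) * (if S ⊆ H then 1 else 0) := by rw [if_pos hS, mul_one]
      _ ≤ _ := Finset.single_le_sum hnn hmem

lemma prod_factor_bound (d c m mx : ℕ) (hm0 : 0 < m) (hm : m ≤ c) (hH : c ≤ mx) :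
    ∏ i ∈ Finset.range d, (1 - (m : ℝ) / ((c : ℝ) - i)) ≤ (1 - (m : ℝ) / mx) ^ d := by
  rcases Nat.lt_or_ge (c - m) (d) with hd | hd
  · rw [Finset.prod_eq_zero (Finset.mem_range.2 hd)]
    · apply pow_nonneg
      have : (m : ℝ) / mx ≤ 1 := div_le_one_of_le₀ (by exact_mod_cast hm.trans hH) (by positivity)
      linarith
    · rw [Nat.cast_sub hm, sub_sub_cancel, div_self (by positivity), sub_self]
  · rw [← Finset.card_range (d)]
    conv_rhs => rw [← Finset.prod_const]
    rw [Finset.card_range]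
    have hmR : (0:ℝ) < m := by exact_mod_cast hm0
    apply Finset.prod_le_prod
    · intro i hi
      rw [Finset.mem_range] at hi
      have h1 : m ≤ c - i := by omega
      have h2 : (m : ℝ) ≤ (c : ℝ) - i := by
        rw [← Nat.cast_sub (by omega)]; exact_mod_cast h1
      have : (m : ℝ) / ((c : ℝ) - i) ≤ 1 := div_le_one_of_le₀ h2 (by linarith)
      linarith
    · intro i hi
      rw [Finset.mem_range] at hi
      have h1 : m ≤ c - i := by omega
      have h2 : (m : ℝ) ≤ (c : ℝ) - i := by
        rw [← Nat.cast_sub (by omega)]; exact_mod_cast h1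
      have h3 : (c : ℝ) ≤ mx := by exact_mod_cast hH
      have h4 : (0:ℝ) ≤ i := by positivity
      have : (m : ℝ) / mx ≤ (m : ℝ) / ((c : ℝ) - i) := by
        apply div_le_div_of_nonneg_left hmR.le (by linarith) (by linarith)
      linarith

/-- For fixed `H`, the probability that `v` is isolated at time `m`. -/
lemma iso_fixed (hF0 : F.Nonempty) {H : Finset (FE n)} (hHA : H ⊆ allFEdges F n) (m mx : ℕ) (hmx : m ≤ mx) (hH : H.card ≤ mx)
    (v : Fin n) :
    ∑ σ : Lab n, (if ∃ h ∈ proc (ordH F H σ) m, v ∈ h.1 then (0:ℝ) else 1) ≤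
      (Fintype.card (Lab n) : ℝ) * (1 - (m : ℝ) / mx) ^ degFE H v := by
  have hq0 : (0:ℝ) ≤ 1 - (m : ℝ) / mx := by
    have : (m : ℝ) / mx ≤ 1 := div_le_one_of_le₀ (by exact_mod_cast hmx) (by positivity)
    linarith
  have triv : (1:ℝ) ≤ (1 - (m : ℝ) / mx) ^ degFE H v →
      ∑ σ : Lab n, (if ∃ h ∈ proc (ordH F H σ) m, v ∈ h.1 then (0:ℝ) else 1) ≤
      (Fintype.card (Lab n) : ℝ) * (1 - (m : ℝ) / mx) ^ degFE H v := by
    intro h1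
    calc _ ≤ ∑ σ : Lab n, (1:ℝ) := Finset.sum_le_sum (fun σ _ => by split_ifs <;> norm_num)
      _ = (Fintype.card (Lab n) : ℝ) * 1 := by simp
      _ ≤ _ := by gcongr
  rcases Nat.eq_zero_or_pos m with hm0 | hm0
  · apply triv; simp [hm0]
  set S := H.filter (fun h => v ∈ h.1) with hSdef
  have hSd : S.card = degFE H v := rfl
  rcases Nat.lt_or_ge H.card m with hlt | hm
  · rcases Nat.eq_zero_or_pos (degFE H v) with hd | hd
    · apply triv; simp [hd]
    · have : ∀ σ : Lab n, (if ∃ h ∈ proc (ordH F H σ) m, v ∈ h.1 then (0:ℝ) else 1) = 0 := by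
        intro σ
        rw [if_pos]
        obtain ⟨h, hh⟩ := Finset.card_pos.1 (hSd ▸ hd : 0 < S.card)
        rw [hSdef, Finset.mem_filter] at hh
        exact ⟨h, (ordH_small hF0 hHA σ).2 m hlt.le hh.1, hh.2⟩
      simp only [this, Finset.sum_const_zero]
      positivity
  have hle : ∑ σ : Lab n, (if ∃ h ∈ proc (ordH F H σ) m, v ∈ h.1 then (0:ℝ) else 1) ≤
      ∑ σ : Lab n, (if Disjoint S (proc (ordH F H σ) m) then (1:ℝ) else 0) := by
    apply Finset.sum_le_sum
    intro σ _
    split_ifs with h1 h2 h2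
    · norm_num
    · norm_num
    · norm_num
    · exfalso
      apply h2
      rw [Finset.disjoint_left]
      intro h hh hp
      rw [hSdef, Finset.mem_filter] at hh
      exact h1 ⟨h, hp, hh.2⟩
  refine hle.trans ?_
  rw [avoid_fixed hF0 hHA hm (Finset.filter_subset _ _), hSd]
  apply mul_le_mul_of_nonneg_left _ (by positivity)
  exact prod_factor_bound _ _ _ _ hm0 hm hH

/-- The overlap term. -/
lemma overlap_bound (π q : ℝ) (h0 : 0 ≤ π) (h1 : π ≤ 1) (hq0 : 0 ≤ q) (hq1 : q ≤ 1) :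
    bE (allFEdges F n) π (fun H => ∑ i ∈ allFEdges F n,
      ∑ i' ∈ (allFEdges F n).filter (fun i' => i' ≠ i ∧ 2 ≤ (i.1 ∩ i'.1).card), ∑ v ∈ i.1,
        (if i ∈ H ∧ i' ∈ H then q ^ degFE H v else 0)) ≤
    (Mnum F n : ℝ) * ((r ^ 4 * n ^ (r - 2) : ℕ) * (r * (π ^ 2 * (1 - (1 - q) * π) ^ (Ndeg F n - 2)))) := by
  have hz0 : 0 ≤ 1 - (1 - q) * π := by nlinarith
  have hz1 : 1 - (1 - q) * π ≤ 1 := by nlinarith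
  have key : ∀ i ∈ allFEdges F n, ∀ i' ∈ allFEdges F n, i' ≠ i → ∀ v : Fin n,
      bE (allFEdges F n) π (fun H => if i ∈ H ∧ i' ∈ H then q ^ degFE H v else 0) ≤
        π ^ 2 * (1 - (1 - q) * π) ^ (Ndeg F n - 2) := by
    intro i hi i' hi' hne v
    set A := allFEdges F n with hA
    have e1 := bE_prod A π (fun a => if v ∈ a.1 then q else 1) (fun a => if a = i ∨ a = i' then 0 else 1)
    have e2 : bE A π (fun H => if i ∈ H ∧ i' ∈ H then q ^ degFE H v else 0) =
        bE A π (fun S => ∏ a ∈ A, if a ∈ S then (if v ∈ a.1 then q else 1) else (if a = i ∨ a = i' then 0 else 1)) := by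
      apply bE_congr
      intro H hH
      split_ifs with hh
      · rw [degFE, ← prod_ite_pow, ← Finset.prod_subset hH]
        · apply Finset.prod_congr rfl
          intro a ha
          rw [if_pos ha]
        · intro a _ ha
          rw [if_neg ha, if_neg]
          rintro (rfl | rfl)
          · exact ha hh.1
          · exact ha hh.2
      · symm
        by_cases hiH : i ∈ H
        · have : i' ∉ H := fun h => hh ⟨hiH, h⟩
          exact Finset.prod_eq_zero hi' (by simp [this])
        · exact Finset.prod_eq_zero hi (by simp [hiH])
    rw [e2, e1]
    have hi'2 : i' ∈ A.erase i := Finset.mem_erase.2 ⟨hne, hi'⟩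
    rw [← Finset.mul_prod_erase _ _ hi, ← Finset.mul_prod_erase _ _ hi'2]
    have f1 : ∀ j, (j = i ∨ j = i') → 0 ≤ π * (if v ∈ j.1 then q else 1) + (1 - π) * (if j = i ∨ j = i' then 0 else 1) ∧
        π * (if v ∈ j.1 then q else 1) + (1 - π) * (if j = i ∨ j = i' then 0 else 1) ≤ π := by
      intro j hj
      rw [if_pos hj, mul_zero, add_zero]
      split_ifs
      · exact ⟨by positivity, by nlinarith⟩
      · exact ⟨by linarith, by linarith⟩
    have f2 : ∏ a ∈ (A.erase i).erase i', (π * (if v ∈ a.1 then q else 1) + (1 - π) * (if a = i ∨ a = i' then 0 else 1)) ≤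
        (1 - (1 - q) * π) ^ (Ndeg F n - 2) := by
      have : ∏ a ∈ (A.erase i).erase i', (π * (if v ∈ a.1 then q else 1) + (1 - π) * (if a = i ∨ a = i' then 0 else 1)) =
        ∏ a ∈ (A.erase i).erase i', (if v ∈ a.1 then (1 - (1 - q) * π) else 1) := by
        apply Finset.prod_congr rfl
        intro a ha
        rw [Finset.mem_erase, Finset.mem_erase] at ha
        rw [if_neg (c := a = i ∨ a = i') (by tauto)]
        split_ifs <;> ring
      rw [this, prod_ite_pow]
      apply pow_le_pow_of_le_one hz0 hz1
      rw [← degAll_eq v, degFE, ← hA, Finset.filter_erase, Finset.filter_erase]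
      have := Finset.pred_card_le_card_erase (s := (A.filter (fun h => v ∈ h.1)).erase i) (a := i')
      have := Finset.pred_card_le_card_erase (s := (A.filter (fun h => v ∈ h.1))) (a := i)
      omega
    have f3 : 0 ≤ ∏ a ∈ (A.erase i).erase i', (π * (if v ∈ a.1 then q else 1) + (1 - π) * (if a = i ∨ a = i' then 0 else 1)) := by
      apply Finset.prod_nonneg
      intro a _
      have : 0 ≤ 1 - π := by linarith
      have g1 : (0:ℝ) ≤ if v ∈ a.1 then q else 1 := by split_ifs <;> linarith
      have g2 : (0:ℝ) ≤ if a = i ∨ a = i' then (0:ℝ) else 1 := by split_ifs <;> norm_num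
      positivity
    have a1 := f1 i (Or.inl rfl)
    have a2 := f1 i' (Or.inr rfl)
    rw [sq, mul_assoc]
    apply mul_le_mul a1.2 _ (mul_nonneg a2.1 f3) h0
    exact mul_le_mul a2.2 f2 f3 h0
  simp only [bE_sum]
  set T : ℝ := π ^ 2 * (1 - (1 - q) * π) ^ (Ndeg F n - 2) with hT
  have hT0 : 0 ≤ T := by positivity
  rw [Mnum, ← nsmul_eq_mul]
  apply Finset.sum_le_card_nsmul
  intro i hi
  have hiF := mem_allFEdges.1 hi
  calc _ ≤ ∑ i' ∈ (allFEdges F n).filter (fun i' => i' ≠ i ∧ 2 ≤ (i.1 ∩ i'.1).card), (r * T) := by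
        apply Finset.sum_le_sum
        intro i' hi'
        rw [Finset.mem_filter] at hi'
        calc _ ≤ ∑ v ∈ i.1, T := Finset.sum_le_sum (fun v _ => key i hi i' hi'.1 hi'.2.1 v)
          _ = r * T := by rw [Finset.sum_const, hiF.card_fst, nsmul_eq_mul]
    _ = ((allFEdges F n).filter (fun i' => i' ≠ i ∧ 2 ≤ (i.1 ∩ i'.1).card)).card * (r * T) := by
        rw [Finset.sum_const, nsmul_eq_mul]
    _ ≤ _ := by
        apply mul_le_mul_of_nonneg_right _ (by positivity)
        norm_cast
        refine le_trans (Finset.card_le_card ?_) (overlap_count hiF)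
        intro x hx
        rw [Finset.mem_filter] at hx ⊢
        exact ⟨hx.1, hx.2.2⟩

end FiniteProb


/-! ### Second moment -/
section SecondMoment

lemma prodP_bounds (M N m k B : ℕ) (hm : m + 2 * N ≤ M) (hN : 1 ≤ N) (hk : k ≤ N) (hkB : k ≤ B) :
    let y : ℝ := (m : ℝ) / ((M : ℝ) - N)
    let P : ℕ → ℝ := fun d => ∏ i ∈ Finset.range d, (1 - (m : ℝ) / ((M : ℝ) - i))
    0 < 1 - y ∧ (1 - y) ^ N ≤ P N ∧ P (2 * N - k) ≤ P N ^ 2 * ((1 - y) ^ B)⁻¹ := by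
  intro y P
  have hMR : (m : ℝ) + 2 * N ≤ M := by exact_mod_cast hm
  have hNR : (1:ℝ) ≤ N := by exact_mod_cast hN
  have hm0 : (0:ℝ) ≤ m := by positivity
  have hy0 : 0 ≤ y := div_nonneg hm0 (by linarith)
  have hy : y < 1 := by
    rw [div_lt_one (by linarith)]; linarith
  have hy1 : 0 < 1 - y := by linarith
  have ha : ∀ i : ℕ, i ≤ N → 1 - y ≤ 1 - (m : ℝ) / ((M : ℝ) - i) := by
    intro i hi
    have hi : (i : ℝ) ≤ N := by exact_mod_cast hi
    have : (m : ℝ) / ((M : ℝ) - i) ≤ y := div_le_div_of_nonneg_left hm0 (by linarith) (by linarith)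
    linarith
  have hnn : ∀ i : ℕ, i ≤ 2 * N → 0 ≤ 1 - (m : ℝ) / ((M : ℝ) - i) := by
    intro i hi
    have hi : (i : ℝ) ≤ 2 * N := by exact_mod_cast hi
    have : (m : ℝ) / ((M : ℝ) - i) ≤ 1 := div_le_one_of_le₀ (by linarith) (by linarith)
    linarith
  have hP0 : ∀ d, d ≤ 2 * N → 0 ≤ P d := by
    intro d hd
    apply Finset.prod_nonneg
    intro i hi
    rw [Finset.mem_range] at hi
    exact hnn i (by omega)
  refine ⟨hy1, ?_, ?_⟩
  · calc (1 - y) ^ N = ∏ i ∈ Finset.range N, (1 - y) := by simp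
      _ ≤ _ := Finset.prod_le_prod (fun i _ => hy1.le) (fun i hi => ha i (Finset.mem_range.1 hi).le)
  · have e1 : P (2 * N - k) ≤ P N * P (N - k) := by
      have : 2 * N - k = N + (N - k) := by omega
      rw [this]
      simp only [P]
      rw [Finset.prod_range_add]
      apply mul_le_mul_of_nonneg_left _ (hP0 N (by omega))
      apply Finset.prod_le_prod
      · intro j hj
        rw [Finset.mem_range] at hj
        exact hnn (N + j) (by omega)
      · intro j hj
        rw [Finset.mem_range] at hj
        have hj : (j : ℝ) ≤ N := by exact_mod_cast (by omega : j ≤ N)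
        have : (m : ℝ) / ((M : ℝ) - j) ≤ (m : ℝ) / ((M : ℝ) - ((N + j : ℕ) : ℝ)) := by
          push_cast
          rcases eq_or_lt_of_le hm0 with h | h
          · rw [← h]; simp
          · exact div_le_div_of_nonneg_left hm0 (by linarith) (by linarith)
        linarith
    have e2 : P (N - k) * (1 - y) ^ k ≤ P N := by
      have : P N = P (N - k) * ∏ j ∈ Finset.range k, (1 - (m : ℝ) / ((M : ℝ) - ((N - k + j : ℕ) : ℝ))) := by
        simp only [P]
        rw [← Finset.prod_range_add]
        congr 2; omega
      rw [this]
      apply mul_le_mul_of_nonneg_left _ (hP0 _ (by omega))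
      calc (1 - y) ^ k = ∏ i ∈ Finset.range k, (1 - y) := by simp
        _ ≤ _ := Finset.prod_le_prod (fun i _ => hy1.le) (fun i hi => by
            rw [Finset.mem_range] at hi
            exact ha _ (by omega))
    have e3 : (1 - y) ^ B ≤ (1 - y) ^ k := pow_le_pow_of_le_one hy1.le (by linarith) hkB
    have hB0 : 0 < (1 - y) ^ B := by positivity
    rw [← div_eq_mul_inv, le_div_iff₀ hB0]
    calc P (2 * N - k) * (1 - y) ^ B ≤ (P N * P (N - k)) * (1 - y) ^ k := by
          apply mul_le_mul e1 e3 hB0.le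
          exact mul_nonneg (hP0 _ (by omega)) (hP0 _ (by omega))
      _ = P N * (P (N - k) * (1 - y) ^ k) := by ring
      _ ≤ P N * P N := mul_le_mul_of_nonneg_left e2 (hP0 _ (by omega))
      _ = _ := by ring

variable {n r : ℕ} {F : Finset (Finset (Fin r))}

set_option maxHeartbeats 800000 in
lemma cover_bound (hF0 : F.Nonempty) (π : ℝ) (h0 : 0 ≤ π) (h1 : π ≤ 1) (m B : ℕ)
    (hm : m + 2 * Ndeg F n ≤ Mnum F n) (hN : 1 ≤ Ndeg F n) (hn : 0 < n) (hB : r ^ 2 * n ^ (r - 2) ≤ B)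
    (y : ℝ) (hy : y = (m : ℝ) / ((Mnum F n : ℝ) - Ndeg F n)) :
    bE (allFEdges F n) π (fun H => ∑ σ : Lab n,
      if ∀ v, ∃ h ∈ proc (ordH F H σ) m, v ∈ h.1 then (1:ℝ) else 0) ≤
    (Fintype.card (Lab n) : ℝ) * (1 / (n * (1 - y) ^ Ndeg F n) + (((1 - y) ^ B)⁻¹ - 1)) := by
  set N := Ndeg F n with hNdef
  set M := Mnum F n with hMdef
  obtain ⟨L, hL⟩ : ∃ L : ℝ, L = (Fintype.card (Lab n) : ℝ) := ⟨_, rfl⟩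
  rw [← hL]
  set P : ℕ → ℝ := fun d => ∏ i ∈ Finset.range d, (1 - (m : ℝ) / ((M : ℝ) - i)) with hP
  have hL0 : 0 ≤ L := by rw [hL]; exact Nat.cast_nonneg _
  let Sv : Fin n → Finset (FE n) := fun v => (allFEdges F n).filter (fun h => v ∈ h.1)
  have hSc : ∀ v, (Sv v).card = N := fun v => degAll_eq v
  let I : Fin n → Finset (FE n) → Lab n → ℝ := fun v H σ =>
    if Disjoint (Sv v) (proc (ordH F H σ) m) then 1 else 0
  have hE1 : ∀ v, bE (allFEdges F n) π (fun H => ∑ σ : Lab n, I v H σ) = L * P N := by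
    intro v
    have := avoid_avg hF0 π (m := m) (n := n) (F := F) (by omega) (S := Sv v) (Finset.filter_subset _ _)
    rw [hSc, ← hL] at this
    exact this
  obtain ⟨hy1, hPN, _⟩ := prodP_bounds M N m 0 B hm hN (by omega) (by omega)
  rw [← hy] at hy1 hPN
  have hPN0 : 0 < P N := lt_of_lt_of_le (by positivity) hPN
  have hinv1 : 1 ≤ ((1 - y) ^ B)⁻¹ := by
    rw [one_le_inv₀ (by positivity)]
    apply pow_le_one₀ hy1.le
    have : 0 ≤ y := by
      rw [hy]
      have : (m : ℝ) + 2 * N ≤ M := by exact_mod_cast hm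
      have h3 : (0:ℝ) ≤ N := by positivity
      have h4 : (0:ℝ) ≤ m := by positivity
      exact div_nonneg h4 (by linarith)
    linarith
  have hE2 : ∀ v w, bE (allFEdges F n) π (fun H => ∑ σ : Lab n, I v H σ * I w H σ) ≤
      L * ((if v = w then P N else 0) + P N ^ 2 * ((1 - y) ^ B)⁻¹) := by
    intro v w
    by_cases hvw : v = w
    · subst hvw
      rw [if_pos rfl]
      have : bE (allFEdges F n) π (fun H => ∑ σ : Lab n, I v H σ * I v H σ) = L * P N := by
        rw [← hE1 v]
        apply bE_congr
        intro H _
        apply Finset.sum_congr rfl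
        intro σ _
        simp only [I]
        split_ifs <;> simp
      rw [this]
      apply mul_le_mul_of_nonneg_left _ hL0
      have : 0 ≤ P N ^ 2 * ((1 - y) ^ B)⁻¹ := by positivity
      linarith
    · rw [if_neg hvw, zero_add]
      have e1 : bE (allFEdges F n) π (fun H => ∑ σ : Lab n, I v H σ * I w H σ) = L * P (Sv v ∪ Sv w).card := by
        have := avoid_avg hF0 π (m := m) (n := n) (F := F) (by omega) (S := Sv v ∪ Sv w)
          (Finset.union_subset (Finset.filter_subset _ _) (Finset.filter_subset _ _))
        rw [hP, hL]
        rw [← this]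
        apply bE_congr
        intro H _
        apply Finset.sum_congr rfl
        intro σ _
        simp only [I, Finset.disjoint_union_left]
        by_cases c1 : Disjoint (Sv v) (proc (ordH F H σ) m) <;>
          by_cases c2 : Disjoint (Sv w) (proc (ordH F H σ) m) <;> simp [c1, c2]
      rw [e1]
      apply mul_le_mul_of_nonneg_left _ hL0
      have e2 : (Sv v ∪ Sv w).card = 2 * N - (Sv v ∩ Sv w).card := by
        rw [Finset.card_union, hSc, hSc]; omega
      have e3 : (Sv v ∩ Sv w).card ≤ N := by
        rw [← hSc v]; exact Finset.card_le_card Finset.inter_subset_left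
      have e4 : (Sv v ∩ Sv w).card ≤ B := by
        refine le_trans ?_ ((pair_count (F := F) hvw).trans hB)
        apply Finset.card_le_card
        intro h hh
        simp only [Sv, Finset.mem_inter, Finset.mem_filter] at hh ⊢
        exact ⟨hh.1.1, hh.1.2, hh.2.2⟩
      obtain ⟨_, _, h5⟩ := prodP_bounds M N m _ B hm hN e3 e4
      rw [← hy] at h5
      rw [e2]
      exact h5
  set μ : ℝ := n * P N with hμ
  have hnR : (0:ℝ) < n := by exact_mod_cast hn
  have hμ0 : 0 < μ := by positivity
  set Cv : Finset (FE n) → Lab n → ℝ := fun H σ =>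
    if ∀ v, ∃ h ∈ proc (ordH F H σ) m, v ∈ h.1 then 1 else 0 with hCv
  have hpt : ∀ H σ, μ ^ 2 * Cv H σ ≤ ∑ v, ∑ w, I v H σ * I w H σ - 2 * μ * ∑ v, I v H σ + μ ^ 2 := by
    intro H σ
    have hsq : ∑ v, ∑ w, I v H σ * I w H σ = (∑ v, I v H σ) ^ 2 := by
      rw [sq, Finset.sum_mul_sum]
    rw [hsq]
    simp only [hCv]
    split_ifs with hc
    · have : ∑ v, I v H σ = 0 := by
        apply Finset.sum_eq_zero
        intro v _
        simp only [I]
        rw [if_neg]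
        intro hd
        obtain ⟨h, hh, hv⟩ := hc v
        apply Finset.disjoint_left.1 hd _ hh
        simp only [Sv, Finset.mem_filter]
        refine ⟨?_, hv⟩
        obtain ⟨i, _, rfl⟩ := mem_proc.1 hh
        exact (ordH_isSort hF0 H σ).1 i
      rw [this]
      nlinarith
    · nlinarith [sq_nonneg (∑ v, I v H σ - μ)]
  have hbE : μ ^ 2 * bE (allFEdges F n) π (fun H => ∑ σ : Lab n, Cv H σ) ≤
      L * (μ + μ ^ 2 * (((1 - y) ^ B)⁻¹ - 1)) := by
    calc μ ^ 2 * bE (allFEdges F n) π (fun H => ∑ σ : Lab n, Cv H σ)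
        = bE (allFEdges F n) π (fun H => ∑ σ : Lab n, μ ^ 2 * Cv H σ) := by
          rw [← bE_mul_left]
          simp only [Finset.mul_sum]
      _ ≤ bE (allFEdges F n) π (fun H => ∑ σ : Lab n,
            (∑ v, ∑ w, I v H σ * I w H σ - 2 * μ * ∑ v, I v H σ + μ ^ 2)) := by
          apply bE_mono h0 h1
          intro H _
          exact Finset.sum_le_sum (fun σ _ => hpt H σ)
      _ = bE (allFEdges F n) π (fun H => (∑ v, ∑ w, ∑ σ : Lab n, I v H σ * I w H σ
            - 2 * μ * ∑ v, ∑ σ : Lab n, I v H σ) + L * μ ^ 2) := by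
          apply bE_congr
          intro H _
          rw [Finset.sum_add_distrib, Finset.sum_sub_distrib, ← Finset.mul_sum]
          congr 1
          · congr 1
            · rw [Finset.sum_comm]
              apply Finset.sum_congr rfl
              intro v _
              rw [Finset.sum_comm]
            · rw [Finset.sum_comm]
          · rw [hL, Finset.sum_const, Finset.card_univ, nsmul_eq_mul]
      _ = ∑ v, ∑ w, bE (allFEdges F n) π (fun H => ∑ σ : Lab n, I v H σ * I w H σ)
            - 2 * μ * ∑ v, bE (allFEdges F n) π (fun H => ∑ σ : Lab n, I v H σ) + L * μ ^ 2 := by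
          rw [bE_add, bE_sub, bE_mul_left, bE_const]
          simp only [bE_sum]
      _ ≤ ∑ v : Fin n, ∑ w : Fin n, L * ((if v = w then P N else 0) + P N ^ 2 * ((1 - y) ^ B)⁻¹)
            - 2 * μ * ∑ v : Fin n, L * P N + L * μ ^ 2 := by
          have s1 := Finset.sum_le_sum (s := Finset.univ) (fun v _ => Finset.sum_le_sum (s := Finset.univ) (fun w _ => hE2 v w))
          have s2 : ∑ v, bE (allFEdges F n) π (fun H => ∑ σ : Lab n, I v H σ) = ∑ v : Fin n, L * P N :=
            Finset.sum_congr rfl (fun v _ => hE1 v)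
          rw [s2]
          linarith
      _ = L * (μ + μ ^ 2 * (((1 - y) ^ B)⁻¹ - 1)) := by
          have s3 : ∀ v : Fin n, ∑ w : Fin n, L * ((if v = w then P N else 0) + P N ^ 2 * ((1 - y) ^ B)⁻¹) =
              L * (P N + n * (P N ^ 2 * ((1 - y) ^ B)⁻¹)) := by
            intro v
            rw [← Finset.mul_sum, Finset.sum_add_distrib]
            simp
          rw [Finset.sum_congr rfl (fun v _ => s3 v)]
          simp only [Finset.sum_const, Finset.card_univ, Fintype.card_fin, nsmul_eq_mul]
          rw [hμ]
          ring
  have hfin : bE (allFEdges F n) π (fun H => ∑ σ : Lab n, Cv H σ) ≤ L * (1 / μ + (((1 - y) ^ B)⁻¹ - 1)) := by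
    have : L * (1 / μ + (((1 - y) ^ B)⁻¹ - 1)) = L * (μ + μ ^ 2 * (((1 - y) ^ B)⁻¹ - 1)) / μ ^ 2 := by
      field_simp
    rw [this, le_div_iff₀ (by positivity), mul_comm]
    exact hbE
  refine hfin.trans ?_
  apply mul_le_mul_of_nonneg_left _ hL0
  have : 1 / μ ≤ 1 / (n * (1 - y) ^ N) := by
    apply one_div_le_one_div_of_le (by positivity)
    exact mul_le_mul_of_nonneg_left hPN hnR.le
  linarith

end SecondMoment


/-! ### Extra copies at late vertices -/
section Star
variable {n r u : ℕ} {F : Finset (Finset (Fin r))}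

lemma degG_lower (hFc : ∀ e ∈ F, e.card = u) (p q : ℝ) (hp0 : 0 ≤ p) (hp1 : p ≤ 1) (hq0 : 0 ≤ q) (hq1 : q ≤ 1) (v : Fin n) :
    (1 - (1 - q) * p ^ F.card) ^ Ndeg F n ≤
      bE (allUEdges u n) p (fun G => q ^ ((allFEdges F n).filter (fun i => v ∈ i.1 ∧ i.2 ⊆ G)).card) := by
  have h := harris_prod (allUEdges u n) hp0 hp1 ((allFEdges F n).filter (fun i => v ∈ i.1))
    (fun i G => if i.2 ⊆ G then q else 1) ?_ ?_
  · have e1 : ∀ i ∈ (allFEdges F n).filter (fun i => v ∈ i.1),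
        bE (allUEdges u n) p (fun G => if i.2 ⊆ G then q else 1) = 1 - (1 - q) * p ^ F.card := by
      intro i hi
      rw [Finset.mem_filter, mem_allFEdges] at hi
      have hsub : i.2 ⊆ allUEdges u n := by
        intro e he
        rw [mem_allUEdges]
        exact hi.1.card_edge hFc he
      have h2 := bE_superset hsub p
      rw [hi.1.card_snd] at h2
      rw [← h2]
      have h3 : ∀ G : Finset (Finset (Fin n)), (if i.2 ⊆ G then q else 1) = 1 - (1 - q) * (if i.2 ⊆ G then 1 else 0) := by
        intro G; split_ifs <;> ring
      simp only [h3]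
      rw [bE_sub, bE_const, bE_mul_left]
    rw [Finset.prod_congr rfl e1, Finset.prod_const] at h
    have e2 : ((allFEdges F n).filter (fun i => v ∈ i.1)).card = Ndeg F n := degAll_eq v
    rw [e2] at h
    refine h.trans (le_of_eq ?_)
    apply bE_congr
    intro G _
    rw [prod_ite_pow, Finset.filter_filter]
  · intro i G G' hGG
    dsimp only
    split_ifs with h1 h2 h2
    · exact le_rfl
    · exact hq1
    · exact absurd (h2.trans hGG) h1
    · exact le_rfl
  · intro i G
    split_ifs <;> linarith

lemma star_bound (hn : 0 < n) (hFc : ∀ e ∈ F, e.card = u) {K D : ℕ} (π p q : ℝ) (hπ0 : 0 ≤ π)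
    (hp0 : 0 ≤ p) (hp1 : p ≤ 1) (hq0 : 0 ≤ q) (hq1 : q ≤ 1)
    (c : Finset (FE n) → Finset (Finset (Fin n)) → ℝ) (hc0 : ∀ H G, 0 ≤ c H G)
    (hcH : ∀ H ⊆ allFEdges F n, ∑ G ∈ (allUEdges u n).powerset, c H G = bw (allFEdges F n) π H)
    (hcG : ∀ G ⊆ allUEdges u n, ∑ H ∈ (allFEdges F n).powerset, c H G = bw (allUEdges u n) p G)
    (hcE : ∀ H G, H ⊆ allFEdges F n → c H G ≠ 0 → ∀ i ∈ H, (¬ ∃ S, S ⊆ H ∧ i ∈ S ∧ BadC r K D S) → i.2 ⊆ G) :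
    ∑ H ∈ (allFEdges F n).powerset, ∑ G ∈ (allUEdges u n).powerset, c H G *
      (∑ v : Fin n, if (∃ i, IsFEdge F n i ∧ v ∈ i.1 ∧ i.2 ⊆ G ∧ i ∉ H) ∧ (∀ S, S ⊆ H → ¬ BadC r K D S)
        then q ^ degFE H v * (1 - q) else 0) ≤
    n * ((1 - (1 - q) * π) ^ Ndeg F n - (1 - (1 - q) * p ^ F.card) ^ Ndeg F n) + r * Rm F n K D π := by
  set A := allFEdges F n with hA
  set U := allUEdges u n with hU
  let dG : Finset (Finset (Fin n)) → Fin n → ℕ := fun G v => (A.filter (fun i => v ∈ i.1 ∧ i.2 ⊆ G)).card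
  have hpt : ∀ H ∈ A.powerset, ∀ G ∈ U.powerset, c H G *
      (∑ v : Fin n, if (∃ i, IsFEdge F n i ∧ v ∈ i.1 ∧ i.2 ⊆ G ∧ i ∉ H) ∧ (∀ S, S ⊆ H → ¬ BadC r K D S)
        then q ^ degFE H v * (1 - q) else 0) ≤
      c H G * (∑ v : Fin n, (q ^ degFE H v - q ^ dG G v) + r * badW r K D A H) := by
    intro H hH G _
    rw [Finset.mem_powerset] at hH
    by_cases hc : c H G = 0
    · rw [hc]; simp
    apply mul_le_mul_of_nonneg_left _ (hc0 H G)
    -- removed edges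
    let R : Fin n → ℝ := fun v => ∑ S ∈ A.powerset.filter (BadC r K D), ∑ i ∈ S, if S ⊆ H ∧ v ∈ i.1 then 1 else 0
    have hR : ∑ v : Fin n, R v = r * badW r K D A H := by
      simp only [R]
      rw [Finset.sum_comm, badW, Finset.mul_sum]
      apply Finset.sum_congr rfl
      intro S hS
      rw [Finset.mem_filter, Finset.mem_powerset] at hS
      rw [Finset.sum_comm]
      by_cases hSH : S ⊆ H
      · have : ∀ i ∈ S, ∑ v : Fin n, (if S ⊆ H ∧ v ∈ i.1 then (1:ℝ) else 0) = r := by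
          intro i hi
          simp only [hSH, true_and]
          rw [Finset.sum_boole]
          have h3 := (mem_allFEdges.1 (hS.1 hi)).card_fst
          have h4 : (Finset.univ.filter (fun v => v ∈ i.1)) = i.1 := by ext; simp
          rw [h4, h3]
        rw [Finset.sum_congr rfl this, Finset.sum_const, nsmul_eq_mul, if_pos hSH]
        ring
      · simp [hSH]
    have hR0 : ∀ v, 0 ≤ R v := by
      intro v
      apply Finset.sum_nonneg; intro S _
      apply Finset.sum_nonneg; intro i _
      split_ifs <;> norm_num
    rw [← hR, ← Finset.sum_add_distrib]
    apply Finset.sum_le_sum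
    intro v _
    have hqd : ∀ d : ℕ, 0 ≤ q ^ d ∧ q ^ d ≤ 1 := fun d => ⟨by positivity, pow_le_one₀ hq0 hq1⟩
    by_cases hrem : ∃ S, S ⊆ H ∧ BadC r K D S ∧ ∃ i ∈ S, v ∈ i.1
    · obtain ⟨S, hSH, hSb, i, hi, hvi⟩ := hrem
      rw [if_neg (fun hcon => hcon.2 S hSH hSb)]
      have : 1 ≤ R v := by
        have hmem : S ∈ A.powerset.filter (BadC r K D) :=
          Finset.mem_filter.2 ⟨Finset.mem_powerset.2 (hSH.trans hH), hSb⟩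
        calc (1:ℝ) = if S ⊆ H ∧ v ∈ i.1 then 1 else 0 := by rw [if_pos ⟨hSH, hvi⟩]
          _ ≤ ∑ i ∈ S, (if S ⊆ H ∧ v ∈ i.1 then (1:ℝ) else 0) :=
            Finset.single_le_sum (f := fun i : FE n => if S ⊆ H ∧ v ∈ i.1 then (1:ℝ) else 0)
              (fun i _ => by split_ifs <;> norm_num) hi
          _ ≤ R v := Finset.single_le_sum (f := fun S : Finset (FE n) => ∑ i ∈ S, if S ⊆ H ∧ v ∈ i.1 then (1:ℝ) else 0)
              (fun S _ => Finset.sum_nonneg (fun i _ => by split_ifs <;> norm_num)) hmem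
      have h1 := hqd (degFE H v)
      have h2 := hqd (dG G v)
      linarith
    · have hin : H.filter (fun h => v ∈ h.1) ⊆ A.filter (fun i => v ∈ i.1 ∧ i.2 ⊆ G) := by
        intro i hi
        rw [Finset.mem_filter] at hi ⊢
        refine ⟨hH hi.1, hi.2, hcE H G hH hc i hi.1 ?_⟩
        rintro ⟨S, hS, hiS, hb⟩
        exact hrem ⟨S, hS, hb, i, hiS, hi.2⟩
      have hd : degFE H v ≤ dG G v := Finset.card_le_card hin
      have hle : q ^ dG G v ≤ q ^ degFE H v := pow_le_pow_of_le_one hq0 hq1 hd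
      have hRv := hR0 v
      split_ifs with hx
      · obtain ⟨⟨i, hiF, hvi, hiG, hiH⟩, _⟩ := hx
        have hd1 : degFE H v + 1 ≤ dG G v := by
          apply Finset.card_lt_card
          refine ⟨hin, fun hcon => ?_⟩
          have : i ∈ H.filter (fun h => v ∈ h.1) := hcon (Finset.mem_filter.2 ⟨mem_allFEdges.2 hiF, hvi, hiG⟩)
          exact hiH (Finset.mem_filter.1 this).1
        have : q ^ dG G v ≤ q ^ degFE H v * q := by
          rw [← pow_succ]
          exact pow_le_pow_of_le_one hq0 hq1 hd1
        linarith
      · linarith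
  refine (Finset.sum_le_sum (fun H hH => Finset.sum_le_sum (fun G hG => hpt H hH G hG))).trans ?_
  have e1 : ∑ H ∈ A.powerset, ∑ G ∈ U.powerset,
      c H G * (∑ v : Fin n, (q ^ degFE H v - q ^ dG G v) + r * badW r K D A H) =
      ∑ v : Fin n, (bE A π (fun H => q ^ degFE H v) - bE U p (fun G => q ^ dG G v)) + r * bE A π (badW r K D A) := by
    have a1 : ∀ f : Finset (FE n) → ℝ, ∑ H ∈ A.powerset, ∑ G ∈ U.powerset, c H G * f H = bE A π f := by
      intro f
      rw [bE]
      apply Finset.sum_congr rfl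
      intro H hH
      rw [← Finset.sum_mul, hcH H (Finset.mem_powerset.1 hH)]
    have a2 : ∀ f : Finset (Finset (Fin n)) → ℝ, ∑ H ∈ A.powerset, ∑ G ∈ U.powerset, c H G * f G = bE U p f := by
      intro f
      rw [bE, Finset.sum_comm]
      apply Finset.sum_congr rfl
      intro G hG
      rw [← Finset.sum_mul, hcG G (Finset.mem_powerset.1 hG)]
    rw [Finset.sum_sub_distrib, ← bE_sum, ← bE_sum, ← bE_mul_left, ← a1, ← a1, ← a2,
      ← Finset.sum_sub_distrib, ← Finset.sum_add_distrib]
    apply Finset.sum_congr rfl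
    intro H _
    rw [← Finset.sum_sub_distrib, ← Finset.sum_add_distrib]
    apply Finset.sum_congr rfl
    intro G _
    rw [Finset.sum_sub_distrib]
    ring
  rw [e1]
  apply add_le_add
  · have : ∀ v ∈ (Finset.univ : Finset (Fin n)), bE A π (fun H => q ^ degFE H v) - bE U p (fun G => q ^ dG G v) ≤
        (1 - (1 - q) * π) ^ Ndeg F n - (1 - (1 - q) * p ^ F.card) ^ Ndeg F n := by
      intro v _
      have h1 := degG_lower (n := n) hFc p q hp0 hp1 hq0 hq1 v
      have h2 := bE_pow_deg (F := F) π q v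
      rw [h2]
      linarith
    refine (Finset.sum_le_sum this).trans (le_of_eq ?_)
    rw [Finset.sum_const, Finset.card_univ, Fintype.card_fin, nsmul_eq_mul]
  · exact mul_le_mul_of_nonneg_left (bad_bound hn K D π hπ0) (by positivity)

end Star


/-! ### Assembling the coupling for fixed `n` -/
section Assembly

lemma exists_pmf {ι β : Type*} [Fintype β] (s : Finset ι) (a : ι → ℝ) (ha : ∀ i ∈ s, 0 ≤ a i) (ha1 : ∑ i ∈ s, a i = 1)
    (X : ι → β) : ∃ μ : PMF β, ∀ E : Set β, μ.toOuterMeasure E =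
      ENNReal.ofReal (∑ i ∈ s, a i * (if X i ∈ E then 1 else 0)) := by
  have hnn : ∀ (P : ι → Prop), ∀ i ∈ s, 0 ≤ a i * (if P i then 1 else 0) := by
    intro P i hi
    apply mul_nonneg (ha i hi)
    split_ifs <;> norm_num
  have hnn2 : ∀ (P : ι → Prop), 0 ≤ ∑ i ∈ s, a i * (if P i then 1 else 0) := fun P => Finset.sum_nonneg (hnn P)
  let f : β → ℝ≥0∞ := fun b => ENNReal.ofReal (∑ i ∈ s, a i * (if X i = b then 1 else 0))
  have hf : ∑ b, f b = 1 := by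
    simp only [f]
    rw [← ENNReal.ofReal_sum_of_nonneg (fun b _ => hnn2 (fun i => X i = b)), Finset.sum_comm]
    have e : ∑ i ∈ s, ∑ b, a i * (if X i = b then (1:ℝ) else 0) = 1 := by
      refine Eq.trans ?_ ha1
      apply Finset.sum_congr rfl
      intro i _
      rw [← Finset.mul_sum]
      simp
    rw [e, ENNReal.ofReal_one]
  refine ⟨PMF.ofFintype f hf, fun E => ?_⟩
  rw [PMF.toOuterMeasure_apply_fintype]
  have : ∀ b, E.indicator (PMF.ofFintype f hf) b =
      ENNReal.ofReal (∑ i ∈ s, a i * (if X i = b ∧ b ∈ E then 1 else 0)) := by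
    intro b
    by_cases hb : b ∈ E
    · rw [Set.indicator_of_mem hb, PMF.ofFintype_apply]
      simp [f, hb]
    · rw [Set.indicator_of_notMem hb]
      simp [hb]
  simp only [this]
  rw [← ENNReal.ofReal_sum_of_nonneg (fun b _ => Finset.sum_nonneg (fun i hi => mul_nonneg (ha i hi)
    (by split_ifs <;> norm_num))), Finset.sum_comm]
  congr 1
  apply Finset.sum_congr rfl
  intro i _
  rw [← Finset.mul_sum]
  congr 1
  by_cases hE : X i ∈ E
  · rw [if_pos hE, Finset.sum_eq_single (X i)]
    · simp [hE]
    · intro b _ hb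
      rw [if_neg]
      rintro ⟨h, _⟩
      exact hb h.symm
    · simp
  · rw [if_neg hE]
    apply Finset.sum_eq_zero
    intro b _
    rw [if_neg]
    rintro ⟨rfl, h⟩
    exact hE h

variable {n r u : ℕ} {F : Finset (Finset (Fin r))}

/-- The average over `(H, G, σ)`. -/
def avg (u : ℕ) {r : ℕ} (F : Finset (Finset (Fin r))) {n : ℕ} (c : Finset (FE n) → Finset (Finset (Fin n)) → ℝ)
    (φ : Finset (FE n) → Finset (Finset (Fin n)) → Lab n → ℝ) : ℝ :=
  ∑ H ∈ (allFEdges F n).powerset, ∑ G ∈ (allUEdges u n).powerset,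
    c H G * ((∑ σ : Lab n, φ H G σ) / (Fintype.card (Lab n) : ℝ))

lemma labL_pos : (0:ℝ) < (Fintype.card (Lab n) : ℝ) := by
  have : 0 < Fintype.card (Lab n) := Fintype.card_pos_iff.2 ⟨Fintype.equivFin _⟩
  exact_mod_cast this

section
variable {c : Finset (FE n) → Finset (Finset (Fin n)) → ℝ} {π p : ℝ}

lemma avg_mono (hc0 : ∀ H G, 0 ≤ c H G) {φ ψ : Finset (FE n) → Finset (Finset (Fin n)) → Lab n → ℝ}
    (h : ∀ H G σ, H ⊆ allFEdges F n → G ⊆ allUEdges u n → c H G ≠ 0 → φ H G σ ≤ ψ H G σ) :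
    avg u F c φ ≤ avg u F c ψ := by
  apply Finset.sum_le_sum; intro H hH
  apply Finset.sum_le_sum; intro G hG
  by_cases hc : c H G = 0
  · rw [hc]; simp
  apply mul_le_mul_of_nonneg_left _ (hc0 H G)
  apply div_le_div_of_nonneg_right _ labL_pos.le
  exact Finset.sum_le_sum (fun σ _ => h H G σ (Finset.mem_powerset.1 hH) (Finset.mem_powerset.1 hG) hc)

lemma avg_add (φ ψ : Finset (FE n) → Finset (Finset (Fin n)) → Lab n → ℝ) :
    avg u F c (fun H G σ => φ H G σ + ψ H G σ) = avg u F c φ + avg u F c ψ := by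
  simp only [avg, Finset.sum_add_distrib, add_div, mul_add]

lemma avg_H (hcH : ∀ H ⊆ allFEdges F n, ∑ G ∈ (allUEdges u n).powerset, c H G = bw (allFEdges F n) π H)
    (φ : Finset (FE n) → Lab n → ℝ) :
    avg u F c (fun H _ σ => φ H σ) = bE (allFEdges F n) π (fun H => ∑ σ : Lab n, φ H σ) / (Fintype.card (Lab n) : ℝ) := by
  rw [avg, bE, Finset.sum_div]
  apply Finset.sum_congr rfl
  intro H hH
  rw [← Finset.sum_mul, hcH H (Finset.mem_powerset.1 hH), mul_div_assoc]

lemma avg_H' (hcH : ∀ H ⊆ allFEdges F n, ∑ G ∈ (allUEdges u n).powerset, c H G = bw (allFEdges F n) π H)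
    (φ : Finset (FE n) → ℝ) :
    avg u F c (fun H _ _ => φ H) = bE (allFEdges F n) π φ := by
  rw [avg_H hcH (fun H _ => φ H)]
  simp only [Finset.sum_const, Finset.card_univ, nsmul_eq_mul]
  rw [bE_mul_left, mul_div_assoc, mul_comm, div_mul_cancel₀ _ labL_pos.ne']

lemma avg_G (hcG : ∀ G ⊆ allUEdges u n, ∑ H ∈ (allFEdges F n).powerset, c H G = bw (allUEdges u n) p G)
    (φ : Finset (Finset (Fin n)) → Lab n → ℝ) :
    avg u F c (fun _ G σ => φ G σ) = bE (allUEdges u n) p (fun G => ∑ σ : Lab n, φ G σ) / (Fintype.card (Lab n) : ℝ) := by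
  rw [avg, bE, Finset.sum_div, Finset.sum_comm]
  apply Finset.sum_congr rfl
  intro G hG
  rw [← Finset.sum_mul, hcG G (Finset.mem_powerset.1 hG), mul_div_assoc]

lemma avg_HG (φ : Finset (FE n) → Finset (Finset (Fin n)) → ℝ) :
    avg u F c (fun H G _ => φ H G) = ∑ H ∈ (allFEdges F n).powerset, ∑ G ∈ (allUEdges u n).powerset, c H G * φ H G := by
  rw [avg]
  apply Finset.sum_congr rfl; intro H _
  apply Finset.sum_congr rfl; intro G _
  rw [Finset.sum_const, Finset.card_univ, nsmul_eq_mul, mul_div_assoc, mul_comm (Fintype.card (Lab n) : ℝ),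
    div_mul_cancel₀ _ labL_pos.ne']

/-- The measure. -/
lemma exists_coupling (hF0 : F.Nonempty) (hc0 : ∀ H G, 0 ≤ c H G)
    (hcH : ∀ H ⊆ allFEdges F n, ∑ G ∈ (allUEdges u n).powerset, c H G = bw (allFEdges F n) π H)
    (hcG : ∀ G ⊆ allUEdges u n, ∑ H ∈ (allFEdges F n).powerset, c H G = bw (allUEdges u n) p G) :
    ∃ μ : PMF ((Fin (Nat.choose n u) → Finset (Fin n)) × (Fin (Mnum F n) → FE n)),
      UniformOn μ Prod.fst (ValidOrdU u n) ∧ UniformOn μ Prod.snd (ValidOrdH F n) ∧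
      ∀ E : Set ((Fin (Nat.choose n u) → Finset (Fin n)) × (Fin (Mnum F n) → FE n)),
        μ.toOuterMeasure E = ENNReal.ofReal (avg u F c (fun H G σ => if (ordU u G σ, ordH F H σ) ∈ E then 1 else 0)) := by
  have hone : avg u F c (fun _ _ _ => 1) = 1 := by
    rw [avg_H' hcH (fun _ => 1), bE_one]
  have hconv : ∀ φ : Finset (FE n) → Finset (Finset (Fin n)) → Lab n → ℝ,
      ∑ i ∈ (allFEdges F n).powerset ×ˢ ((allUEdges u n).powerset ×ˢ (Finset.univ : Finset (Lab n))),
        (c i.1 i.2.1 / (Fintype.card (Lab n) : ℝ)) * φ i.1 i.2.1 i.2.2 = avg u F c φ := by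
    intro φ
    rw [Finset.sum_product, avg]
    apply Finset.sum_congr rfl; intro H _
    rw [Finset.sum_product]
    apply Finset.sum_congr rfl; intro G _
    dsimp only
    rw [← Finset.mul_sum]
    ring
  obtain ⟨μ, hμ⟩ := exists_pmf
    ((allFEdges F n).powerset ×ˢ ((allUEdges u n).powerset ×ˢ (Finset.univ : Finset (Lab n))))
    (fun i => c i.1 i.2.1 / (Fintype.card (Lab n) : ℝ)) (fun i _ => div_nonneg (hc0 _ _) labL_pos.le)
    (by
      have := hconv (fun _ _ _ => 1)
      simp only [mul_one] at this
      rw [this, hone])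
    (fun i => (ordU u i.2.1 i.2.2, ordH F i.1 i.2.2))
  have hμ2 : ∀ E : Set ((Fin (Nat.choose n u) → Finset (Fin n)) × (Fin (Mnum F n) → FE n)),
        μ.toOuterMeasure E = ENNReal.ofReal (avg u F c (fun H G σ => if (ordU u G σ, ordH F H σ) ∈ E then 1 else 0)) := by
    intro E
    rw [hμ E]
    exact congrArg ENNReal.ofReal <| hconv (fun H G σ => if (ordU u G σ, ordH F H σ) ∈ E then 1 else 0)
  refine ⟨μ, ⟨?_, ?_⟩, ⟨?_, ?_⟩, hμ2⟩
  · rw [hμ2]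
    have : (fun H G σ => if (ordU u G σ, ordH F H σ) ∈ {ω : (Fin (Nat.choose n u) → Finset (Fin n)) × (Fin (Mnum F n) → FE n) | ValidOrdU u n ω.1} then (1:ℝ) else 0)
        = fun _ _ _ => 1 := by
      funext H G σ
      rw [if_pos]
      have hs := ordU_isSort u G σ
      exact ⟨hs.injective, fun e he => hs.surj (card_allUEdges u) (mem_allUEdges.2 he)⟩
    rw [this, hone, ENNReal.ofReal_one]
  · intro a b ha hb
    have key : ∀ a, ∀ E : Set ((Fin (Nat.choose n u) → Finset (Fin n)) × (Fin (Mnum F n) → FE n)),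
        (∀ ω, ω ∈ E ↔ ω.1 = a) → (fun (H : Finset (FE n)) G σ => if (ordU u G σ, ordH F H σ) ∈ E then (1:ℝ) else 0)
        = fun _ G σ => if ordU u G σ = a then 1 else 0 := by
      intro a E hE
      funext H G σ
      exact if_congr (hE _) rfl rfl
    rw [hμ2, hμ2, key a {ω | ω.1 = a} (fun _ => Iff.rfl), key b {ω | ω.1 = b} (fun _ => Iff.rfl)]
    have e := ordU_unif u p a b ha hb
    have e1 := fun a => avg_G hcG (fun G σ => if ordU u G σ = a then (1:ℝ) else 0)
    rw [e1 a, e1 b, e]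
  · rw [hμ2]
    have : (fun H G σ => if (ordU u G σ, ordH F H σ) ∈ {ω : (Fin (Nat.choose n u) → Finset (Fin n)) × (Fin (Mnum F n) → FE n) | ValidOrdH F n ω.2} then (1:ℝ) else 0)
        = fun _ _ _ => 1 := by
      funext H G σ
      rw [if_pos]
      have hs := ordH_isSort hF0 H σ
      exact ⟨hs.injective, fun e he => hs.surj rfl (mem_allFEdges.2 he)⟩
    rw [this, hone, ENNReal.ofReal_one]
  · intro a b ha hb
    have key : ∀ a, ∀ E : Set ((Fin (Nat.choose n u) → Finset (Fin n)) × (Fin (Mnum F n) → FE n)),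
        (∀ ω, ω ∈ E ↔ ω.2 = a) → (fun (H : Finset (FE n)) G σ => if (ordU u G σ, ordH F H σ) ∈ E then (1:ℝ) else 0)
        = fun H _ σ => if ordH F H σ = a then 1 else 0 := by
      intro a E hE
      funext H G σ
      exact if_congr (hE _) rfl rfl
    rw [hμ2, hμ2, key a {ω | ω.2 = a} (fun _ => Iff.rfl), key b {ω | ω.2 = b} (fun _ => Iff.rfl)]
    have e := ordH_unif hF0 π a b ha hb
    have e1 := fun a => avg_H hcH (fun H σ => if ordH F H σ = a then (1:ℝ) else 0)
    rw [e1 a, e1 b, e]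

end

lemma trivial_coupling (hF0 : F.Nonempty) (n : ℕ) :
    ∃ μ : PMF ((Fin (Nat.choose n u) → Finset (Fin n)) × (Fin (Mnum F n) → FE n)),
      UniformOn μ Prod.fst (ValidOrdU u n) ∧ UniformOn μ Prod.snd (ValidOrdH F n) := by
  have hs1 : ∀ {α : Type} [DecidableEq α] (A : Finset α), ∑ S ∈ A.powerset, bw A 1 S = 1 := by
    intro α _ A
    have := bE_one A (1:ℝ)
    simpa [bE] using this
  obtain ⟨μ, h1, h2, _⟩ := exists_coupling (u := u) (n := n) (π := 1) (p := 1) hF0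
    (c := fun H G => bw (allFEdges F n) 1 H * bw (allUEdges u n) 1 G)
    (fun H G => mul_nonneg (bw_nonneg _ (by norm_num) le_rfl _) (bw_nonneg _ (by norm_num) le_rfl _))
    (fun H _ => by rw [← Finset.mul_sum, hs1, mul_one])
    (fun G _ => by rw [← Finset.sum_mul, hs1, one_mul])
  exact ⟨μ, h1, h2⟩

end Assembly


/-! ### The coupling for fixed `n` -/
section FixedN
variable {n r u : ℕ} {F : Finset (Finset (Fin r))}

lemma avg_le_HG {c : Finset (FE n) → Finset (Finset (Fin n)) → ℝ} (hc0 : ∀ H G, 0 ≤ c H G)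
    {φ : Finset (FE n) → Finset (Finset (Fin n)) → Lab n → ℝ} {ψ : Finset (FE n) → Finset (Finset (Fin n)) → ℝ}
    (h : ∀ H G, H ⊆ allFEdges F n → ∑ σ : Lab n, φ H G σ ≤ (Fintype.card (Lab n) : ℝ) * ψ H G) :
    avg u F c φ ≤ ∑ H ∈ (allFEdges F n).powerset, ∑ G ∈ (allUEdges u n).powerset, c H G * ψ H G := by
  apply Finset.sum_le_sum; intro H hH
  apply Finset.sum_le_sum; intro G hG
  apply mul_le_mul_of_nonneg_left _ (hc0 H G)
  rw [div_le_iff₀ labL_pos, mul_comm (ψ H G)]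
  exact h H G (Finset.mem_powerset.1 hH)

/-- Indicator that `v` is isolated at time `m`, when `H` is not too large. -/
def isoI (F : Finset (Finset (Fin r))) (m mx : ℕ) (H : Finset (FE n)) (σ : Lab n) (v : Fin n) : ℝ :=
  if H.card ≤ mx then (if ∃ h ∈ proc (ordH F H σ) m, v ∈ h.1 then 0 else 1) else 0

lemma isoI_nonneg (m mx : ℕ) (H : Finset (FE n)) (σ : Lab n) (v : Fin n) : 0 ≤ isoI F m mx H σ v := by
  unfold isoI; split_ifs <;> norm_num

lemma isoI_sum (hF0 : F.Nonempty) (m mx : ℕ) (hmx : m ≤ mx) {H : Finset (FE n)} (hH : H ⊆ allFEdges F n) (v : Fin n)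
    (q : ℝ) (hq : q = 1 - m / mx) (hq0 : 0 ≤ q) :
    ∑ σ : Lab n, isoI F m mx H σ v ≤ (Fintype.card (Lab n) : ℝ) * q ^ degFE H v := by
  unfold isoI
  by_cases h : H.card ≤ mx
  · simp only [if_pos h]
    rw [hq]
    exact iso_fixed hF0 hH m mx hmx h v
  · simp only [if_neg h, Finset.sum_const_zero]
    exact mul_nonneg labL_pos.le (pow_nonneg hq0 _)

def starT (u : ℕ) (F : Finset (Finset (Fin r))) (K D m mx : ℕ) (H : Finset (FE n)) (G : Finset (Finset (Fin n)))
    (σ : Lab n) : ℝ :=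
  ∑ v, if (∃ i, IsFEdge F n i ∧ v ∈ i.1 ∧ i.2 ⊆ G ∧ i ∉ H) ∧ (∀ S, S ⊆ H → ¬ BadC r K D S) then
    isoI F m mx H σ v else 0

def overT (F : Finset (Finset (Fin r))) (m mx : ℕ) (H : Finset (FE n)) (σ : Lab n) : ℝ :=
  ∑ i ∈ allFEdges F n, ∑ i' ∈ (allFEdges F n).filter (fun i' => i' ≠ i ∧ 2 ≤ (i.1 ∩ i'.1).card), ∑ v ∈ i.1,
    if i ∈ H ∧ i' ∈ H then isoI F m mx H σ v else 0

lemma starT_nonneg (K D m mx : ℕ) (H : Finset (FE n)) (G : Finset (Finset (Fin n))) (σ : Lab n) :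
    0 ≤ starT u F K D m mx H G σ := by
  apply Finset.sum_nonneg; intro v _
  split_ifs
  · exact isoI_nonneg _ _ _ _ _
  · exact le_rfl

lemma overT_nonneg (m mx : ℕ) (H : Finset (FE n)) (σ : Lab n) : 0 ≤ overT F m mx H σ := by
  apply Finset.sum_nonneg; intro i _
  apply Finset.sum_nonneg; intro i' _
  apply Finset.sum_nonneg; intro v _
  split_ifs
  · exact isoI_nonneg _ _ _ _ _
  · exact le_rfl

lemma starT_ge (K D m mx : ℕ) (H : Finset (FE n)) (G : Finset (Finset (Fin n))) (σ : Lab n) (hcard : H.card ≤ mx)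
    (hgood : ∀ S, S ⊆ H → ¬ BadC r K D S) (v : Fin n) (hv : ¬ ∃ h ∈ proc (ordH F H σ) m, v ∈ h.1)
    (hex : ∃ i, IsFEdge F n i ∧ v ∈ i.1 ∧ i.2 ⊆ G ∧ i ∉ H) : 1 ≤ starT u F K D m mx H G σ := by
  unfold starT
  refine le_trans ?_ (Finset.single_le_sum (f := fun v => if (∃ i, IsFEdge F n i ∧ v ∈ i.1 ∧ i.2 ⊆ G ∧ i ∉ H) ∧
    (∀ S, S ⊆ H → ¬ BadC r K D S) then isoI F m mx H σ v else 0) ?_ (Finset.mem_univ v))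
  · rw [if_pos ⟨hex, hgood⟩, isoI, if_pos hcard, if_neg hv]
  · intro w _
    split_ifs
    · exact isoI_nonneg _ _ _ _ _
    · exact le_rfl

lemma triple_ge (A H : Finset (FE n)) (R : FE n → FE n → Prop) [∀ i, DecidablePred (R i)] (J : Fin n → ℝ) (hJ : ∀ v, 0 ≤ J v) (i i' : FE n) (v : Fin n)
    (hiA : i ∈ A) (hiA' : i' ∈ A) (hi : i ∈ H) (hi' : i' ∈ H) (hv : v ∈ i.1) (hR : R i i') :
    J v ≤ ∑ i ∈ A, ∑ i' ∈ A.filter (fun i' => R i i'), ∑ v ∈ i.1, if i ∈ H ∧ i' ∈ H then J v else 0 := by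
  have nn : ∀ i i' : FE n, ∀ v : Fin n, 0 ≤ if i ∈ H ∧ i' ∈ H then J v else 0 := by
    intro i i' v
    split_ifs
    · exact hJ v
    · exact le_rfl
  refine le_trans ?_ (Finset.single_le_sum
    (fun w _ => Finset.sum_nonneg (fun y _ => Finset.sum_nonneg (fun x _ => nn w y x))) hiA)
  refine le_trans ?_ (Finset.single_le_sum
    (fun w _ => Finset.sum_nonneg (fun x _ => nn i w x)) (Finset.mem_filter.2 ⟨hiA', hR⟩))
  refine le_trans ?_ (Finset.single_le_sum (fun w _ => nn i i' w) hv)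
  rw [if_pos ⟨hi, hi'⟩]

lemma overT_ge (m mx : ℕ) (H : Finset (FE n)) (σ : Lab n) (hHA : H ⊆ allFEdges F n) (hcard : H.card ≤ mx)
    (v : Fin n) (hv : ¬ ∃ h ∈ proc (ordH F H σ) m, v ∈ h.1)
    (i i' : FE n) (hi : i ∈ H) (hvi : v ∈ i.1) (hi' : i' ∈ H) (hne : i' ≠ i) (h2 : 2 ≤ (i.1 ∩ i'.1).card) :
    1 ≤ overT F m mx H σ := by
  have h := triple_ge (allFEdges F n) H (fun i i' => i' ≠ i ∧ 2 ≤ (i.1 ∩ i'.1).card) (fun v => isoI F m mx H σ v)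
    (fun v => isoI_nonneg _ _ _ _ _) i i' v (hHA hi) (hHA hi') hi hi' hvi ⟨hne, h2⟩
  have h1 : isoI F m mx H σ v = 1 := by rw [isoI, if_pos hcard, if_neg hv]
  rw [h1] at h
  exact h

/-- The event of the theorem. -/
def evt (u : ℕ) (F : Finset (Finset (Fin r))) (n gap : ℕ) :
    Set ((Fin (Nat.choose n u) → Finset (Fin n)) × (Fin (Mnum F n) → FE n)) :=
  {ω | ∀ h ∈ proc ω.2 (THit F n ω.2), ¬ h.2 ⊆ proc ω.1 (TGHit u F n ω.1) →
    ∃ h' ∈ proc ω.2 (THit F n ω.2 + gap), h' ∉ proc ω.2 (THit F n ω.2) ∧ Partner u h h'}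

lemma starT_avg (hn : 0 < n) (hFc : ∀ e ∈ F, e.card = u) (hF0 : F.Nonempty) {K D : ℕ} (π p q : ℝ) (hπ0 : 0 ≤ π) (hp0 : 0 ≤ p)
    (hp1 : p ≤ 1) (hq0 : 0 ≤ q) (hq1 : q < 1) (m mx : ℕ) (hmx : m ≤ mx) (hq : q = 1 - m / mx)
    (c : Finset (FE n) → Finset (Finset (Fin n)) → ℝ) (hc0 : ∀ H G, 0 ≤ c H G)
    (hcH : ∀ H ⊆ allFEdges F n, ∑ G ∈ (allUEdges u n).powerset, c H G = bw (allFEdges F n) π H)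
    (hcG : ∀ G ⊆ allUEdges u n, ∑ H ∈ (allFEdges F n).powerset, c H G = bw (allUEdges u n) p G)
    (hcE : ∀ H G, H ⊆ allFEdges F n → c H G ≠ 0 → ∀ i ∈ H, (¬ ∃ S, S ⊆ H ∧ i ∈ S ∧ BadC r K D S) → i.2 ⊆ G) :
    avg u F c (starT u F K D m mx) ≤
      (n * ((1 - (1 - q) * π) ^ Ndeg F n - (1 - (1 - q) * p ^ F.card) ^ Ndeg F n) + r * Rm F n K D π) / (1 - q) := by
  have h1 := star_bound (K := K) (D := D) hn hFc π p q hπ0 hp0 hp1 hq0 hq1.le c hc0 hcH hcG hcE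
  rw [le_div_iff₀ (by linarith)]
  refine le_trans ?_ h1
  have h2 : avg u F c (starT u F K D m mx) ≤ ∑ H ∈ (allFEdges F n).powerset, ∑ G ∈ (allUEdges u n).powerset,
      c H G * (∑ v, if (∃ i, IsFEdge F n i ∧ v ∈ i.1 ∧ i.2 ⊆ G ∧ i ∉ H) ∧ (∀ S, S ⊆ H → ¬ BadC r K D S) then
        q ^ degFE H v else 0) := by
    apply avg_le_HG hc0
    intro H G hH
    unfold starT
    rw [Finset.sum_comm, Finset.mul_sum]
    apply Finset.sum_le_sum
    intro v _
    split_ifs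
    · exact isoI_sum hF0 m mx hmx hH v q hq hq0
    · simp
  refine (mul_le_mul_of_nonneg_right h2 (by linarith)).trans (le_of_eq ?_)
  rw [Finset.sum_mul]
  apply Finset.sum_congr rfl; intro H _
  rw [Finset.sum_mul]
  apply Finset.sum_congr rfl; intro G _
  rw [mul_assoc, Finset.sum_mul]
  congr 1
  apply Finset.sum_congr rfl; intro v _
  split_ifs
  · rfl
  · simp

lemma overT_avg (hF0 : F.Nonempty) (π q : ℝ) (hπ0 : 0 ≤ π) (hπ1 : π ≤ 1) (hq0 : 0 ≤ q) (hq1 : q ≤ 1)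
    (m mx : ℕ) (hmx : m ≤ mx) (hq : q = 1 - m / mx)
    (c : Finset (FE n) → Finset (Finset (Fin n)) → ℝ) (hc0 : ∀ H G, 0 ≤ c H G)
    (hcH : ∀ H ⊆ allFEdges F n, ∑ G ∈ (allUEdges u n).powerset, c H G = bw (allFEdges F n) π H) :
    avg u F c (fun H _ σ => overT F m mx H σ) ≤
      Mnum F n * ((r ^ 4 * n ^ (r - 2) : ℕ) * (r * (π ^ 2 * (1 - (1 - q) * π) ^ (Ndeg F n - 2)))) := by
  refine le_trans ?_ (overlap_bound π q hπ0 hπ1 hq0 hq1)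
  rw [← avg_H' hcH, avg_HG]
  apply avg_le_HG hc0
  intro H G hH
  unfold overT
  rw [Finset.sum_comm, Finset.mul_sum]
  apply Finset.sum_le_sum; intro i _
  rw [Finset.sum_comm, Finset.mul_sum]
  apply Finset.sum_le_sum; intro i' _
  rw [Finset.sum_comm, Finset.mul_sum]
  apply Finset.sum_le_sum; intro v _
  split_ifs
  · exact isoI_sum hF0 m mx hmx hH v q hq hq0
  · simp

/-- The total error. -/
def betaErr (F : Finset (Finset (Fin r))) (n K D m mx B : ℕ) (π p η ρ y : ℝ) : ℝ :=
  Rm F n K D π + n * (1 - π) ^ Ndeg F n + (1 + η * π) ^ Mnum F n / (1 + η) ^ mx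
    + (1 / (n * (1 - y) ^ Ndeg F n) + (((1 - y) ^ B)⁻¹ - 1))
    + (n * ((1 - ρ * π) ^ Ndeg F n - (1 - ρ * p ^ F.card) ^ Ndeg F n) + r * Rm F n K D π) / ρ
    + Mnum F n * ((r ^ 4 * n ^ (r - 2) : ℕ) * (r * (π ^ 2 * (1 - ρ * π) ^ (Ndeg F n - 2))))

lemma pointwise (hu : 2 ≤ u) (hFc : ∀ e ∈ F, e.card = u) (hF : Nice u F)
    {K D : ℕ} (hK : 2 ≤ K) (m mx gap : ℕ) (hgap : mx ≤ m + gap) (c : Finset (FE n) → Finset (Finset (Fin n)) → ℝ)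
    (hcE : ∀ H G, H ⊆ allFEdges F n → c H G ≠ 0 → ∀ i ∈ H, (¬ ∃ S, S ⊆ H ∧ i ∈ S ∧ BadC r K D S) → i.2 ⊆ G)
    (H : Finset (FE n)) (G : Finset (Finset (Fin n))) (σ : Lab n) (hH : H ⊆ allFEdges F n) (hc : c H G ≠ 0) :
    (1:ℝ) ≤ (if (ordU u G σ, ordH F H σ) ∈ evt u F n gap then 1 else 0)
      + (if ∀ S, S ⊆ H → ¬ BadC r K D S then 0 else 1) + (if ∀ v : Fin n, ∃ h ∈ H, v ∈ h.1 then 0 else 1)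
      + (if mx < H.card then 1 else 0)
      + (if ∀ v : Fin n, ∃ h ∈ proc (ordH F H σ) m, v ∈ h.1 then 1 else 0)
      + starT u F K D m mx H G σ + overT F m mx H σ := by
  have s0 := starT_nonneg (u := u) (F := F) K D m mx H G σ
  have o0 := overT_nonneg (F := F) m mx H σ
  have i0 : ∀ P : Prop, (0:ℝ) ≤ if P then 0 else 1 := by intro P; split_ifs <;> norm_num
  have i1 : ∀ P : Prop, (0:ℝ) ≤ if P then 1 else 0 := by intro P; split_ifs <;> norm_num
  have a0 : (0:ℝ) ≤ (if (ordU u G σ, ordH F H σ) ∈ evt u F n gap then 1 else 0) := by split_ifs <;> norm_num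
  have a1 : (0:ℝ) ≤ (if ∀ S, S ⊆ H → ¬ BadC r K D S then 0 else 1) := by split_ifs <;> norm_num
  have a2 : (0:ℝ) ≤ (if ∀ v : Fin n, ∃ h ∈ H, v ∈ h.1 then 0 else 1) := by split_ifs <;> norm_num
  have a3 : (0:ℝ) ≤ (if mx < H.card then 1 else 0) := by split_ifs <;> norm_num
  have a4 : (0:ℝ) ≤ (if ∀ v : Fin n, ∃ h ∈ proc (ordH F H σ) m, v ∈ h.1 then 1 else 0) := by split_ifs <;> norm_num
  by_cases h1 : ∀ S, S ⊆ H → ¬ BadC r K D S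
  swap
  · rw [if_neg h1] at a1 ⊢; linarith
  by_cases h2 : ∀ v : Fin n, ∃ h ∈ H, v ∈ h.1
  swap
  · rw [if_neg h2] at a2 ⊢; linarith
  by_cases h3 : mx < H.card
  · rw [if_pos h3] at a3 ⊢; linarith
  by_cases h4 : ∀ v : Fin n, ∃ h ∈ proc (ordH F H σ) m, v ∈ h.1
  · rw [if_pos h4] at a4 ⊢; linarith
  by_cases h5 : ∃ v : Fin n, (¬ ∃ h ∈ proc (ordH F H σ) m, v ∈ h.1) ∧ ∃ i, IsFEdge F n i ∧ v ∈ i.1 ∧ i.2 ⊆ G ∧ i ∉ H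
  · obtain ⟨v, hv, hex⟩ := h5
    have := starT_ge (u := u) (F := F) K D m mx H G σ (not_lt.1 h3) h1 v hv hex
    linarith
  by_cases h6 : ∃ v : Fin n, (¬ ∃ h ∈ proc (ordH F H σ) m, v ∈ h.1) ∧ ∃ i ∈ H, v ∈ i.1 ∧ ∃ i' ∈ H, i' ≠ i ∧ 2 ≤ (i.1 ∩ i'.1).card
  · obtain ⟨v, hv, i, hi, hvi, i', hi', hne, hc2⟩ := h6
    have := overT_ge (F := F) m mx H σ hH (not_lt.1 h3) v hv i i' hi hvi hi' hne hc2
    linarith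
  have hev : (ordU u G σ, ordH F H σ) ∈ evt u F n gap := by
    refine determ hu hFc hF hK H G σ m gap hH (fun S hS hb => h1 S hS (Or.inl hb)) ?_ h2 (by omega) h4 ?_ ?_
    · intro i hi
      exact hcE H G hH hc i hi (fun ⟨S, hS, _, hb⟩ => h1 S hS hb)
    · intro v hv i hi hvi hiG
      by_contra hiH
      exact h5 ⟨v, hv, i, hi, hvi, hiG, hiH⟩
    · intro v hv i hi hvi i' hi' hne
      by_contra hlt
      exact h6 ⟨v, hv, i, hi, hvi, i', hi', hne, not_lt.1 hlt⟩
  rw [if_pos hev]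
  rw [if_pos hev] at a0
  linarith

theorem fin_coupling (hu : 2 ≤ u) (hFc : ∀ e ∈ F, e.card = u) (hF : Nice u F) (hF0 : F.Nonempty) (hn : 0 < n)
    {K D : ℕ} (hK : 2 ≤ K) (hD : 1 ≤ D) (m mx gap B : ℕ) (hm0 : 0 < m) (hmx : m ≤ mx) (hgap : mx ≤ m + gap)
    (π p η ρ y : ℝ) (hπ0 : 0 ≤ π) (hπ1 : π ≤ 1) (hp0 : 0 ≤ p) (hp1 : p ≤ 1) (hη : 0 ≤ η) (hρ : ρ = m / mx)
    (hm : m + 2 * Ndeg F n ≤ Mnum F n) (hN : 1 ≤ Ndeg F n) (hB : r ^ 2 * n ^ (r - 2) ≤ B)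
    (hy : y = (m : ℝ) / ((Mnum F n : ℝ) - Ndeg F n))
    (c : Finset (FE n) → Finset (Finset (Fin n)) → ℝ) (hc0 : ∀ H G, 0 ≤ c H G)
    (hcH : ∀ H ⊆ allFEdges F n, ∑ G ∈ (allUEdges u n).powerset, c H G = bw (allFEdges F n) π H)
    (hcG : ∀ G ⊆ allUEdges u n, ∑ H ∈ (allFEdges F n).powerset, c H G = bw (allUEdges u n) p G)
    (hcE : ∀ H G, H ⊆ allFEdges F n → c H G ≠ 0 → ∀ i ∈ H, (¬ ∃ S, S ⊆ H ∧ i ∈ S ∧ BadC r K D S) → i.2 ⊆ G) :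
    ∃ μ : PMF ((Fin (Nat.choose n u) → Finset (Fin n)) × (Fin (Mnum F n) → FE n)),
      UniformOn μ Prod.fst (ValidOrdU u n) ∧ UniformOn μ Prod.snd (ValidOrdH F n) ∧
      ENNReal.ofReal (1 - betaErr F n K D m mx B π p η ρ y) ≤ μ.toOuterMeasure (evt u F n gap) := by
  obtain ⟨μ, h1, h2, h3⟩ := exists_coupling hF0 hc0 hcH hcG
  refine ⟨μ, h1, h2, ?_⟩
  rw [h3]
  apply ENNReal.ofReal_le_ofReal
  have hmxp : 0 < mx := lt_of_lt_of_le hm0 hmx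
  have hρ0 : 0 < ρ := by rw [hρ]; positivity
  have hρ1 : ρ ≤ 1 := by
    rw [hρ, div_le_one (by exact_mod_cast hmxp)]; exact_mod_cast hmx
  have hone : avg u F c (fun _ _ _ => 1) = 1 := by
    rw [avg_H' hcH (fun _ => 1), bE_one]
  have hmono := avg_mono (u := u) hc0 (fun H G σ hH _ hc => pointwise hu hFc hF hK m mx gap hgap c hcE H G σ hH hc)
  rw [hone] at hmono
  simp only [avg_add] at hmono
  have e1 := bad_event_bound (F := F) hn K D hD π hπ0 hπ1
  rw [← avg_H' hcH] at e1
  have e2 := isolated_bound (n := n) (F := F) π hπ0 hπ1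
  rw [← avg_H' hcH] at e2
  have e3 := size_bound (allFEdges F n) π hπ0 hπ1 mx η hη
  rw [← avg_H' hcH] at e3
  have e4 := cover_bound hF0 π hπ0 hπ1 m B hm hN hn hB y hy
  rw [← div_le_iff₀' labL_pos, ← avg_H hcH] at e4
  have e5 := starT_avg hn hFc hF0 π p (1 - ρ) hπ0 hp0 hp1 (by linarith) (by linarith) m mx hmx (by rw [hρ]) c hc0 hcH hcG hcE
  have e6 := overT_avg hF0 π (1 - ρ) hπ0 hπ1 (by linarith) (by linarith) m mx hmx (by rw [hρ]) c hc0 hcH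
  rw [sub_sub_cancel] at e5 e6
  unfold betaErr
  have hM : (allFEdges F n).card = Mnum F n := rfl
  rw [hM] at e3
  linarith

end FixedN


/-! ### Numerical estimates -/
section Numeric

lemma num_pow_le_exp (x : ℝ) (hx : x ≤ 1) (k : ℕ) : (1 - x) ^ k ≤ Real.exp (-(x * k)) := by
  have h : 1 - x ≤ Real.exp (-x) := Real.one_sub_le_exp_neg x
  calc (1 - x) ^ k ≤ Real.exp (-x) ^ k := pow_le_pow_left₀ (by linarith) h k
    _ = Real.exp (-(x * k)) := by rw [← Real.exp_nat_mul]; congr 1; ring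

lemma num_exp_le_pow (y : ℝ) (hy : y < 1) (k : ℕ) : Real.exp (-(k * (y / (1 - y)))) ≤ (1 - y) ^ k := by
  have h1 : 0 < 1 - y := by linarith
  have h := Real.one_sub_inv_le_log_of_pos h1
  have h2 : -(y / (1 - y)) ≤ Real.log (1 - y) := by
    refine le_trans (le_of_eq ?_) h
    field_simp
    ring
  calc Real.exp (-(k * (y / (1 - y)))) = Real.exp (-(y / (1 - y))) ^ k := by rw [← Real.exp_nat_mul]; congr 1; ring
    _ ≤ (Real.exp (Real.log (1 - y))) ^ k := pow_le_pow_left₀ (Real.exp_pos _).le (Real.exp_le_exp.2 h2) k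
    _ = (1 - y) ^ k := by rw [Real.exp_log h1]

/-- isolated vertices -/
lemma num_T2 (n N : ℕ) (hn : 0 < n) (π γ : ℝ) (hπ1 : π ≤ 1) (h : π * N = Real.log n + γ) :
    n * (1 - π) ^ N ≤ Real.exp (-γ) := by
  have h1 := num_pow_le_exp π hπ1 N
  have hn' : (0:ℝ) < n := by exact_mod_cast hn
  calc n * (1 - π) ^ N ≤ n * Real.exp (-(π * N)) := mul_le_mul_of_nonneg_left h1 hn'.le
    _ = Real.exp (-γ) := by
      nth_rewrite 1 [← Real.exp_log hn']
      rw [← Real.exp_add, h]; congr 1; ring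

/-- number of `F`-edges -/
lemma num_T3 (n M mx : ℕ) (π η ℓ : ℝ) (hπ0 : 0 ≤ π) (hℓ : 1 ≤ ℓ) (hη : η = 1 / ℓ) (h1 : η * (π * M) ≤ n / 2)
    (h2 : π * M + n ≤ mx) : (1 + η * π) ^ M / (1 + η) ^ mx ≤ Real.exp (-(n / (4 * ℓ))) := by
  have hℓ0 : 0 < ℓ := by linarith
  have hη0 : 0 < η := by rw [hη]; positivity
  have hη1 : η ≤ 1 := by rw [hη, div_le_one hℓ0]; exact hℓ
  have a1 : (1 + η * π) ^ M ≤ Real.exp (η * π * M) := by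
    calc (1 + η * π) ^ M ≤ Real.exp (η * π) ^ M :=
          pow_le_pow_left₀ (by positivity) (by linarith [Real.add_one_le_exp (η * π)]) M
      _ = _ := by rw [← Real.exp_nat_mul]; congr 1; ring
  have a2 : Real.exp (mx * (η / (1 + η))) ≤ (1 + η) ^ mx := by
    have := num_exp_le_pow (-η) (by linarith) mx
    refine le_trans (le_of_eq ?_) (this.trans (le_of_eq ?_))
    · congr 1; rw [sub_neg_eq_add]; ring
    · rw [sub_neg_eq_add]
  calc (1 + η * π) ^ M / (1 + η) ^ mx ≤ Real.exp (η * π * M) / Real.exp (mx * (η / (1 + η))) :=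
        div_le_div₀ (Real.exp_pos _).le a1 (Real.exp_pos _) a2
    _ = Real.exp (η * π * M - mx * (η / (1 + η))) := by rw [Real.exp_sub]
    _ ≤ Real.exp (-(n / (4 * ℓ))) := by
      apply Real.exp_le_exp.2
      have b1 : (π * M + n) * (η / (1 + η)) ≤ mx * (η / (1 + η)) := mul_le_mul_of_nonneg_right h2 (by positivity)
      have b2 : η * π * M - (π * M + n) * (η / (1 + η)) = (η / (1 + η)) * (η * (π * M) - n) := by
        field_simp; ring
      have b3 : (η / (1 + η)) * (η * (π * M) - n) ≤ (η / (1 + η)) * (-(n / 2)) :=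
        mul_le_mul_of_nonneg_left (by linarith) (by positivity)
      have b4 : η / 2 ≤ η / (1 + η) := div_le_div_of_nonneg_left hη0.le (by linarith) (by linarith)
      have b5 : (η / 2) * (n / 2) ≤ (η / (1 + η)) * (n / 2) := mul_le_mul_of_nonneg_right b4 (by positivity)
      have b6 : (η / 2) * (n / 2 : ℝ) = n / (4 * ℓ) := by rw [hη]; field_simp; ring
      linarith

/-- early covering -/
lemma num_T4 (n N B : ℕ) (hn : 0 < n) (γ y w : ℝ) (hy1 : y < 1)
    (h : N * (y / (1 - y)) ≤ Real.log n - γ + 1) (hB : B * (y / (1 - y)) ≤ w) :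
    1 / (n * (1 - y) ^ N) + (((1 - y) ^ B)⁻¹ - 1) ≤ Real.exp (1 - γ) + (Real.exp w - 1) := by
  have hn' : (0:ℝ) < n := by exact_mod_cast hn
  have a1 := num_exp_le_pow y hy1 N
  have a2 := num_exp_le_pow y hy1 B
  have b1 : 1 / (n * (1 - y) ^ N) ≤ Real.exp (1 - γ) := by
    have c1 : (n:ℝ) * Real.exp (-(Real.log n - γ + 1)) ≤ n * (1 - y) ^ N :=
      mul_le_mul_of_nonneg_left (le_trans (Real.exp_le_exp.2 (by linarith)) a1) hn'.le
    have c2 : (n:ℝ) * Real.exp (-(Real.log n - γ + 1)) = Real.exp (-(1 - γ)) := by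
      nth_rewrite 1 [← Real.exp_log hn']
      rw [← Real.exp_add]; congr 1; ring
    rw [c2] at c1
    calc 1 / (n * (1 - y) ^ N) ≤ 1 / Real.exp (-(1 - γ)) := one_div_le_one_div_of_le (Real.exp_pos _) c1
      _ = _ := by rw [Real.exp_neg]; simp
  have b2 : ((1 - y) ^ B)⁻¹ ≤ Real.exp w := by
    calc ((1 - y) ^ B)⁻¹ ≤ (Real.exp (-w))⁻¹ :=
          inv_anti₀ (Real.exp_pos _) (le_trans (Real.exp_le_exp.2 (by linarith)) a2)
      _ = _ := by rw [Real.exp_neg]; simp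
  linarith

lemma num_pow_sub (a b : ℝ) (hb : 0 ≤ b) (hab : b ≤ a) (N : ℕ) : a ^ N - b ^ N ≤ N * a ^ (N - 1) * (a - b) := by
  have ha : 0 ≤ a := hb.trans hab
  have h := (Commute.all a b).mul_geom_sum₂ N
  rw [← h, mul_comm]
  apply mul_le_mul_of_nonneg_right _ (by linarith)
  calc ∑ i ∈ Finset.range N, a ^ i * b ^ (N - 1 - i) ≤ ∑ i ∈ Finset.range N, a ^ (N - 1) := by
        apply Finset.sum_le_sum
        intro i hi
        rw [Finset.mem_range] at hi
        calc a ^ i * b ^ (N - 1 - i) ≤ a ^ i * a ^ (N - 1 - i) :=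
              mul_le_mul_of_nonneg_left (pow_le_pow_left₀ hb hab _) (pow_nonneg ha _)
          _ = a ^ (N - 1) := by rw [← pow_add]; congr 1; omega
    _ = N * a ^ (N - 1) := by simp

/-- `(1-x)^(N-j)` -/
lemma num_pow_sub_le (x : ℝ) (hx0 : 0 ≤ x) (hx1 : x ≤ 1) (N j : ℕ) (hj : j ≤ N) :
    (1 - x) ^ (N - j) ≤ Real.exp j * Real.exp (-(x * N)) := by
  refine (num_pow_le_exp x hx1 (N - j)).trans ?_
  rw [← Real.exp_add]
  apply Real.exp_le_exp.2
  rw [Nat.cast_sub hj]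
  have : x * j ≤ j := by
    calc x * (j:ℝ) ≤ 1 * j := mul_le_mul_of_nonneg_right hx1 (by positivity)
      _ = j := one_mul _
  nlinarith

/-- extra copies -/
lemma num_T6 (n N : ℕ) (hN : 1 ≤ N) (π ps ρ ε ℓ E : ℝ) (hπ0 : 0 ≤ π) (hπ1 : π ≤ 1)
    (hps : π = ps * (1 - ε)) (hps1 : ps ≤ 1) (hε0 : 0 ≤ ε) (hε : ε ≤ 1 / 2) (hρ0 : 0 ≤ ρ) (hρ1 : ρ ≤ 1)
    (hπN : π * N ≤ 2 * ℓ) (hE : n * Real.exp (-(ρ * π * N)) ≤ E) :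
    n * ((1 - ρ * π) ^ N - (1 - ρ * ps) ^ N) ≤ 4 * Real.exp 1 * (ε * ℓ * E) := by
  have hps0 : 0 ≤ ps := by
    by_contra h
    have : ps * (1 - ε) < 0 := mul_neg_of_neg_of_pos (not_le.1 h) (by linarith)
    linarith
  have hpp : π ≤ ps := by rw [hps]; nlinarith
  have hps2 : ps ≤ 2 * π := by rw [hps]; nlinarith
  have hb : 0 ≤ 1 - ρ * ps := by nlinarith
  have hab : 1 - ρ * ps ≤ 1 - ρ * π := by nlinarith
  have h1 := num_pow_sub _ _ hb hab N
  have h2 := num_pow_sub_le (ρ * π) (by positivity) (by nlinarith) N 1 hN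
  have hd : (1 - ρ * π) - (1 - ρ * ps) ≤ 2 * ε * π := by
    have : ps - π = ps * ε := by rw [hps]; ring
    calc (1 - ρ * π) - (1 - ρ * ps) = ρ * (ps - π) := by ring
      _ ≤ 1 * (ps - π) := mul_le_mul_of_nonneg_right hρ1 (by linarith)
      _ = ps * ε := by rw [one_mul, this]
      _ ≤ 2 * π * ε := mul_le_mul_of_nonneg_right hps2 hε0
      _ = _ := by ring
  have hd0 : 0 ≤ (1 - ρ * π) - (1 - ρ * ps) := by linarith
  rw [Nat.cast_one] at h2
  calc n * ((1 - ρ * π) ^ N - (1 - ρ * ps) ^ N) ≤ n * (N * (Real.exp 1 * Real.exp (-(ρ * π * N))) * (2 * ε * π)) := by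
        apply mul_le_mul_of_nonneg_left _ (by positivity)
        refine h1.trans ?_
        apply mul_le_mul _ hd hd0 (by positivity)
        exact mul_le_mul_of_nonneg_left h2 (by positivity)
    _ = Real.exp 1 * 2 * ε * (π * N) * (n * Real.exp (-(ρ * π * N))) := by ring
    _ ≤ Real.exp 1 * 2 * ε * (2 * ℓ) * E := by
        apply mul_le_mul _ hE (by positivity)
        · have : 0 ≤ π * N := by positivity
          have : 0 ≤ 2 * ℓ := by linarith
          positivity
        · exact mul_le_mul_of_nonneg_left hπN (by positivity)
    _ = _ := by ring

/-- overlaps -/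
lemma num_T7 (n N M r : ℕ) (hr : 4 ≤ r) (hn : 0 < n) (hN : 2 ≤ N) (π ρ A E : ℝ) (hπ0 : 0 ≤ π) (hπ1 : π ≤ 1)
    (hρ0 : 0 ≤ ρ) (hρ1 : ρ ≤ 1) (hM : M ≤ n ^ r) (hA : π * (n:ℝ) ^ (r - 1) ≤ A)
    (hE : n * Real.exp (-(ρ * π * N)) ≤ E) :
    M * ((r ^ 4 * n ^ (r - 2) : ℕ) * (r * (π ^ 2 * (1 - ρ * π) ^ (N - 2)))) ≤ r ^ 5 * Real.exp 2 * (A ^ 2 * E / n) := by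
  have hn' : (0:ℝ) < n := by exact_mod_cast hn
  have h2 := num_pow_sub_le (ρ * π) (by positivity) (by nlinarith) N 2 hN
  have hM' : (M:ℝ) ≤ (n:ℝ) ^ r := by exact_mod_cast hM
  obtain ⟨k, rfl⟩ : ∃ k, r = k + 2 := ⟨r - 2, by omega⟩
  have e1 : k + 2 - 2 = k := by omega
  have e2 : k + 2 - 1 = k + 1 := by omega
  rw [e1]
  rw [e2] at hA
  have hA2 : (π * (n:ℝ) ^ (k + 1)) ^ 2 ≤ A ^ 2 := pow_le_pow_left₀ (by positivity) hA 2
  have hnn : 0 ≤ 1 - ρ * π := by nlinarith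
  push_cast at h2 ⊢
  calc (M:ℝ) * (((k + 2 : ℝ) ^ 4 * (n:ℝ) ^ k) * ((k + 2 : ℝ) * (π ^ 2 * (1 - ρ * π) ^ (N - 2))))
      ≤ (n:ℝ) ^ (k + 2) * (((k + 2 : ℝ) ^ 4 * (n:ℝ) ^ k) * ((k + 2 : ℝ) * (π ^ 2 * (Real.exp 2 * Real.exp (-(ρ * π * N)))))) := by
        gcongr
    _ = (k + 2 : ℝ) ^ 5 * Real.exp 2 * ((π * (n:ℝ) ^ (k + 1)) ^ 2 * (n * Real.exp (-(ρ * π * N))) / n) := by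
        field_simp
        ring
    _ ≤ (k + 2 : ℝ) ^ 5 * Real.exp 2 * (A ^ 2 * E / n) := by
        gcongr

/-- large degree -/
lemma num_deg (n N D : ℕ) (hn : 0 < n) (π : ℝ) (hπ0 : 0 ≤ π) (hπN : π * N ≤ 2 * Real.log n)
    (hD : (1 + Real.exp 3) * Real.log n ≤ D) : n * (D * (Nat.choose N D : ℝ) * π ^ D) ≤ 1 / n := by
  have hn' : (0:ℝ) < n := by exact_mod_cast hn
  have hℓ : 0 ≤ Real.log n := Real.log_natCast_nonneg n
  set ℓ := Real.log n with hℓd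
  have a1 : (Nat.choose N D : ℝ) ≤ (N:ℝ) ^ D / D.factorial := by
    exact Nat.choose_le_pow_div D N
  have a2 : (D:ℝ) ≤ Real.exp D := by linarith [Real.add_one_le_exp (D:ℝ)]
  have a3 : (2 * ℓ * Real.exp 3) ^ D / D.factorial ≤ Real.exp (2 * ℓ * Real.exp 3) :=
    Real.pow_div_factorial_le_exp _ (by positivity) D
  have a4 : (2 * ℓ) ^ D / D.factorial ≤ Real.exp (2 * ℓ * Real.exp 3 - 3 * D) := by
    rw [Real.exp_sub, le_div_iff₀ (Real.exp_pos _)]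
    refine le_trans (le_of_eq ?_) a3
    have : Real.exp (3 * D) = Real.exp 3 ^ D := by rw [← Real.exp_nat_mul]; congr 1; ring
    rw [this, mul_pow]; ring
  calc n * (D * (Nat.choose N D : ℝ) * π ^ D) ≤ n * (Real.exp D * ((N:ℝ) ^ D / D.factorial) * π ^ D) := by
        gcongr
    _ = n * (Real.exp D * ((π * N) ^ D / D.factorial)) := by rw [mul_pow]; ring
    _ ≤ n * (Real.exp D * ((2 * ℓ) ^ D / D.factorial)) := by gcongr
    _ ≤ n * (Real.exp D * Real.exp (2 * ℓ * Real.exp 3 - 3 * D)) := by gcongr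
    _ = Real.exp (ℓ + (D + (2 * ℓ * Real.exp 3 - 3 * D))) := by
        rw [Real.exp_add, Real.exp_add, hℓd, Real.exp_log hn']
    _ ≤ Real.exp (-ℓ) := by
        apply Real.exp_le_exp.2
        nlinarith
    _ = 1 / n := by rw [Real.exp_neg, hℓd, Real.exp_log hn', one_div]

/-- The constant in the bound for small dense configurations. -/
def CKconst (r K : ℕ) : ℝ := ∑ k ∈ Finset.Icc 2 K, (k:ℝ) * 2 ^ (((r - 1) * k - 1) ^ r)

lemma CKconst_nonneg (r K : ℕ) : 0 ≤ CKconst r K := by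
  unfold CKconst; positivity

lemma num_Rm {r : ℕ} (F : Finset (Finset (Fin r))) (n K D : ℕ) (hr : 4 ≤ r) (hn : 0 < n) (π A : ℝ) (hπ0 : 0 ≤ π)
    (hA1 : 1 ≤ A) (hA : π * (n:ℝ) ^ (r - 1) ≤ A) (hπN : π * Ndeg F n ≤ 2 * Real.log n)
    (hD : (1 + Real.exp 3) * Real.log n ≤ D) : Rm F n K D π ≤ (CKconst r K + 1) * A ^ K / n := by
  have hn' : (0:ℝ) < n := by exact_mod_cast hn
  have h1 := num_deg n (Ndeg F n) D hn π hπ0 hπN hD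
  have h2 : ∀ k ∈ Finset.Icc 2 K, (k:ℝ) * ((n:ℝ) ^ ((r - 1) * k - 1) * 2 ^ (((r - 1) * k - 1) ^ r)) * π ^ k
      ≤ ((k:ℝ) * 2 ^ (((r - 1) * k - 1) ^ r)) * (A ^ K / n) := by
    intro k hk
    rw [Finset.mem_Icc] at hk
    have e1 : (n:ℝ) ^ ((r - 1) * k - 1) * π ^ k ≤ A ^ K / n := by
      rw [le_div_iff₀ hn']
      have : 1 ≤ (r - 1) * k := Nat.mul_pos (by omega) (by omega)
      calc (n:ℝ) ^ ((r - 1) * k - 1) * π ^ k * n = (n:ℝ) ^ ((r - 1) * k - 1 + 1) * π ^ k := by ring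
        _ = (π * (n:ℝ) ^ (r - 1)) ^ k := by rw [Nat.sub_add_cancel this, pow_mul, mul_pow]; ring
        _ ≤ A ^ k := pow_le_pow_left₀ (by positivity) hA k
        _ ≤ A ^ K := pow_le_pow_right₀ hA1 hk.2
    calc (k:ℝ) * ((n:ℝ) ^ ((r - 1) * k - 1) * 2 ^ (((r - 1) * k - 1) ^ r)) * π ^ k
        = ((k:ℝ) * 2 ^ (((r - 1) * k - 1) ^ r)) * ((n:ℝ) ^ ((r - 1) * k - 1) * π ^ k) := by ring
      _ ≤ _ := mul_le_mul_of_nonneg_left e1 (by positivity)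
  have h3 := Finset.sum_le_sum h2
  rw [← Finset.sum_mul] at h3
  have h4 : 1 / (n:ℝ) ≤ A ^ K / n := by
    apply div_le_div_of_nonneg_right _ hn'.le
    exact one_le_pow₀ hA1
  have h5 : (CKconst r K + 1) * A ^ K / n = CKconst r K * (A ^ K / n) + A ^ K / n := by ring
  rw [h5]
  unfold Rm
  exact add_le_add h3 (h1.trans h4)

end Numeric


/-! ### Choice of parameters -/
section Params

set_option maxHeartbeats 2000000 in
lemma num_params (n r N M : ℕ) (ℓ γ c0 gn : ℝ) (hr : 4 ≤ r) (hn : 2 * r ≤ n) (hℓ : 1 ≤ ℓ) (hγ0 : 0 ≤ γ)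
    (hγ : 4 * γ + 6 * r ≤ ℓ) (hγg : γ ≤ gn) (hg : 8 ≤ gn) (hNM : (n:ℝ) * N = r * M) (hc0 : 0 < c0)
    (hN : c0 * (n:ℝ) ≤ N) (hθ : 4 * ℓ * (r / n + ℓ / (c0 * n)) ≤ 1) :
    ∃ m mx : ℕ, 0 < m ∧ m ≤ mx ∧ mx ≤ m + ⌊gn * n⌋₊ ∧ m + 2 * N ≤ M ∧ (1 / 2 : ℝ) ≤ m / mx ∧
      ℓ - 3 * γ - 6 * r ≤ (m / mx : ℝ) * (ℓ + γ) ∧ (n:ℝ) / r * (ℓ + γ) + n ≤ mx ∧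
      ((m : ℝ) / ((M:ℝ) - N)) < 1 ∧
      N * (((m : ℝ) / ((M:ℝ) - N)) / (1 - ((m : ℝ) / ((M:ℝ) - N)))) ≤ ℓ - γ + 1 := by
  have hr' : (4:ℝ) ≤ r := by exact_mod_cast hr
  have hr0 : (0:ℝ) < r := by linarith
  have hn' : 2 * (r:ℝ) ≤ n := by exact_mod_cast hn
  have hn0 : (0:ℝ) < n := by linarith
  have hN0 : (0:ℝ) < N := lt_of_lt_of_le (by positivity) hN
  have hMe : (M:ℝ) = n / r * N := by field_simp; linarith
  have hM0 : (0:ℝ) < M := by rw [hMe]; positivity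
  obtain ⟨a, ha⟩ : ∃ a : ℝ, a = n / r := ⟨_, rfl⟩
  have ha2 : 2 ≤ a := by rw [ha, le_div_iff₀ hr0]; linarith
  have har : a * r = n := by rw [ha]; field_simp
  rw [← ha] at hMe ⊢
  have hga : 0 ≤ ℓ - γ := by linarith
  refine ⟨⌊a * (ℓ - γ)⌋₊, ⌈a * (ℓ + γ) + n⌉₊, ?_⟩
  have f1 : (⌊a * (ℓ - γ)⌋₊ : ℝ) ≤ a * (ℓ - γ) := Nat.floor_le (by positivity)
  have f2 : a * (ℓ - γ) < (⌊a * (ℓ - γ)⌋₊ : ℝ) + 1 := Nat.lt_floor_add_one _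
  have g1 : a * (ℓ + γ) + n ≤ (⌈a * (ℓ + γ) + n⌉₊ : ℝ) := Nat.le_ceil _
  have g2 : (⌈a * (ℓ + γ) + n⌉₊ : ℝ) < a * (ℓ + γ) + n + 1 := Nat.ceil_lt_add_one (by positivity)
  obtain ⟨m, hm⟩ : ∃ m : ℕ, m = ⌊a * (ℓ - γ)⌋₊ := ⟨_, rfl⟩
  obtain ⟨mx, hmx⟩ : ∃ m : ℕ, m = ⌈a * (ℓ + γ) + n⌉₊ := ⟨_, rfl⟩
  rw [← hm] at f1 f2 ⊢
  rw [← hmx] at g1 g2 ⊢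
  have hag : 0 ≤ a * γ := by positivity
  have x1 : a * (ℓ - γ) = a * ℓ - a * γ := by ring
  have x2 : a * (ℓ + γ) = a * ℓ + a * γ := by ring
  have x3 : 2 * (ℓ - γ) ≤ a * (ℓ - γ) := mul_le_mul_of_nonneg_right ha2 hga
  have hmp : (0:ℝ) < m := by linarith
  have hmmx : (m:ℝ) ≤ mx := by linarith
  have hmxp : (0:ℝ) < mx := by linarith
  have hdiff : (mx:ℝ) - m ≤ a * (2 * γ + 3 * r) := by
    have : a * (2 * γ + 3 * r) = 2 * (a * γ) + 3 * (a * r) := by ring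
    rw [this, har]; linarith
  -- ratio
  have hrat : (1 - (m / mx : ℝ)) * ℓ ≤ 2 * γ + 3 * r := by
    have e1 : (1 - (m / mx : ℝ)) = (mx - m) / mx := by field_simp
    rw [e1, div_mul_eq_mul_div, div_le_iff₀ hmxp]
    have : a * ℓ ≤ mx := by linarith
    calc ((mx:ℝ) - m) * ℓ ≤ a * (2 * γ + 3 * r) * ℓ := mul_le_mul_of_nonneg_right hdiff (by linarith)
      _ = (2 * γ + 3 * r) * (a * ℓ) := by ring
      _ ≤ (2 * γ + 3 * r) * mx := mul_le_mul_of_nonneg_left this (by positivity)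
  have hρ1 : (m / mx : ℝ) ≤ 1 := by rw [div_le_one hmxp]; exact hmmx
  have hρ12 : (1 / 2 : ℝ) ≤ m / mx := by
    by_contra h
    push Not at h
    have := mul_lt_mul_of_pos_right (by linarith : (1/2:ℝ) < 1 - m / mx) (by linarith : (0:ℝ) < ℓ)
    linarith
  -- theta
  obtain ⟨θ, hθd⟩ : ∃ θ : ℝ, θ = r / n + ℓ / (c0 * n) := ⟨_, rfl⟩
  have hθ0 : 0 ≤ θ := by rw [hθd]; positivity
  rw [← hθd] at hθ
  have hθℓ : θ * 1 ≤ θ * ℓ := mul_le_mul_of_nonneg_left hℓ hθ0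
  have hθ4 : θ ≤ 1 / 4 := by linarith
  have t1 : (r / n : ℝ) * M = N := by rw [hMe, ha]; field_simp
  have t2 : (m:ℝ) ≤ ℓ / (c0 * n) * M := by
    calc (m:ℝ) ≤ a * ℓ := by linarith
      _ ≤ ℓ / (c0 * n) * (a * N) := by
        rw [div_mul_eq_mul_div, le_div_iff₀ (by positivity)]
        have : a * ℓ * (c0 * n) ≤ a * ℓ * N := mul_le_mul_of_nonneg_left hN (by positivity)
        linarith
      _ = _ := by rw [hMe]
  have t3 : (N:ℝ) + m ≤ θ * M := by rw [hθd, add_mul, t1]; linarith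
  have t4 : (N:ℝ) ≤ θ * M := by linarith
  have t5 : θ * (M:ℝ) ≤ 1 / 4 * M := mul_le_mul_of_nonneg_right hθ4 hM0.le
  have hMN : (0:ℝ) < (M:ℝ) - N := by linarith
  refine ⟨by exact_mod_cast hmp, by exact_mod_cast hmmx, ?_, ?_, hρ12, ?_, g1, ?_, ?_⟩
  · have k1 : gn * n < (⌊gn * n⌋₊ : ℝ) + 1 := Nat.lt_floor_add_one _
    have k2 : a * (2 * γ) ≤ gn * n / 2 := by
      have : γ * (4 * a) ≤ gn * n := mul_le_mul hγg (by rw [← har]; linarith [mul_le_mul_of_nonneg_left hr' (by linarith : (0:ℝ) ≤ a)]) (by positivity) (by linarith)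
      linarith
    have k3 : 8 * (n:ℝ) ≤ gn * n := mul_le_mul_of_nonneg_right hg hn0.le
    have : (mx:ℝ) ≤ m + ⌊gn * n⌋₊ := by linarith
    exact_mod_cast this
  · have : (m:ℝ) + 2 * N ≤ M := by linarith
    exact_mod_cast this
  · have : (1 - (m / mx : ℝ)) * (ℓ + γ) ≤ 2 * (2 * γ + 3 * r) := by
      calc (1 - (m / mx : ℝ)) * (ℓ + γ) ≤ (1 - (m / mx : ℝ)) * (2 * ℓ) :=
            mul_le_mul_of_nonneg_left (by linarith) (by linarith)
        _ ≤ _ := by linarith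
    linarith
  · rw [div_lt_one hMN]; linarith
  · have hM3 : (0:ℝ) < (M:ℝ) - N - m := by linarith
    have e1 : ((m : ℝ) / ((M:ℝ) - N)) / (1 - ((m : ℝ) / ((M:ℝ) - N))) = m / ((M:ℝ) - N - m) := by
      have : (1 - ((m : ℝ) / ((M:ℝ) - N))) = ((M:ℝ) - N - m) / ((M:ℝ) - N) := by field_simp
      rw [this]; field_simp
    rw [e1, ← mul_div_assoc, div_le_iff₀ hM3]
    have u1 : (N:ℝ) * m ≤ M * (ℓ - γ) := by rw [hMe]; calc (N:ℝ) * m ≤ N * (a * (ℓ - γ)) := mul_le_mul_of_nonneg_left f1 hN0.le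
        _ = _ := by ring
    have u2 : (1 - θ) * M ≤ (M:ℝ) - N - m := by linarith
    have u3 : (ℓ - γ) ≤ (ℓ - γ + 1) * (1 - θ) := by
      have v1 : θ * (ℓ - γ + 1) ≤ θ * (2 * ℓ) := mul_le_mul_of_nonneg_left (by linarith) hθ0
      have v2 : (ℓ - γ + 1) * (1 - θ) = ℓ - γ + 1 - θ * (ℓ - γ + 1) := by ring
      linarith
    calc (N:ℝ) * m ≤ M * (ℓ - γ) := u1
      _ ≤ M * ((ℓ - γ + 1) * (1 - θ)) := mul_le_mul_of_nonneg_left u3 hM0.le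
      _ = (ℓ - γ + 1) * ((1 - θ) * M) := by ring
      _ ≤ _ := mul_le_mul_of_nonneg_left u2 (by linarith)

end Params


/-! ### The main estimate for fixed `n` -/
section FixedMain
variable {n r u : ℕ} {F : Finset (Finset (Fin r))}

def Rbnd (r K : ℕ) (n ℓ c0 : ℝ) : ℝ := (CKconst r K + 1) * (2 * ℓ / c0) ^ K / n

def bnd (r K : ℕ) (n ℓ γ c0 ε : ℝ) : ℝ :=
  Rbnd r K n ℓ c0 + Real.exp (-γ) + Real.exp (-(n / (4 * ℓ)))
    + (Real.exp (1 - γ) + (Real.exp (r ^ 2 * (ℓ + 1) / (c0 * n)) - 1))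
    + 2 * (4 * Real.exp 1 * (ε * ℓ * (Real.exp (6 * r) * ℓ ^ 3)) + r * Rbnd r K n ℓ c0)
    + r ^ 5 * Real.exp 2 * ((2 * ℓ / c0) ^ 2 * (Real.exp (6 * r) * ℓ ^ 3) / n)

theorem fixed_main (hu : 2 ≤ u) (hFc : ∀ e ∈ F, e.card = u) (hF : Nice u F) (hF0 : F.Nonempty) (hr : 4 ≤ r)
    (hn : 2 * r ≤ n) (ℓ γ c0 gn ε x : ℝ) (hℓd : ℓ = Real.log n) (hℓ : 1 ≤ ℓ) (hγ0 : 0 ≤ γ) (hγ : 4 * γ + 6 * r ≤ ℓ)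
    (hγl : γ ≤ Real.log ℓ) (hγg : γ ≤ gn) (hg : 8 ≤ gn) (hc0 : 0 < c0) (hc1 : c0 ≤ 1)
    (hN : c0 * (n:ℝ) ^ (r - 1) ≤ Ndeg F n) (hθ : 4 * ℓ * (r / n + ℓ / (c0 * n)) ≤ 1)
    (hε0 : 0 ≤ ε) (hε2 : ε ≤ 1 / 2) (D : ℕ) (hD : (1 + Real.exp 3) * ℓ ≤ D) (hD1 : 1 ≤ D) (hx0 : 0 ≤ x)
    (hx : x ^ F.card * n = 1)
    (hεx : 2 ^ F.card * (r * (((1 + r * D : ℕ) : ℝ) ^ r) ^ r * r) * ((4 * ℓ / c0) * x) ≤ ε) :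
    ∃ μ : PMF ((Fin (Nat.choose n u) → Finset (Fin n)) × (Fin (Mnum F n) → FE n)),
      UniformOn μ Prod.fst (ValidOrdU u n) ∧ UniformOn μ Prod.snd (ValidOrdH F n) ∧
      ENNReal.ofReal (1 - bnd r (F.card + 2) n ℓ γ c0 ε) ≤ μ.toOuterMeasure (evt u F n ⌊gn * n⌋₊) := by
  have hs : 0 < F.card := Finset.card_pos.2 hF0
  have hr' : (4:ℝ) ≤ r := by exact_mod_cast hr
  have hr0 : (0:ℝ) < r := by linarith
  have hn' : 2 * (r:ℝ) ≤ n := by exact_mod_cast hn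
  have hnp : 0 < n := by omega
  have hn0 : (0:ℝ) < n := by linarith
  have hn1 : (1:ℝ) ≤ n := by linarith
  have hℓ0 : 0 < ℓ := by linarith
  have hNM : (n:ℝ) * Ndeg F n = r * Mnum F n := by exact_mod_cast (n_mul_Ndeg (F := F) (n := n))
  have hMle : Mnum F n ≤ n ^ r := Mnum_le
  have hpw : (n:ℝ) ≤ (n:ℝ) ^ (r - 1) := by
    calc (n:ℝ) = (n:ℝ) ^ 1 := (pow_one _).symm
      _ ≤ _ := pow_le_pow_right₀ hn1 (by omega)
  have hN1 : c0 * (n:ℝ) ≤ Ndeg F n := (mul_le_mul_of_nonneg_left hpw hc0.le).trans hN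
  obtain ⟨m, mx, hm0, hmmx, hgap, hm2, hρ2, hρℓ, hmxge, hy1, hyN⟩ :=
    num_params n r (Ndeg F n) (Mnum F n) ℓ γ c0 gn hr hn hℓ hγ0 hγ hγg hg hNM hc0 hN1 hθ
  -- the degree is large
  have hA0 : ℓ / (c0 * n) ≤ 1 / 4 := by
    have : 0 ≤ (r / n : ℝ) := by positivity
    have h0 : 0 ≤ ℓ / (c0 * n) := by positivity
    have h2 : 1 * (r / n + ℓ / (c0 * n)) ≤ ℓ * (r / n + ℓ / (c0 * n)) := mul_le_mul_of_nonneg_right hℓ (by positivity)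
    linarith
  have hNreal : (4:ℝ) ≤ Ndeg F n := by
    rw [div_le_iff₀ (by positivity)] at hA0
    linarith
  have hN2 : 2 ≤ Ndeg F n := by
    have : ((2:ℕ):ℝ) ≤ Ndeg F n := by push_cast; linarith
    exact_mod_cast this
  have hNpos : (0:ℝ) < Ndeg F n := by linarith
  obtain ⟨π, hπ⟩ : ∃ π : ℝ, π = (ℓ + γ) / Ndeg F n := ⟨_, rfl⟩
  have hπ0 : 0 < π := by rw [hπ]; positivity
  have hπN : π * Ndeg F n = ℓ + γ := by rw [hπ]; field_simp
  have hπN2 : π * Ndeg F n ≤ 2 * ℓ := by linarith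
  have hA : π * (n:ℝ) ^ (r - 1) ≤ 2 * ℓ / c0 := by
    rw [le_div_iff₀ hc0]
    calc π * (n:ℝ) ^ (r - 1) * c0 = π * (c0 * (n:ℝ) ^ (r - 1)) := by ring
      _ ≤ π * Ndeg F n := mul_le_mul_of_nonneg_left hN hπ0.le
      _ ≤ _ := hπN2
  have hA1 : 1 ≤ 2 * ℓ / c0 := by rw [le_div_iff₀ hc0]; linarith
  have hπ2 : π ≤ 1 / 2 := by
    have h1 : π * n ≤ 2 * ℓ / c0 := (mul_le_mul_of_nonneg_left hpw hπ0.le).trans hA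
    have h2 : π ≤ 2 * ℓ / c0 / n := by rw [le_div_iff₀ hn0]; exact h1
    have h3 : 2 * ℓ / c0 / n = 2 * (ℓ / (c0 * n)) := by field_simp
    linarith
  -- p
  have hε1 : 0 < 1 - ε := by linarith
  obtain ⟨p, hpd⟩ : ∃ p : ℝ, p = (π / (1 - ε)) ^ ((F.card : ℝ)⁻¹) := ⟨_, rfl⟩
  have hp0 : 0 ≤ p := by rw [hpd]; positivity
  have hps : p ^ F.card = π / (1 - ε) := by
    rw [hpd]; exact Real.rpow_inv_natCast_pow (by positivity) hs.ne'
  have hps2 : p ^ F.card ≤ 2 * π := by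
    rw [hps, div_le_iff₀ hε1]
    have : π * (2 * ε) ≤ π * 1 := mul_le_mul_of_nonneg_left (by linarith) hπ0.le
    linarith
  have hp1 : p ≤ 1 := by
    by_contra h
    push Not at h
    have := one_lt_pow₀ h hs.ne'
    linarith
  have hπp : π = p ^ F.card * (1 - ε) := by rw [hps]; field_simp
  have hL1 : (1:ℝ) ≤ 4 * ℓ / c0 := by rw [le_div_iff₀ hc0]; linarith
  have hpL : p ^ F.card * (n:ℝ) ^ (r - 1) ≤ 4 * ℓ / c0 := by
    calc p ^ F.card * (n:ℝ) ^ (r - 1) ≤ 2 * π * (n:ℝ) ^ (r - 1) := mul_le_mul_of_nonneg_right hps2 (by positivity)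
      _ = 2 * (π * (n:ℝ) ^ (r - 1)) := by ring
      _ ≤ 2 * (2 * ℓ / c0) := by linarith
      _ = _ := by ring
  obtain ⟨c, hc0', hcH, hcG, hcE⟩ := oneshot (n := n) (K := F.card + 2) (D := D) hu hFc hF (by omega) p π ε (4 * ℓ / c0) x hp0 hp1 hπ0 (by linarith)
    hπp (by linarith) hD1 hL1 hx0 hx hpL hεx
  obtain ⟨ρ, hρ⟩ : ∃ ρ : ℝ, ρ = m / mx := ⟨_, rfl⟩
  obtain ⟨y, hy⟩ : ∃ y : ℝ, y = (m : ℝ) / ((Mnum F n : ℝ) - Ndeg F n) := ⟨_, rfl⟩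
  obtain ⟨μ, h1, h2, h3⟩ := fin_coupling hu hFc hF hF0 hnp (by omega : 2 ≤ F.card + 2) hD1 m mx ⌊gn * n⌋₊ (r ^ 2 * n ^ (r - 2))
    hm0 hmmx hgap π p (1 / ℓ) ρ y hπ0.le (by linarith) hp0 hp1 (by positivity) hρ hm2 (by omega) le_rfl hy c hc0' hcH hcG hcE
  refine ⟨μ, h1, h2, le_trans (ENNReal.ofReal_le_ofReal ?_) h3⟩
  rw [← hρ] at hρ2 hρℓ
  rw [← hy] at hy1 hyN
  have hρ1 : ρ ≤ 1 := by
    rw [hρ, div_le_one (by exact_mod_cast (lt_of_lt_of_le hm0 hmmx))]; exact_mod_cast hmmx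
  have hE : n * Real.exp (-(ρ * π * Ndeg F n)) ≤ Real.exp (6 * r) * ℓ ^ 3 := by
    have e1 : ρ * π * Ndeg F n = ρ * (ℓ + γ) := by rw [mul_assoc, hπN]
    rw [e1]
    have e2 : Real.exp (6 * r) * ℓ ^ 3 = Real.exp (6 * r + 3 * Real.log ℓ) := by
      rw [Real.exp_add]; congr 1
      nth_rewrite 1 [← Real.exp_log hℓ0]
      rw [← Real.exp_nat_mul]; norm_num
    have e3 : (n:ℝ) = Real.exp ℓ := by rw [hℓd, Real.exp_log hn0]
    rw [e2, e3, ← Real.exp_add]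
    apply Real.exp_le_exp.2
    linarith
  have hy0 : 0 ≤ y := by
    rw [hy]
    apply div_nonneg (by positivity)
    have : (m:ℝ) + 2 * Ndeg F n ≤ Mnum F n := by exact_mod_cast hm2
    have : (0:ℝ) ≤ m := by positivity
    linarith
  have hπM : π * Mnum F n = n / r * (ℓ + γ) := by
    rw [← hπN]; field_simp; linarith
  have b1 : Rm F n (F.card + 2) D π ≤ Rbnd r (F.card + 2) n ℓ c0 :=
    num_Rm F n (F.card + 2) D hr hnp π _ hπ0.le hA1 hA (by rw [← hℓd]; exact hπN2) (by rw [← hℓd]; exact hD)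
  have b2 := num_T2 n (Ndeg F n) hnp π γ (by linarith) (by rw [hπN, hℓd])
  have b3 := num_T3 n (Mnum F n) mx π (1 / ℓ) ℓ hπ0.le hℓ rfl (by
      rw [hπM]
      have : 1 / ℓ * ((n:ℝ) / r * (ℓ + γ)) = n * ((ℓ + γ) / (ℓ * r)) := by field_simp
      rw [this, div_eq_mul_inv (n:ℝ) 2]
      apply mul_le_mul_of_nonneg_left _ hn0.le
      rw [div_le_iff₀ (by positivity)]
      have : ℓ * 4 ≤ ℓ * r := mul_le_mul_of_nonneg_left hr' hℓ0.le
      linarith) (by rw [hπM]; exact hmxge)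
  have hz0 : 0 ≤ y / (1 - y) := div_nonneg hy0 (by linarith)
  have b4 := num_T4 n (Ndeg F n) (r ^ 2 * n ^ (r - 2)) hnp γ y (r ^ 2 * (ℓ + 1) / (c0 * n)) hy1 (by rw [← hℓd]; exact hyN) (by
      rw [le_div_iff₀ (by positivity)]
      have e1 : (n:ℝ) ^ (r - 2) * n = (n:ℝ) ^ (r - 1) := by rw [← pow_succ]; congr 1; omega
      push_cast
      calc (r:ℝ) ^ 2 * (n:ℝ) ^ (r - 2) * (y / (1 - y)) * (c0 * n)
          = r ^ 2 * (c0 * ((n:ℝ) ^ (r - 2) * n) * (y / (1 - y))) := by ring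
        _ ≤ r ^ 2 * (Ndeg F n * (y / (1 - y))) := by rw [e1]; gcongr
        _ ≤ r ^ 2 * (ℓ + 1) := by
          apply mul_le_mul_of_nonneg_left _ (by positivity)
          linarith)
  have b6 := num_T6 n (Ndeg F n) (by omega) π (p ^ F.card) ρ ε ℓ _ hπ0.le (by linarith) hπp (by linarith) hε0 hε2
    (by linarith) hρ1 hπN2 hE
  have b7 := num_T7 n (Ndeg F n) (Mnum F n) r hr hnp hN2 π ρ _ _ hπ0.le (by linarith) (by linarith) hρ1 hMle hA hE
  have hR0 : 0 ≤ Rbnd r (F.card + 2) n ℓ c0 := by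
    unfold Rbnd
    have := CKconst_nonneg r (F.card + 2)
    positivity
  have b8 : (n * ((1 - ρ * π) ^ Ndeg F n - (1 - ρ * p ^ F.card) ^ Ndeg F n) + r * Rm F n (F.card + 2) D π) / ρ ≤
      2 * (4 * Real.exp 1 * (ε * ℓ * (Real.exp (6 * r) * ℓ ^ 3)) + r * Rbnd r (F.card + 2) n ℓ c0) := by
    rw [div_le_iff₀ (by linarith)]
    have c1 : r * Rm F n (F.card + 2) D π ≤ r * Rbnd r (F.card + 2) n ℓ c0 := mul_le_mul_of_nonneg_left b1 hr0.le
    have c2 : 0 ≤ 4 * Real.exp 1 * (ε * ℓ * (Real.exp (6 * r) * ℓ ^ 3)) + r * Rbnd r (F.card + 2) n ℓ c0 := by positivity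
    have c3 := mul_le_mul_of_nonneg_left hρ2 (mul_nonneg (by norm_num : (0:ℝ) ≤ 2) c2)
    linarith
  unfold betaErr bnd
  linarith

end FixedMain


/-! ### Asymptotics -/
section Asymp

def c0c (r : ℕ) : ℝ := 1 / (2 ^ r * (r.factorial : ℝ))

lemma c0c_pos (r : ℕ) : 0 < c0c r := by unfold c0c; positivity

lemma c0c_le (r : ℕ) : c0c r ≤ 1 := by
  unfold c0c
  rw [div_le_one (by positivity)]
  have h1 : (1:ℝ) ≤ 2 ^ r := one_le_pow₀ (by norm_num)
  have h2 : (1:ℝ) ≤ r.factorial := by exact_mod_cast r.factorial_pos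
  nlinarith

lemma Ndeg_ge {n r : ℕ} (F : Finset (Finset (Fin r))) (hr : 4 ≤ r) (hn : 2 * r ≤ n) :
    c0c r * (n:ℝ) ^ (r - 1) ≤ Ndeg F n := by
  have hn0 : (0:ℝ) < n := by
    have : 0 < n := by omega
    exact_mod_cast this
  have hNM : (n:ℝ) * Ndeg F n = r * Mnum F n := by exact_mod_cast (n_mul_Ndeg (F := F) (n := n))
  have h1 : (n.choose r : ℝ) ≤ Mnum F n := by exact_mod_cast (Mnum_ge (F := F) (n := n))
  have h2 : (((n + 1 - r : ℕ) : ℝ) ^ r) / r.factorial ≤ n.choose r := Nat.pow_le_choose r n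
  have h3 : (n:ℝ) / 2 ≤ ((n + 1 - r : ℕ) : ℝ) := by
    have : n ≤ 2 * (n + 1 - r) := by omega
    have : (n:ℝ) ≤ 2 * ((n + 1 - r : ℕ) : ℝ) := by exact_mod_cast this
    linarith
  have h4 : ((n:ℝ) / 2) ^ r ≤ ((n + 1 - r : ℕ) : ℝ) ^ r := pow_le_pow_left₀ (by positivity) h3 r
  have h5 : ((n:ℝ) / 2) ^ r / r.factorial ≤ Mnum F n :=
    (div_le_div_of_nonneg_right h4 (by positivity)).trans (h2.trans h1)
  have h6 : (1:ℝ) * Mnum F n ≤ r * Mnum F n :=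
    mul_le_mul_of_nonneg_right (by exact_mod_cast (by omega : 1 ≤ r)) (by positivity)
  have h7 : ((n:ℝ) / 2) ^ r / r.factorial = n * (c0c r * (n:ℝ) ^ (r - 1)) := by
    unfold c0c
    have : (n:ℝ) ^ r = n * (n:ℝ) ^ (r - 1) := by rw [← pow_succ']; congr 1; omega
    rw [div_pow, this]
    field_simp
  rw [h7] at h5
  refine le_of_mul_le_mul_left ?_ hn0
  linarith

lemma lim_log_pow (k : ℕ) (a : ℝ) (ha : 0 < a) :
    Tendsto (fun n : ℕ => Real.log n ^ k * (n:ℝ) ^ (-a)) atTop (nhds 0) := by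
  have h := (isLittleO_log_rpow_rpow_atTop (k:ℝ) ha).tendsto_div_nhds_zero.comp tendsto_natCast_atTop_atTop
  refine h.congr (fun n => ?_)
  simp only [Function.comp]
  rw [Real.rpow_natCast, Real.rpow_neg (by positivity), div_eq_mul_inv]

lemma lim_log_pow_div (k : ℕ) : Tendsto (fun n : ℕ => Real.log n ^ k / (n:ℝ)) atTop (nhds 0) := by
  refine (lim_log_pow k 1 one_pos).congr (fun n => ?_)
  rw [Real.rpow_neg_one, div_eq_mul_inv]

lemma lim_log : Tendsto (fun n : ℕ => Real.log n) atTop atTop :=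
  Real.tendsto_log_atTop.comp tendsto_natCast_atTop_atTop

def gam (g : ℕ → ℝ) (n : ℕ) : ℝ := min (g n) (Real.log (Real.log n))

lemma lim_gam {g : ℕ → ℝ} (hg : Tendsto g atTop atTop) : Tendsto (gam g) atTop atTop := by
  have h2 : Tendsto (fun n : ℕ => Real.log (Real.log n)) atTop atTop := Real.tendsto_log_atTop.comp lim_log
  rw [tendsto_atTop] at hg h2 ⊢
  intro b
  filter_upwards [hg b, h2 b] with n h1 h2
  exact le_min h1 h2

def epsn (s n : ℕ) : ℝ := (n:ℝ) ^ (-(1 / (2 * (s:ℝ))))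

lemma ev_theta (r : ℕ) (c0 : ℝ) (hc0 : 0 < c0) :
    ∀ᶠ n : ℕ in atTop, 4 * Real.log n * (r / n + Real.log n / (c0 * n)) ≤ 1 := by
  have h1 := (lim_log_pow_div 1).const_mul (4 * (r:ℝ))
  have h2 := (lim_log_pow_div 2).const_mul (4 / c0)
  have h := h1.add h2
  simp only [mul_zero, add_zero] at h
  filter_upwards [h.eventually_le_const one_pos, eventually_gt_atTop 0] with n hn hn0
  refine le_trans (le_of_eq ?_) hn
  have : (0:ℝ) < n := by exact_mod_cast hn0
  field_simp

lemma ev_loglog (r : ℕ) : ∀ᶠ n : ℕ in atTop, 4 * Real.log (Real.log n) + 6 * r ≤ Real.log n := by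
  have h1 : ∀ᶠ x : ℝ in atTop, 4 * Real.log x + 6 * r ≤ x := by
    have h := Real.isLittleO_log_id_atTop.tendsto_div_nhds_zero
    filter_upwards [h.eventually_le_const (by norm_num : (0:ℝ) < 1 / 8), eventually_ge_atTop (12 * (r:ℝ)),
      eventually_gt_atTop 0] with x h1 h2 h3
    simp only [id] at h1
    rw [div_le_iff₀ h3] at h1
    linarith
  exact lim_log.eventually h1

lemma ev_eps (s r : ℕ) (hs : 0 < s) (c0 : ℝ) (hc0 : 0 < c0) :
    ∀ᶠ n : ℕ in atTop, 2 ^ s * (r * (((1 + r * ⌈(1 + Real.exp 3) * Real.log n⌉₊ : ℕ) : ℝ) ^ r) ^ r * r) *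
      ((4 * Real.log n / c0) * (n:ℝ) ^ (-(1 / (s:ℝ)))) ≤ epsn s n := by
  have ha : 0 < 1 / (2 * (s:ℝ)) := by positivity
  obtain ⟨C1, hC1⟩ : ∃ C1 : ℝ, C1 = 1 + r * (2 + Real.exp 3) := ⟨_, rfl⟩
  have h := (lim_log_pow (r * r + 1) _ ha).const_mul (2 ^ s * (r * (C1 ^ r) ^ r * r) * (4 / c0))
  rw [mul_zero] at h
  filter_upwards [h.eventually_le_const one_pos, eventually_gt_atTop 0, lim_log.eventually_ge_atTop 1] with n hn hn0 hl
  have hn0' : (0:ℝ) < n := by exact_mod_cast hn0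
  have hx : (n:ℝ) ^ (-(1 / (s:ℝ))) = epsn s n * epsn s n := by
    unfold epsn
    rw [← Real.rpow_add hn0']
    congr 1
    field_simp; ring
  have hε0 : 0 < epsn s n := Real.rpow_pos_of_pos hn0' _
  have he : (n:ℝ) ^ (-(1 / (2 * (s:ℝ)))) = epsn s n := rfl
  rw [hx]
  rw [he] at hn
  obtain ⟨ℓ, hℓ⟩ : ∃ ℓ : ℝ, ℓ = Real.log n := ⟨_, rfl⟩
  rw [← hℓ] at hl hn ⊢
  have hD : (⌈(1 + Real.exp 3) * ℓ⌉₊ : ℝ) ≤ (2 + Real.exp 3) * ℓ := by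
    have := Nat.ceil_lt_add_one (by positivity : 0 ≤ (1 + Real.exp 3) * ℓ)
    linarith
  have hD2 : ((1 + r * ⌈(1 + Real.exp 3) * ℓ⌉₊ : ℕ) : ℝ) ≤ C1 * ℓ := by
    push_cast
    have := mul_le_mul_of_nonneg_left hD (by positivity : (0:ℝ) ≤ r)
    rw [hC1]; linarith
  have hD3 : (((1 + r * ⌈(1 + Real.exp 3) * ℓ⌉₊ : ℕ) : ℝ) ^ r) ^ r ≤ ((C1 * ℓ) ^ r) ^ r :=
    pow_le_pow_left₀ (by positivity) (pow_le_pow_left₀ (by positivity) hD2 r) r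
  calc _ ≤ 2 ^ s * (r * ((C1 * ℓ) ^ r) ^ r * r) * ((4 * ℓ / c0) * (epsn s n * epsn s n)) := by
        gcongr
    _ = (2 ^ s * (r * (C1 ^ r) ^ r * r) * (4 / c0) * (ℓ ^ (r * r + 1) * epsn s n)) * epsn s n := by
        rw [mul_pow, mul_pow, pow_succ ℓ (r * r), pow_mul ℓ r r]; ring
    _ ≤ 1 * epsn s n := mul_le_mul_of_nonneg_right hn hε0.le
    _ = _ := one_mul _

lemma lim_eps (s : ℕ) (hs : 0 < s) : Tendsto (epsn s) atTop (nhds 0) := by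
  refine (lim_log_pow 0 (1 / (2 * (s:ℝ))) (by positivity)).congr (fun n => ?_)
  rw [pow_zero, one_mul]; rfl

lemma lim_bnd (r K s : ℕ) (hs : 0 < s) (g : ℕ → ℝ) (hg : Tendsto g atTop atTop) (c0 : ℝ) (hc0 : 0 < c0) :
    Tendsto (fun n : ℕ => bnd r K n (Real.log n) (gam g n) c0 (epsn s n)) atTop (nhds 0) := by
  have hγ := lim_gam hg
  have hR : Tendsto (fun n : ℕ => Rbnd r K n (Real.log n) c0) atTop (nhds 0) := by
    have := (lim_log_pow_div K).const_mul ((CKconst r K + 1) * (2 / c0) ^ K)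
    rw [mul_zero] at this
    refine this.congr (fun n => ?_)
    unfold Rbnd
    rw [mul_div_assoc, mul_div_right_comm 2 _ c0, mul_pow]
    ring
  have t2 : Tendsto (fun n : ℕ => Real.exp (-(gam g n))) atTop (nhds 0) := Real.tendsto_exp_neg_atTop_nhds_zero.comp hγ
  have t3 : Tendsto (fun n : ℕ => Real.exp (-((n:ℝ) / (4 * Real.log n)))) atTop (nhds 0) := by
    refine Real.tendsto_exp_neg_atTop_nhds_zero.comp ?_
    have h1 := (lim_log_pow_div 1).const_mul 4
    rw [mul_zero] at h1
    have h2 : Tendsto (fun n : ℕ => 4 * (Real.log n ^ 1 / (n:ℝ))) atTop (nhdsWithin 0 (Set.Ioi 0)) := by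
      rw [tendsto_nhdsWithin_iff]
      refine ⟨h1, ?_⟩
      filter_upwards [eventually_gt_atTop 0, lim_log.eventually_ge_atTop 1] with n hn hl
      have : (0:ℝ) < n := by exact_mod_cast hn
      rw [Set.mem_Ioi]
      positivity
    refine h2.inv_tendsto_nhdsGT_zero.congr (fun n => ?_)
    simp only [Pi.inv_apply, pow_one]
    rw [← mul_div_assoc, inv_div]
  have t4 : Tendsto (fun n : ℕ => Real.exp (1 - gam g n)) atTop (nhds 0) := by
    have := t2.const_mul (Real.exp 1)
    rw [mul_zero] at this
    refine this.congr (fun n => ?_)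
    rw [← Real.exp_add]; rfl
  have t5 : Tendsto (fun n : ℕ => Real.exp (r ^ 2 * (Real.log n + 1) / (c0 * n)) - 1) atTop (nhds 0) := by
    have h1 := ((lim_log_pow_div 1).add (lim_log_pow_div 0)).const_mul ((r:ℝ) ^ 2 / c0)
    rw [add_zero, mul_zero] at h1
    have h2 := ((Real.continuous_exp.tendsto 0).comp h1).sub_const 1
    rw [Real.exp_zero, sub_self] at h2
    refine h2.congr (fun n => ?_)
    simp only [Function.comp]
    congr 2
    rw [pow_one, pow_zero, ← add_div, div_mul_div_comm]
  have t6 : Tendsto (fun n : ℕ => 4 * Real.exp 1 * (epsn s n * Real.log n * (Real.exp (6 * r) * Real.log n ^ 3))) atTop (nhds 0) := by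
    have := (lim_log_pow 4 (1 / (2 * (s:ℝ))) (by positivity)).const_mul (4 * Real.exp 1 * Real.exp (6 * r))
    rw [mul_zero] at this
    refine this.congr (fun n => ?_)
    unfold epsn
    ring
  have t7 : Tendsto (fun n : ℕ => r ^ 5 * Real.exp 2 * ((2 * Real.log n / c0) ^ 2 * (Real.exp (6 * r) * Real.log n ^ 3) / n)) atTop (nhds 0) := by
    have := (lim_log_pow_div 5).const_mul ((r:ℝ) ^ 5 * Real.exp 2 * (2 / c0) ^ 2 * Real.exp (6 * r))
    rw [mul_zero] at this
    refine this.congr (fun n => ?_)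
    ring
  have := ((((hR.add t2).add t3).add (t4.add t5)).add ((t6.add (hR.const_mul (r:ℝ))).const_mul 2)).add t7
  simp only [mul_zero, add_zero] at this
  exact this

end Asymp

/-- One may couple the random `u`-graph process with the random
`F`-graph process so that whp every `F`-edge of `H_{T_H}` whose copy of `F` is not in
`G_{T_G}` has a partner `F`-edge among those added between times `T_H` and
`T_H + ⌊g(n)n⌋`; i.e. whp `E ⊆ 𝓕`. -/
theorem statement_10 (u r : ℕ) (hu : 2 ≤ u) (hr : 4 ≤ r)
    (F : Finset (Finset (Fin r))) (hFcard : ∀ e ∈ F, e.card = u) (hF : Nice u F)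
    (g : ℕ → ℝ) (hg : GoodG g) :
    ∃ μ : (n : ℕ) →
        PMF ((Fin (Nat.choose n u) → Finset (Fin n)) × (Fin (Mnum F n) → FE n)),
      (∀ n, UniformOn (μ n) Prod.fst (ValidOrdU u n)) ∧
      (∀ n, UniformOn (μ n) Prod.snd (ValidOrdH F n)) ∧
      Tendsto (fun n => (μ n).toOuterMeasure
          {ω | ∀ h ∈ proc ω.2 (THit F n ω.2),
                 ¬ h.2 ⊆ proc ω.1 (TGHit u F n ω.1) →
                 ∃ h' ∈ proc ω.2 (THit F n ω.2 + ⌊g n * (n : ℝ)⌋₊),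
                   h' ∉ proc ω.2 (THit F n ω.2) ∧ Partner u h h'})
        atTop (nhds 1) := by
  have hF0 : F.Nonempty := F_nonempty hF.2.1
  have hs : 0 < F.card := Finset.card_pos.2 hF0
  let bb : ℕ → ℝ := fun n => bnd r (F.card + 2) n (Real.log n) (gam g n) (c0c r) (epsn F.card n)
  let good : ℕ → Prop := fun n => ∃ μ : PMF ((Fin (Nat.choose n u) → Finset (Fin n)) × (Fin (Mnum F n) → FE n)),
      UniformOn μ Prod.fst (ValidOrdU u n) ∧ UniformOn μ Prod.snd (ValidOrdH F n) ∧
      ENNReal.ofReal (1 - bb n) ≤ μ.toOuterMeasure (evt u F n ⌊g n * n⌋₊)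
  have hex : ∀ n, ∃ μ : PMF ((Fin (Nat.choose n u) → Finset (Fin n)) × (Fin (Mnum F n) → FE n)),
      UniformOn μ Prod.fst (ValidOrdU u n) ∧ UniformOn μ Prod.snd (ValidOrdH F n) ∧
      (good n → ENNReal.ofReal (1 - bb n) ≤ μ.toOuterMeasure (evt u F n ⌊g n * n⌋₊)) := by
    intro n
    by_cases h : good n
    · obtain ⟨μ, h1, h2, h3⟩ := h
      exact ⟨μ, h1, h2, fun _ => h3⟩
    · obtain ⟨μ, h1, h2⟩ := trivial_coupling (u := u) hF0 n
      exact ⟨μ, h1, h2, fun h' => absurd h' h⟩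
  choose μ h1 h2 h3 using hex
  refine ⟨μ, h1, h2, ?_⟩
  have hgood : ∀ᶠ n in atTop, good n := by
    have hγ := lim_gam hg.1
    filter_upwards [eventually_ge_atTop (2 * r), lim_log.eventually_ge_atTop 1, hγ.eventually_ge_atTop 0, ev_loglog r,
      hg.1.eventually_ge_atTop 8, ev_theta r (c0c r) (c0c_pos r), ev_eps F.card r hs (c0c r) (c0c_pos r),
      (lim_eps F.card hs).eventually_le_const (by norm_num : (0:ℝ) < 1 / 2)] with n a1 a2 a3 a4 a5 a6 a7 a8
    have hn0 : (0:ℝ) < n := by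
      have : 0 < n := by omega
      exact_mod_cast this
    have hγl : gam g n ≤ Real.log (Real.log n) := min_le_right _ _
    refine fixed_main hu hFcard hF hF0 hr a1 (Real.log n) (gam g n) (c0c r) (g n) (epsn F.card n)
      ((n:ℝ) ^ (-(1 / (F.card:ℝ)))) rfl a2 a3 (by linarith) hγl (min_le_left _ _) a5 (c0c_pos r) (c0c_le r)
      (Ndeg_ge F hr a1) a6 (Real.rpow_pos_of_pos hn0 _).le a8 ⌈(1 + Real.exp 3) * Real.log n⌉₊ (Nat.le_ceil _) ?_
      (Real.rpow_pos_of_pos hn0 _).le ?_ a7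
    · rw [Nat.one_le_ceil_iff]
      have := Real.exp_pos 3
      positivity
    · rw [← Real.rpow_natCast, ← Real.rpow_mul hn0.le]
      have : -(1 / (F.card:ℝ)) * F.card = -1 := by
        have : (F.card:ℝ) ≠ 0 := by exact_mod_cast hs.ne'
        field_simp
      rw [this, Real.rpow_neg_one, inv_mul_cancel₀ hn0.ne']
  have hlim : Tendsto (fun n => ENNReal.ofReal (1 - bb n)) atTop (nhds 1) := by
    have h := (lim_bnd r (F.card + 2) F.card hs g hg.1 (c0c r) (c0c_pos r)).const_sub 1
    rw [sub_zero] at h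
    have h' := (ENNReal.continuous_ofReal.tendsto 1).comp h
    rw [ENNReal.ofReal_one] at h'
    exact h'
  refine tendsto_of_tendsto_of_tendsto_of_le_of_le' hlim tendsto_const_nhds ?_ ?_
  · filter_upwards [hgood] with n hn
    exact h3 n hn
  · refine Eventually.of_forall (fun n => ?_)
    have hle : (μ n).toOuterMeasure (evt u F n ⌊g n * n⌋₊) ≤ (μ n).toOuterMeasure Set.univ :=
      (μ n).toOuterMeasure.mono (Set.subset_univ _)
    have hu1 : (μ n).toOuterMeasure Set.univ = 1 := by
      rw [PMF.toOuterMeasure_apply_eq_one_iff]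
      exact Set.subset_univ _
    rw [hu1] at hle
    exact hle
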